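/- arXiv:math/0507317 — 5 statements merged into one kernel-verified Lean document; each statement's English description precedes it below -/
import Mathlib

section
/- For every Schwartz function f on ℝⁿ×ℝⁿ, the ℏ-scaled pseudodifferential operator op_ℏ(f) is a bounded operator on L²(ℝⁿ) for each 0<ℏ≤1, and lim_{ℏ→0⁺} ‖op_ℏ(f)‖ = sup_{(x,θ)∈ℝⁿ×ℝⁿ} |f(x,θ)|, where ‖·‖ is the operator norm on L²(ℝⁿ). -/
open MeasureTheory Filter Topology Set
open scoped ContDiff

noncomputable section

/-- `ℝⁿ`. -/
abbrev X (n : ℕ) : Type := Fin n → ℝ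

/-- `L²(ℝⁿ)`. -/
abbrev L2X (n : ℕ) := Lp ℂ 2 (volume : Measure (X n))

/-- `T` is the ℏ-scaled pseudodifferential operator `op_ℏ(φ)` on `L²(ℝⁿ)`:
`(op_ℏ(φ)ξ)(x) = (2π)^{-n} ∫ e^{i⟨x,θ⟩} φ(x,ℏθ) (ℱξ)(θ) dθ`, where
`(ℱξ)(θ) = ∫ e^{-i⟨y,θ⟩} ξ(y) dy`.  The formula is required for every
integrable representative `ξ` of an element `ξL ∈ L²`; this determines `T`
on the dense subspace `L¹ ∩ L²`. -/
def opSpec (n : ℕ) (ℏ : ℝ) (φ : X n × X n → ℂ) (T : L2X n →L[ℂ] L2X n) : Prop :=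
  ∀ (ξL : L2X n) (ξ : X n → ℂ), Integrable ξ volume → (⇑ξL =ᵐ[volume] ξ) →
    ⇑(T ξL) =ᵐ[volume] fun x =>
      (((2 * Real.pi) ^ n)⁻¹ : ℝ) •
        ∫ θ : X n, Complex.exp (Complex.I * Complex.ofReal (∑ i, x i * θ i)) * φ (x, ℏ • θ) *
          ∫ y : X n, Complex.exp (-(Complex.I) * Complex.ofReal (∑ i, y i * θ i)) * ξ y



namespace PsiDO
open scoped FourierTransform

/-- `e(t) = exp(2π i t)`. -/
def ee (t : ℝ) : ℂ := Complex.exp ((2 * Real.pi * t : ℝ) * Complex.I)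

lemma ee_add (s t : ℝ) : ee (s + t) = ee s * ee t := by
  unfold ee
  rw [← Complex.exp_add]
  congr 1
  push_cast
  ring

lemma norm_ee (t : ℝ) : ‖ee t‖ = 1 := Complex.norm_exp_ofReal_mul_I _

lemma ee_zero : ee 0 = 1 := by simp [ee]

lemma conj_ee (t : ℝ) : (starRingEnd ℂ) (ee t) = ee (-t) := by
  unfold ee
  rw [← Complex.exp_conj]
  congr 1
  rw [map_mul, Complex.conj_I, Complex.conj_ofReal]
  push_cast
  ring

@[fun_prop]
lemma continuous_ee : Continuous ee := by
  unfold ee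
  fun_prop

/-- Fourier inversion on `X n`. -/
lemma fourier_inv {n : ℕ} (u : X n → ℂ) (hc : Continuous u) (hi : Integrable u volume)
    (hF : Integrable (fun θ : X n => ∫ y : X n, ee (-(y ⬝ᵥ θ)) * u y) volume) (x : X n) :
    ∫ θ : X n, ee (x ⬝ᵥ θ) * ∫ y : X n, ee (-(y ⬝ᵥ θ)) * u y = u x := by
  have mp := PiLp.volume_preserving_ofLp (Fin n)
  have me : MeasurableEmbedding (WithLp.ofLp : EuclideanSpace ℝ (Fin n) → (Fin n → ℝ)) :=
    (MeasurableEquiv.toLp 2 (Fin n → ℝ)).symm.measurableEmbedding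
  have h1 : ∀ w : EuclideanSpace ℝ (Fin n), 𝓕 (u ∘ (WithLp.ofLp : EuclideanSpace ℝ (Fin n) → (Fin n → ℝ))) w
      = ∫ y : X n, ee (-(y ⬝ᵥ w.ofLp)) * u y := by
    intro w
    rw [Real.fourier_eq', ← mp.integral_comp me]
    congr 1
    ext v
    simp only [ee, Function.comp, smul_eq_mul, EuclideanSpace.inner_eq_star_dotProduct]
    congr 3
    simp [dotProduct_comm]
  have h2 := Continuous.fourierInv_fourier_eq (f := u ∘ (WithLp.ofLp : EuclideanSpace ℝ (Fin n) → (Fin n → ℝ)))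
    (by fun_prop) ((mp.integrable_comp_emb me).2 hi)
    (by
      have : 𝓕 (u ∘ (WithLp.ofLp : EuclideanSpace ℝ (Fin n) → (Fin n → ℝ))) =
        (fun θ : X n => ∫ y : X n, ee (-(y ⬝ᵥ θ)) * u y) ∘ WithLp.ofLp := by
        ext w; exact h1 w
      rw [this]
      exact (mp.integrable_comp_emb me).2 hF)
  have h3 := congrFun h2 (WithLp.toLp 2 x)
  rw [Real.fourierInv_eq'] at h3
  simp only [Function.comp_apply] at h3
  rw [← h3, ← mp.integral_comp me]
  congr 1
  ext v
  rw [h1]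
  simp only [ee, smul_eq_mul, EuclideanSpace.inner_eq_star_dotProduct]
  congr 3

/-- The Fourier transform of a smooth compactly supported function is integrable. -/
lemma fourier_integrable {n : ℕ} (u : X n → ℂ) (hc : HasCompactSupport u) (hu : ContDiff ℝ ∞ u) :
    Integrable (fun θ : X n => ∫ y : X n, ee (-(y ⬝ᵥ θ)) * u y) volume := by
  have mp := PiLp.volume_preserving_ofLp (Fin n)
  have me : MeasurableEmbedding (WithLp.ofLp : EuclideanSpace ℝ (Fin n) → (Fin n → ℝ)) :=
    (MeasurableEquiv.toLp 2 (Fin n → ℝ)).symm.measurableEmbedding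
  have h1 : ∀ w : EuclideanSpace ℝ (Fin n), 𝓕 (u ∘ (WithLp.ofLp : EuclideanSpace ℝ (Fin n) → (Fin n → ℝ))) w
      = ∫ y : X n, ee (-(y ⬝ᵥ w.ofLp)) * u y := by
    intro w
    rw [Real.fourier_eq', ← mp.integral_comp me]
    congr 1
    ext v
    simp only [ee, Function.comp, smul_eq_mul, EuclideanSpace.inner_eq_star_dotProduct]
    congr 3
    simp [dotProduct_comm]
  let L := EuclideanSpace.equiv (Fin n) ℝ
  let v : SchwartzMap (X n) ℂ := hc.toSchwartzMap hu
  let v' := SchwartzMap.compCLMOfContinuousLinearEquiv ℂ L v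
  have h2 : Integrable (⇑(𝓕 v' : SchwartzMap (EuclideanSpace ℝ (Fin n)) ℂ)) volume := (𝓕 v').integrable
  have h3 : (⇑(𝓕 v' : SchwartzMap (EuclideanSpace ℝ (Fin n)) ℂ)) = (fun θ : X n => ∫ y : X n, ee (-(y ⬝ᵥ θ)) * u y) ∘ WithLp.ofLp := by
    ext w
    rw [SchwartzMap.fourier_coe]
    exact h1 w
  rw [h3] at h2
  exact (mp.integrable_comp_emb me).1 h2

/-- A linear identification of phase space with a Euclidean space. -/
def phaseEquiv (n : ℕ) : (X n × X n) ≃L[ℝ] EuclideanSpace ℝ (Fin n ⊕ Fin n) :=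
  ((LinearEquiv.sumArrowLequivProdArrow (Fin n) (Fin n) ℝ ℝ).symm.trans
    (WithLp.linearEquiv 2 ℝ (Fin n ⊕ Fin n → ℝ)).symm).toContinuousLinearEquiv

lemma phase_mp (n : ℕ) : MeasurePreserving (phaseEquiv n) volume volume :=
  (PiLp.volume_preserving_toLp (Fin n ⊕ Fin n)).comp
    (volume_measurePreserving_sumPiEquivProdPi_symm (fun _ : Fin n ⊕ Fin n => ℝ))

lemma phase_inner (n : ℕ) (v w : X n × X n) :
    inner ℝ (phaseEquiv n v) (phaseEquiv n w) = v.1 ⬝ᵥ w.1 + v.2 ⬝ᵥ w.2 := by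
  rw [EuclideanSpace.inner_eq_star_dotProduct, dotProduct, dotProduct, dotProduct, Fintype.sum_sum_type]
  congr 1 <;> refine Finset.sum_congr rfl fun i _ => ?_
  · change w.1 i * v.1 i = _
    ring
  · change w.2 i * v.2 i = _
    ring

/-- Fourier representation of a Schwartz symbol. -/
lemma exists_rep {n : ℕ} (f : SchwartzMap (X n × X n) ℂ) :
    ∃ F : SchwartzMap (X n × X n) ℂ, ∀ x θ : X n,
      f (x, θ) = ∫ w : X n × X n, F w * ee (x ⬝ᵥ w.1 + θ ⬝ᵥ w.2) := by
  let L := phaseEquiv n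
  let f' : SchwartzMap (EuclideanSpace ℝ (Fin n ⊕ Fin n)) ℂ :=
    SchwartzMap.compCLMOfContinuousLinearEquiv ℂ L.symm f
  refine ⟨SchwartzMap.compCLMOfContinuousLinearEquiv ℂ L (𝓕 f'), fun x θ => ?_⟩
  have me : MeasurableEmbedding L := L.toHomeomorph.measurableEmbedding
  have h : (𝓕⁻ (𝓕 f')) (L (x, θ)) = f (x, θ) := by
    rw [FourierTransform.fourierInv_fourier_eq]
    change f (L.symm (L (x, θ))) = _
    simp
  rw [← h, SchwartzMap.fourierInv_coe, Real.fourierInv_eq', ← (phase_mp n).integral_comp me]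
  congr 1
  ext w
  rw [phase_inner]
  simp only [SchwartzMap.compCLMOfContinuousLinearEquiv_apply, Function.comp, smul_eq_mul, ee]
  rw [mul_comm]
  congr 3
  simp only [dotProduct_comm]

/-- Uniform integrable bound for Schwartz functions on phase space. -/
lemma exists_bound {n : ℕ} (F : SchwartzMap (X n × X n) ℂ) :
    ∃ B : X n → ℝ, Integrable B volume ∧ ∀ x y, ‖F (x, y)‖ ≤ B x ∧ ‖F (x, y)‖ ≤ B y := by
  let N := n + 1
  let m : ℕ × ℕ := (N, 0)
  let C := 2 ^ N * ((Finset.Iic m).sup (fun m => SchwartzMap.seminorm ℝ m.1 m.2)) F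
  have hC : ∀ w, (1 + ‖w‖) ^ N * ‖F w‖ ≤ C := by
    intro w
    have := SchwartzMap.one_add_le_sup_seminorm_apply (𝕜 := ℝ) (m := m) (k := N) (n := 0) le_rfl le_rfl F w
    simpa using this
  refine ⟨fun x => C * (1 + ‖x‖) ^ (-(N : ℝ)), ?_, ?_⟩
  · apply Integrable.const_mul
    apply integrable_one_add_norm
    simp [N]
  · have key : ∀ (w : X n × X n) (z : X n), ‖z‖ ≤ ‖w‖ → ‖F w‖ ≤ C * (1 + ‖z‖) ^ (-(N : ℝ)) := by
      intro w z hz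
      have hp : 0 < (1 + ‖z‖) ^ N := by positivity
      rw [Real.rpow_neg (by positivity), Real.rpow_natCast, ← div_eq_mul_inv, le_div_iff₀ hp, mul_comm]
      refine le_trans ?_ (hC w)
      gcongr
    intro x y
    exact ⟨key _ _ (norm_fst_le (x, y)), key _ _ (norm_snd_le (x, y))⟩


/-- The operator `∫ F(p,q) M_p τ_{hq}`. -/
def Hop {n : ℕ} (F : SchwartzMap (X n × X n) ℂ) (h : ℝ) (ξ : X n → ℂ) (x : X n) : ℂ :=
  ∫ w : X n × X n, F w * ee (x ⬝ᵥ w.1) * ξ (x + h • w.2)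

/-- Fourier representation relation. -/
def IsRep {n : ℕ} (f F : SchwartzMap (X n × X n) ℂ) : Prop :=
  ∀ x θ : X n, f (x, θ) = ∫ w : X n × X n, F w * ee (x ⬝ᵥ w.1 + θ ⬝ᵥ w.2)

lemma F_integrable {n : ℕ} (F : SchwartzMap (X n × X n) ℂ) : Integrable F volume :=
  haveI : Measure.IsAddHaarMeasure (volume : Measure (X n × X n)) :=
    Measure.prod.instIsAddHaarMeasure _ _
  F.integrable

lemma symbol_integrable {n : ℕ} (f : SchwartzMap (X n × X n) ℂ) (x : X n) :
    Integrable (fun θ : X n => f (x, θ)) volume := by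
  obtain ⟨B, hB, hb⟩ := exists_bound f
  refine hB.mono' (by fun_prop) (ae_of_all _ fun θ => (hb x θ).2)

lemma symbol_integrable' {n : ℕ} (f : SchwartzMap (X n × X n) ℂ) (x : X n) :
    Integrable (fun θ : X n => f (θ, x)) volume := by
  obtain ⟨B, hB, hb⟩ := exists_bound f
  refine hB.mono' (by fun_prop) (ae_of_all _ fun θ => (hb θ x).1)

lemma inner_inversion {n : ℕ} {f F : SchwartzMap (X n × X n) ℂ} (hF : IsRep f F) (x q : X n) :
    ∫ θ : X n, ee (-(q ⬝ᵥ θ)) * f (x, θ) = ∫ p : X n, F (p, q) * ee (x ⬝ᵥ p) := by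
  obtain ⟨B, hB, hb⟩ := exists_bound F
  set g : X n → ℂ := fun q => ∫ p : X n, F (p, q) * ee (x ⬝ᵥ p) with hg
  have hi2 : Integrable (fun w : X n × X n => F w * ee (x ⬝ᵥ w.1)) volume := by
    refine (F_integrable F).norm.mono' (by fun_prop) (ae_of_all _ fun w => ?_)
    simp [norm_ee]
  have hgc : Continuous g := by
    refine continuous_of_dominated (bound := B) (fun q => by fun_prop) ?_ hB ?_
    · intro q
      refine ae_of_all _ fun p => ?_
      simpa [norm_ee] using (hb p q).1
    · refine ae_of_all _ fun p => by fun_prop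
  have hgi : Integrable g volume := by
    have := hi2.integral_prod_right
    exact this
  have hgF : ∀ θ : X n, ∫ y : X n, ee (-(y ⬝ᵥ θ)) * g y = f (x, -θ) := by
    intro θ
    rw [hF x (-θ)]
    have hi3 : Integrable (fun w : X n × X n => F w * ee (x ⬝ᵥ w.1 + (-θ) ⬝ᵥ w.2)) volume := by
      refine (F_integrable F).norm.mono' (by fun_prop) (ae_of_all _ fun w => ?_)
      simp [norm_ee]
    rw [Measure.volume_eq_prod, integral_prod_symm _ hi3]
    congr 1
    ext y
    rw [hg, ← integral_const_mul]
    congr 1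
    ext p
    simp only [ee_add]
    rw [neg_dotProduct, dotProduct_comm θ y]
    ring
  have h := fourier_inv g hgc hgi (by
    simp only [hgF]
    exact (symbol_integrable f x).comp_neg) q
  change _ = g q
  rw [← h, ← integral_neg_eq_self]
  congr 1
  ext θ
  rw [hgF]
  simp

lemma op_formula {n : ℕ} {f F : SchwartzMap (X n × X n) ℂ} (hF : IsRep f F) {ℏ : ℝ} (hh : 0 < ℏ)
    (ξ : X n → ℂ) (hξ : Integrable ξ volume) (x : X n) :
    (((2 * Real.pi) ^ n)⁻¹ : ℝ) •
        ∫ θ : X n, Complex.exp (Complex.I * Complex.ofReal (∑ i, x i * θ i)) * f (x, ℏ • θ) *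
          ∫ y : X n, Complex.exp (-(Complex.I) * Complex.ofReal (∑ i, y i * θ i)) * ξ y
      = Hop F (2 * Real.pi * ℏ) ξ x := by
  have hpi := Real.pi_pos
  set h := 2 * Real.pi * ℏ with hhdef
  have hh0 : 0 < h := by positivity
  have e1 : ∀ c : ℝ, ∀ u v : X n, Complex.exp (Complex.I * Complex.ofReal (∑ i, u i * ((2 * Real.pi) • v) i))
      = ee (u ⬝ᵥ v) := by
    intro c u v
    unfold ee
    rw [mul_comm]
    congr 3
    rw [dotProduct, Finset.mul_sum]
    refine Finset.sum_congr rfl fun i _ => ?_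
    simp only [Pi.smul_apply, smul_eq_mul]
    ring
  have e2 : ∀ u v : X n, Complex.exp (-(Complex.I) * Complex.ofReal (∑ i, u i * ((2 * Real.pi) • v) i))
      = ee (-(u ⬝ᵥ v)) := by
    intro u v
    unfold ee
    rw [neg_mul, ← mul_neg, mul_comm, ← Complex.ofReal_neg]
    congr 3
    rw [dotProduct, mul_neg, Finset.mul_sum]
    congr 1
    refine Finset.sum_congr rfl fun i _ => ?_
    simp only [Pi.smul_apply, smul_eq_mul]
    ring
  have s1 := Measure.integral_comp_smul (volume : Measure (X n)) (fun θ : X n =>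
    Complex.exp (Complex.I * Complex.ofReal (∑ i, x i * θ i)) * f (x, ℏ • θ) *
          ∫ y : X n, Complex.exp (-(Complex.I) * Complex.ofReal (∑ i, y i * θ i)) * ξ y) (2 * Real.pi)
  rw [Module.finrank_fin_fun, abs_of_pos (by positivity)] at s1
  rw [← s1]
  simp only [e1 0, e2, smul_smul]
  rw [mul_comm ℏ, ← hhdef]
  have hfi : Integrable (fun θ : X n => f (x, h • θ)) volume :=
    (symbol_integrable f x).comp_smul hh0.ne'
  calc ∫ θ : X n, ee (x ⬝ᵥ θ) * f (x, h • θ) * ∫ y : X n, ee (-(y ⬝ᵥ θ)) * ξ y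
      = ∫ θ : X n, ∫ y : X n, ee ((x - y) ⬝ᵥ θ) * f (x, h • θ) * ξ y := by
        congr 1
        ext θ
        rw [← integral_const_mul]
        congr 1
        ext y
        rw [sub_dotProduct, sub_eq_add_neg, ee_add]
        ring
    _ = ∫ y : X n, ∫ θ : X n, ee ((x - y) ⬝ᵥ θ) * f (x, h • θ) * ξ y := by
        apply integral_integral_swap
        refine (hfi.norm.mul_prod hξ.norm).mono' ?_ ?_
        · apply AEStronglyMeasurable.mul
          · apply Continuous.aestronglyMeasurable
            fun_prop
          · exact hξ.aestronglyMeasurable.comp_snd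
        · refine ae_of_all _ fun z => ?_
          simp [Function.uncurry, norm_ee]
    _ = ∫ y : X n, (h ^ n)⁻¹ • (ξ y * ∫ p : X n, F (p, h⁻¹ • (y - x)) * ee (x ⬝ᵥ p)) := by
        congr 1
        ext y
        rw [← inner_inversion hF, integral_mul_const]
        have s2 := Measure.integral_comp_smul (volume : Measure (X n)) (fun θ : X n =>
          ee (-((h⁻¹ • (y - x)) ⬝ᵥ θ)) * f (x, θ)) h
        rw [Module.finrank_fin_fun, abs_of_pos (by positivity)] at s2
        rw [← mul_smul_comm, ← s2, mul_comm]
        congr 2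
        ext θ
        congr 2
        rw [smul_dotProduct, dotProduct_smul, smul_smul, inv_mul_cancel₀ hh0.ne', one_smul,
          ← neg_dotProduct, neg_sub]
    _ = ∫ y : X n, (h ^ n)⁻¹ • (ξ (x + y) * ∫ p : X n, F (p, h⁻¹ • y) * ee (x ⬝ᵥ p)) := by
        rw [← integral_add_left_eq_self _ x]
        simp
    _ = ∫ z : X n, ξ (x + h • z) * ∫ p : X n, F (p, z) * ee (x ⬝ᵥ p) := by
        have s3 := Measure.integral_comp_smul (volume : Measure (X n)) (fun y : X n =>
          ξ (x + y) * ∫ p : X n, F (p, h⁻¹ • y) * ee (x ⬝ᵥ p)) h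
        rw [Module.finrank_fin_fun, abs_of_pos (by positivity)] at s3
        rw [integral_smul, ← s3]
        simp only [smul_smul, inv_mul_cancel₀ hh0.ne', one_smul]
    _ = Hop F h ξ x := by
        unfold Hop
        obtain ⟨B, hB, hb⟩ := exists_bound F
        have hξ' : Integrable (fun z : X n => ξ (x + h • z)) volume :=
          (hξ.comp_add_left x).comp_smul hh0.ne'
        have hi : Integrable (fun w : X n × X n => F w * ee (x ⬝ᵥ w.1) * ξ (x + h • w.2)) volume := by
          refine (hB.mul_prod hξ'.norm).mono' ?_ ?_
          · apply AEStronglyMeasurable.mul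
            · apply Continuous.aestronglyMeasurable
              fun_prop
            · exact hξ'.aestronglyMeasurable.comp_snd
          · refine ae_of_all _ fun w => ?_
            simp only [norm_mul, norm_ee, mul_one]
            gcongr
            exact (hb w.1 w.2).1
        rw [Measure.volume_eq_prod, integral_prod_symm _ hi]
        congr 1
        ext z
        rw [mul_comm, ← integral_mul_const]


/-- The integrand of the pairing `⟨η, op ξ⟩`. -/
def Gint {n : ℕ} (F : SchwartzMap (X n × X n) ℂ) (h : ℝ) (ξ η : X n → ℂ)
    (z : (X n × X n) × X n) : ℂ :=
  F z.1 * ee (z.2 ⬝ᵥ z.1.1) * ξ (z.2 + h • z.1.2) * (starRingEnd ℂ) (η z.2)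

lemma shift_qmp (n : ℕ) (h : ℝ) : Measure.QuasiMeasurePreserving
    (fun z : (X n × X n) × X n => z.2 + h • z.1.2) (volume.prod volume) volume := by
  apply QuasiMeasurePreserving.prod_of_right
  · fun_prop
  · refine ae_of_all _ fun w => ?_
    exact (measurePreserving_add_right volume (h • w.2)).quasiMeasurePreserving

lemma cs_lintegral {n : ℕ} {ξ η : X n → ℂ} (hξ : AEStronglyMeasurable ξ volume)
    (hη : AEStronglyMeasurable η volume) (v : X n) :
    ∫⁻ x, ‖ξ (x + v)‖ₑ * ‖η x‖ₑ ≤ eLpNorm ξ 2 volume * eLpNorm η 2 volume := by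
  have mp := measurePreserving_add_right (volume : Measure (X n)) v
  have hξ' : AEStronglyMeasurable (fun x => ξ (x + v)) volume :=
    hξ.comp_measurePreserving mp
  have h1 : eLpNorm (fun x => ξ (x + v)) 2 volume = eLpNorm ξ 2 volume :=
    eLpNorm_comp_measurePreserving hξ mp
  have := eLpNorm_smul_le_mul_eLpNorm (p := 2) (q := 2) (r := 1) hη hξ'
  rw [h1, eLpNorm_one_eq_lintegral_enorm] at this
  simpa [enorm_mul] using this

lemma Gint_aesm {n : ℕ} (F : SchwartzMap (X n × X n) ℂ) (h : ℝ) {ξ η : X n → ℂ}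
    (hξ : AEStronglyMeasurable ξ volume) (hη : AEStronglyMeasurable η volume) :
    AEStronglyMeasurable (Gint F h ξ η) (volume.prod volume) := by
  unfold Gint
  apply AEStronglyMeasurable.mul
  · apply AEStronglyMeasurable.mul
    · apply Continuous.aestronglyMeasurable
      fun_prop
    · exact hξ.comp_quasiMeasurePreserving (shift_qmp n h)
  · exact (Complex.continuous_conj.comp_aestronglyMeasurable hη).comp_snd

lemma Gint_lintegral {n : ℕ} (F : SchwartzMap (X n × X n) ℂ) (h : ℝ) {ξ η : X n → ℂ}
    (hξ : AEStronglyMeasurable ξ volume) (hη : AEStronglyMeasurable η volume) :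
    ∫⁻ z, ‖Gint F h ξ η z‖ₑ ∂(volume.prod volume) ≤
      eLpNorm F 1 volume * (eLpNorm ξ 2 volume * eLpNorm η 2 volume) := by
  rw [lintegral_prod _ (Gint_aesm F h hξ hη).enorm, eLpNorm_one_eq_lintegral_enorm,
    ← lintegral_mul_const'' _ (F.continuous.aestronglyMeasurable.enorm)]
  refine lintegral_mono fun w => ?_
  refine le_trans (le_of_eq ?_) (mul_le_mul_right (cs_lintegral hξ hη (h • w.2)) _)
  rw [← lintegral_const_mul' _ _ enorm_ne_top]
  refine lintegral_congr fun x => ?_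
  have : ‖ee (x ⬝ᵥ w.1)‖ₑ = 1 := by
    rw [← ofReal_norm, norm_ee]; simp
  have h2 : ‖(starRingEnd ℂ) (η x)‖ₑ = ‖η x‖ₑ := by
    rw [← ofReal_norm, ← ofReal_norm, RCLike.norm_conj]
  simp only [Gint, enorm_mul, this, h2, mul_one]
  ring

lemma Gint_integrable {n : ℕ} (F : SchwartzMap (X n × X n) ℂ) (h : ℝ) {ξ η : X n → ℂ}
    (hξ : MemLp ξ 2 volume) (hη : MemLp η 2 volume) :
    Integrable (Gint F h ξ η) (volume.prod volume) := by
  refine ⟨Gint_aesm F h hξ.1 hη.1, ?_⟩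
  refine (Gint_lintegral F h hξ.1 hη.1).trans_lt ?_
  refine ENNReal.mul_lt_top ?_ (ENNReal.mul_lt_top hξ.2 hη.2)
  exact (memLp_one_iff_integrable.2 (F_integrable F)).2

lemma Gint_norm_le {n : ℕ} (F : SchwartzMap (X n × X n) ℂ) (h : ℝ) {ξ η : X n → ℂ}
    (hξ : MemLp ξ 2 volume) (hη : MemLp η 2 volume) :
    ‖∫ z, Gint F h ξ η z ∂(volume.prod volume)‖ ≤
      (eLpNorm F 1 volume).toReal * ((eLpNorm ξ 2 volume).toReal * (eLpNorm η 2 volume).toReal) := by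
  rw [← ENNReal.toReal_mul, ← ENNReal.toReal_mul]
  refine (norm_integral_le_lintegral_norm _).trans ?_
  simp only [ofReal_norm]
  refine ENNReal.toReal_mono ?_ (Gint_lintegral F h hξ.1 hη.1)
  refine (ENNReal.mul_lt_top ?_ (ENNReal.mul_lt_top hξ.2 hη.2)).ne
  exact (memLp_one_iff_integrable.2 (F_integrable F)).2

lemma Gint_congr {n : ℕ} (F : SchwartzMap (X n × X n) ℂ) (h : ℝ) {ξ ξ' η η' : X n → ℂ}
    (h1 : ξ =ᵐ[volume] ξ') (h2 : η =ᵐ[volume] η') :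
    Gint F h ξ η =ᵐ[volume.prod volume] Gint F h ξ' η' := by
  have a1 := (shift_qmp n h).ae_eq_comp h1
  have a2 := (Measure.quasiMeasurePreserving_snd (μ := (volume : Measure (X n × X n)))
    (ν := (volume : Measure (X n)))).ae_eq_comp h2
  filter_upwards [a1, a2] with z b1 b2
  simp only [Function.comp] at b1 b2
  simp only [Gint, b1, b2]

/-- The bounded sesquilinear form of the operator. -/
def formB {n : ℕ} (F : SchwartzMap (X n × X n) ℂ) (h : ℝ) : L2X n →L⋆[ℂ] L2X n →L[ℂ] ℂ :=
  LinearMap.mkContinuous₂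
    (LinearMap.mk₂'ₛₗ (starRingEnd ℂ) (RingHom.id ℂ)
      (fun η ξ : L2X n => ∫ z, Gint F h ξ η z ∂(volume.prod volume))
      (by
        intro η η' ξ
        rw [← integral_add (Gint_integrable F h (Lp.memLp ξ) (Lp.memLp η))
          (Gint_integrable F h (Lp.memLp ξ) (Lp.memLp η')),
          integral_congr_ae (Gint_congr F h (ae_eq_refl ξ) (Lp.coeFn_add η η'))]
        congr 1
        ext z
        simp only [Gint, Pi.add_apply, map_add]
        ring)
      (by
        intro c η ξ
        rw [smul_eq_mul, ← integral_const_mul,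
          integral_congr_ae (Gint_congr F h (ae_eq_refl ξ) (Lp.coeFn_smul c η))]
        congr 1
        ext z
        simp only [Gint, Pi.smul_apply, smul_eq_mul, map_mul]
        ring)
      (by
        intro η ξ ξ'
        rw [← integral_add (Gint_integrable F h (Lp.memLp ξ) (Lp.memLp η))
          (Gint_integrable F h (Lp.memLp ξ') (Lp.memLp η)),
          integral_congr_ae (Gint_congr F h (Lp.coeFn_add ξ ξ') (ae_eq_refl η))]
        congr 1
        ext z
        simp only [Gint, Pi.add_apply]
        ring)
      (by
        intro c η ξ
        rw [smul_eq_mul, RingHom.id_apply, ← integral_const_mul,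
          integral_congr_ae (Gint_congr F h (Lp.coeFn_smul c ξ) (ae_eq_refl η))]
        congr 1
        ext z
        simp only [Gint, Pi.smul_apply, smul_eq_mul]
        ring))
    (eLpNorm F 1 volume).toReal
    (by
      intro η ξ
      refine (Gint_norm_le F h (Lp.memLp ξ) (Lp.memLp η)).trans (le_of_eq ?_)
      rw [Lp.norm_def, Lp.norm_def]
      ring)

/-- The operator. -/
def opT {n : ℕ} (F : SchwartzMap (X n × X n) ℂ) (h : ℝ) : L2X n →L[ℂ] L2X n :=
  ContinuousLinearMap.adjoint (InnerProductSpace.continuousLinearMapOfBilin (formB F h))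

lemma inner_opT {n : ℕ} (F : SchwartzMap (X n × X n) ℂ) (h : ℝ) (ξ η : L2X n) :
    inner ℂ η (opT F h ξ) = ∫ z, Gint F h ξ η z ∂(volume.prod volume) := by
  unfold opT
  rw [ContinuousLinearMap.adjoint_inner_right, InnerProductSpace.continuousLinearMapOfBilin_apply]
  rfl

lemma Gint_one_integrable {n : ℕ} (F : SchwartzMap (X n × X n) ℂ) (h : ℝ) {ξ : X n → ℂ}
    (hξ : Integrable ξ volume) :
    Integrable (Gint F h ξ (fun _ => 1)) (volume.prod volume) := by
  refine ⟨Gint_aesm F h hξ.1 (by fun_prop), ?_⟩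
  have : ∫⁻ z, ‖Gint F h ξ (fun _ => 1) z‖ₑ ∂(volume.prod volume) = eLpNorm F 1 volume * eLpNorm ξ 1 volume := by
    rw [lintegral_prod _ (Gint_aesm F h hξ.1 (by fun_prop)).enorm, eLpNorm_one_eq_lintegral_enorm,
      ← lintegral_mul_const'' _ (F.continuous.aestronglyMeasurable.enorm)]
    refine lintegral_congr fun w => ?_
    rw [eLpNorm_one_eq_lintegral_enorm, ← lintegral_add_right_eq_self (fun x => ‖ξ x‖ₑ) (h • w.2),
      ← lintegral_const_mul' _ _ enorm_ne_top]
    refine lintegral_congr fun x => ?_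
    have : ‖ee (x ⬝ᵥ w.1)‖ₑ = 1 := by
      rw [← ofReal_norm, norm_ee]; simp
    simp only [Gint, enorm_mul, this, mul_one, map_one]
  rw [HasFiniteIntegral, this]
  exact ENNReal.mul_lt_top (memLp_one_iff_integrable.2 (F_integrable F)).2
    (memLp_one_iff_integrable.2 hξ).2

lemma Hop_eq {n : ℕ} (F : SchwartzMap (X n × X n) ℂ) (h : ℝ) (ξ η : X n → ℂ) (x : X n) :
    ∫ w, Gint F h ξ η (w, x) = Hop F h ξ x * (starRingEnd ℂ) (η x) := by
  unfold Hop Gint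
  rw [← integral_mul_const]

lemma Hop_integrable {n : ℕ} (F : SchwartzMap (X n × X n) ℂ) (h : ℝ) {ξ : X n → ℂ}
    (hξ : Integrable ξ volume) : Integrable (Hop F h ξ) volume := by
  have := (Gint_one_integrable F h hξ).integral_prod_right
  simpa [Hop_eq] using this

lemma opT_spec {n : ℕ} (F : SchwartzMap (X n × X n) ℂ) (h : ℝ) (ξL : L2X n) (ξ : X n → ℂ)
    (hξ : Integrable ξ volume) (he : ⇑ξL =ᵐ[volume] ξ) :
    ⇑(opT F h ξL) =ᵐ[volume] Hop F h ξ := by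
  refine ae_eq_of_forall_setIntegral_eq_of_sigmaFinite ?_ ?_ ?_
  · intro s hs hμ
    exact integrableOn_Lp_of_measure_ne_top _ fact_one_le_two_ennreal.elim hμ.ne
  · intro s hs hμ
    exact (Hop_integrable F h hξ).integrableOn
  · intro s hs hμ
    have hm : MemLp ξ 2 volume := (memLp_congr_ae he).1 (Lp.memLp ξL)
    have hs2 : MemLp (s.indicator fun _ => (1 : ℂ)) 2 volume :=
      memLp_indicator_const 2 hs 1 (Or.inr hμ.ne)
    rw [← L2.inner_indicatorConstLp_one hs hμ.ne (opT F h ξL), inner_opT,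
      integral_congr_ae (Gint_congr F h he indicatorConstLp_coeFn),
      integral_prod_symm _ (Gint_integrable F h hm hs2), ← integral_indicator hs]
    congr 1
    ext x
    rw [Hop_eq]
    by_cases hx : x ∈ s <;> simp [hx]

/-- Existence half of the theorem. -/
lemma exists_op {n : ℕ} (f : SchwartzMap (X n × X n) ℂ) {ℏ : ℝ} (hh : 0 < ℏ) :
    ∃ T : L2X n →L[ℂ] L2X n, opSpec n ℏ (⇑f) T := by
  obtain ⟨F, hF⟩ := exists_rep f
  refine ⟨opT F (2 * Real.pi * ℏ), fun ξL ξ hξ he => ?_⟩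
  refine (opT_spec F _ ξL ξ hξ he).trans (ae_of_all _ fun x => ?_)
  exact (op_formula hF hh ξ hξ x).symm

lemma opSpec_Hop {n : ℕ} {f F : SchwartzMap (X n × X n) ℂ} (hF : IsRep f F) {ℏ : ℝ} (hh : 0 < ℏ)
    {T : L2X n →L[ℂ] L2X n} (hT : opSpec n ℏ (⇑f) T) (ξL ηL : L2X n) (ξ η : X n → ℂ)
    (hξ : Integrable ξ volume) (he : ⇑ξL =ᵐ[volume] ξ) (he' : ⇑ηL =ᵐ[volume] η) :
    inner ℂ ηL (T ξL) = ∫ w : X n × X n, F w *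
      ∫ x : X n, ee (x ⬝ᵥ w.1) * ξ (x + (2 * Real.pi * ℏ) • w.2) * (starRingEnd ℂ) (η x) := by
  have hT' : T ξL = opT F (2 * Real.pi * ℏ) ξL := by
    apply Lp.ext
    refine (hT ξL ξ hξ he).trans ?_
    refine EventuallyEq.trans (ae_of_all _ fun x => ?_) (opT_spec F _ ξL ξ hξ he).symm
    exact (op_formula hF hh ξ hξ x)
  have hm : MemLp ξ 2 volume := (memLp_congr_ae he).1 (Lp.memLp ξL)
  have hm' : MemLp η 2 volume := (memLp_congr_ae he').1 (Lp.memLp ηL)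
  rw [hT', inner_opT, integral_congr_ae (Gint_congr F _ he he'),
    integral_prod _ (Gint_integrable F _ hm hm')]
  congr 1
  ext w
  rw [← integral_const_mul]
  congr 1
  ext x
  simp only [Gint]
  ring


/-- Fourier transform on `X n`. -/
def ft {n : ℕ} (u : X n → ℂ) (θ : X n) : ℂ := ∫ y : X n, ee (-(y ⬝ᵥ θ)) * u y

lemma parseval_shift {n : ℕ} {u v : X n → ℂ} (hu : ContDiff ℝ ∞ u) (hu' : HasCompactSupport u)
    (hv : ContDiff ℝ ∞ v) (hv' : HasCompactSupport v) (y : X n) :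
    ∫ θ : X n, ee (θ ⬝ᵥ y) * (ft u θ * (starRingEnd ℂ) (ft v θ)) =
      ∫ x : X n, u (x + y) * (starRingEnd ℂ) (v x) := by
  have iu : Integrable u volume := hu.continuous.integrable_of_hasCompactSupport hu'
  have iv : Integrable v volume := hv.continuous.integrable_of_hasCompactSupport hv'
  have fu : Integrable (ft u) volume := fourier_integrable u hu' hu
  calc ∫ θ : X n, ee (θ ⬝ᵥ y) * (ft u θ * (starRingEnd ℂ) (ft v θ))
      = ∫ θ : X n, ∫ x : X n, ee ((x + y) ⬝ᵥ θ) * ft u θ * (starRingEnd ℂ) (v x) := by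
        congr 1
        ext θ
        rw [show (starRingEnd ℂ) (ft v θ) = ∫ x : X n, ee (x ⬝ᵥ θ) * (starRingEnd ℂ) (v x) by
          unfold ft
          rw [← integral_conj]
          simp only [map_mul, conj_ee, neg_neg], ← mul_assoc, ← integral_const_mul]
        congr 1
        ext x
        rw [add_dotProduct, ee_add, dotProduct_comm θ y]
        ring
    _ = ∫ x : X n, ∫ θ : X n, ee ((x + y) ⬝ᵥ θ) * ft u θ * (starRingEnd ℂ) (v x) := by
        apply integral_integral_swap
        refine (fu.norm.mul_prod iv.norm).mono' ?_ ?_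
        · apply AEStronglyMeasurable.mul
          · apply AEStronglyMeasurable.mul
            · apply Continuous.aestronglyMeasurable
              fun_prop
            · exact fu.aestronglyMeasurable.comp_fst
          · exact (Complex.continuous_conj.comp_aestronglyMeasurable iv.aestronglyMeasurable).comp_snd
        · refine ae_of_all _ fun z => ?_
          simp [Function.uncurry, norm_ee]
    _ = ∫ x : X n, u (x + y) * (starRingEnd ℂ) (v x) := by
        congr 1
        ext x
        rw [integral_mul_const]
        congr 1
        exact fourier_inv u hu.continuous iu fu (x + y)

lemma ft_norm_le {n : ℕ} (u : X n → ℂ) (θ : X n) : ‖ft u θ‖ ≤ ∫ y, ‖u y‖ := by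
  refine (norm_integral_le_integral_norm _).trans (le_of_eq ?_)
  simp [norm_ee]

lemma plancherel {n : ℕ} {u : X n → ℂ} (hu : ContDiff ℝ ∞ u) (hu' : HasCompactSupport u) :
    ∫⁻ θ : X n, ‖ft u θ‖ₑ ^ 2 = ∫⁻ x : X n, ‖u x‖ₑ ^ 2 := by
  have fu : Integrable (ft u) volume := fourier_integrable u hu' hu
  have h := parseval_shift hu hu' hu hu' 0
  simp only [dotProduct_zero, ee_zero, one_mul, add_zero, Complex.mul_conj, Complex.normSq_eq_norm_sq] at h
  rw [integral_complex_ofReal, integral_complex_ofReal] at h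
  have h' := Complex.ofReal_injective h
  have i1 : Integrable (fun θ => ‖ft u θ‖ ^ 2) volume := by
    refine (fu.norm.const_mul (∫ y, ‖u y‖)).mono' (by
      exact (fu.aestronglyMeasurable.norm.pow 2)) (ae_of_all _ fun θ => ?_)
    rw [Real.norm_of_nonneg (by positivity), sq]
    gcongr
    exact ft_norm_le u θ
  have i2 : Integrable (fun x => ‖u x‖ ^ 2) volume := by
    apply Continuous.integrable_of_hasCompactSupport
    · have := hu.continuous
      fun_prop
    · exact hu'.comp_left (g := fun z => ‖z‖ ^ 2) (by simp)
  have e : ∀ z : ℂ, ‖z‖ₑ ^ 2 = ENNReal.ofReal (‖z‖ ^ 2) := by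
    intro z
    rw [ENNReal.ofReal_pow (norm_nonneg _), ofReal_norm]
  simp only [e]
  rw [← ofReal_integral_eq_lintegral_ofReal i1 (ae_of_all _ fun _ => by positivity),
    ← ofReal_integral_eq_lintegral_ofReal i2 (ae_of_all _ fun _ => by positivity), h']

lemma measurePreserving_sub_prod_swap_aux (n : ℕ) : MeasurePreserving
    (fun z : X n × X n => (z.2, z.2 - z.1)) (volume.prod volume) (volume.prod volume) := by
  have h1 : MeasurePreserving (fun z : X n × X n => (z.1, z.1 - z.2)) (volume.prod volume) (volume.prod volume) :=
    MeasurePreserving.skew_product (g := fun x y : X n => x - y) (MeasurePreserving.id volume)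
      (by fun_prop) (ae_of_all _ fun x => (Measure.measurePreserving_sub_left volume x).map_eq)
  exact h1.comp Measure.measurePreserving_swap

/-- A normalised smooth window. -/
structure Window {n : ℕ} (ϕ : X n → ℝ) : Prop where
  smooth : ContDiff ℝ ∞ ϕ
  supp : HasCompactSupport ϕ
  norm : ∫ x, ϕ x ^ 2 = 1

/-- Windowed function. -/
def win {n : ℕ} (ϕ : X n → ℝ) (ξ : X n → ℂ) (a x : X n) : ℂ := (ϕ (x - a) : ℂ) * ξ x

/-- Windowed Fourier transform. -/
def V {n : ℕ} (ϕ : X n → ℝ) (ξ : X n → ℂ) (z : X n × X n) : ℂ := ft (win ϕ ξ z.1) z.2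

lemma win_smooth {n : ℕ} {ϕ : X n → ℝ} (hϕ : Window ϕ) {ξ : X n → ℂ} (hξ : ContDiff ℝ ∞ ξ)
    (a : X n) : ContDiff ℝ ∞ (win ϕ ξ a) := by
  unfold win
  apply ContDiff.mul _ hξ
  exact Complex.ofRealCLM.contDiff.comp (hϕ.smooth.comp (contDiff_id.sub contDiff_const))

lemma win_supp {n : ℕ} (ϕ : X n → ℝ) {ξ : X n → ℂ} (hξ : HasCompactSupport ξ)
    (a : X n) : HasCompactSupport (win ϕ ξ a) := hξ.mul_left

lemma V_sm {n : ℕ} {ϕ : X n → ℝ} (hϕ : Window ϕ) {ξ : X n → ℂ} (hξ : ContDiff ℝ ∞ ξ) :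
    StronglyMeasurable (V ϕ ξ) := by
  unfold V ft win
  have h1 := hϕ.smooth.continuous
  have h2 := hξ.continuous
  refine StronglyMeasurable.integral_prod_right' (f := fun z : (X n × X n) × X n =>
    ee (-(z.2 ⬝ᵥ z.1.2)) * (((ϕ (z.2 - z.1.1) : ℝ) : ℂ) * ξ z.2)) ?_
  apply Continuous.stronglyMeasurable
  fun_prop

lemma Window.lint {n : ℕ} {ϕ : X n → ℝ} (hϕ : Window ϕ) : ∫⁻ x, ‖(ϕ x : ℂ)‖ₑ ^ 2 = 1 := by
  have i2 : Integrable (fun x => ϕ x ^ 2) volume := by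
    apply Continuous.integrable_of_hasCompactSupport
    · have := hϕ.smooth.continuous
      fun_prop
    · exact hϕ.supp.comp_left (g := fun z => z ^ 2) (by simp)
  have e : ∀ x, ‖(ϕ x : ℂ)‖ₑ ^ 2 = ENNReal.ofReal (ϕ x ^ 2) := by
    intro x
    rw [← ofReal_norm, ← ENNReal.ofReal_pow (norm_nonneg _), Complex.norm_real, Real.norm_eq_abs, sq_abs]
  simp only [e]
  rw [← ofReal_integral_eq_lintegral_ofReal i2 (ae_of_all _ fun _ => by positivity), hϕ.norm]
  simp

lemma V_lint {n : ℕ} {ϕ : X n → ℝ} (hϕ : Window ϕ) {ξ : X n → ℂ} (hξ : ContDiff ℝ ∞ ξ)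
    (hξ' : HasCompactSupport ξ) :
    ∫⁻ z, ‖V ϕ ξ z‖ₑ ^ 2 ∂(volume.prod volume) = ∫⁻ x, ‖ξ x‖ₑ ^ 2 := by
  have h1 := hϕ.smooth.continuous
  have h2 := hξ.continuous
  rw [lintegral_prod _ ((V_sm hϕ hξ).aestronglyMeasurable.enorm.pow_const 2)]
  calc ∫⁻ a : X n, ∫⁻ θ : X n, ‖V ϕ ξ (a, θ)‖ₑ ^ 2
      = ∫⁻ a : X n, ∫⁻ x : X n, ‖(ϕ (x - a) : ℂ)‖ₑ ^ 2 * ‖ξ x‖ₑ ^ 2 := by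
        refine lintegral_congr fun a => ?_
        refine (plancherel (win_smooth hϕ hξ a) (win_supp ϕ hξ' a)).trans ?_
        refine lintegral_congr fun x => ?_
        rw [win, enorm_mul, mul_pow]
    _ = ∫⁻ x : X n, ∫⁻ a : X n, ‖(ϕ (x - a) : ℂ)‖ₑ ^ 2 * ‖ξ x‖ₑ ^ 2 := by
        apply lintegral_lintegral_swap
        apply Measurable.aemeasurable
        unfold Function.uncurry
        apply Measurable.fun_mul
        · apply Measurable.pow_const
          apply Continuous.measurable
          fun_prop
        · apply Measurable.pow_const
          apply Continuous.measurable
          fun_prop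
    _ = ∫⁻ x, ‖ξ x‖ₑ ^ 2 := by
        refine lintegral_congr fun x => ?_
        rw [lintegral_mul_const' _ _ (by simp),
          lintegral_sub_left_eq_self (fun b : X n => ‖(ϕ b : ℂ)‖ₑ ^ 2) x, hϕ.lint, one_mul]

lemma eLpNorm_two_eq {α : Type*} [MeasurableSpace α] (μ : Measure α) (g : α → ℂ) :
    eLpNorm g 2 μ = (∫⁻ x, ‖g x‖ₑ ^ 2 ∂μ) ^ (1 / 2 : ℝ) := by
  rw [eLpNorm_eq_lintegral_rpow_enorm_toReal (by simp) (by simp)]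
  simp

lemma V_norm {n : ℕ} {ϕ : X n → ℝ} (hϕ : Window ϕ) {ξ : X n → ℂ} (hξ : ContDiff ℝ ∞ ξ)
    (hξ' : HasCompactSupport ξ) :
    eLpNorm (V ϕ ξ) 2 (volume.prod volume) = eLpNorm ξ 2 volume := by
  rw [eLpNorm_two_eq, eLpNorm_two_eq, V_lint hϕ hξ hξ']

lemma V_memLp {n : ℕ} {ϕ : X n → ℝ} (hϕ : Window ϕ) {ξ : X n → ℂ} (hξ : ContDiff ℝ ∞ ξ)
    (hξ' : HasCompactSupport ξ) : MemLp (V ϕ ξ) 2 (volume.prod volume) := by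
  refine ⟨(V_sm hϕ hξ).aestronglyMeasurable, ?_⟩
  rw [V_norm hϕ hξ hξ']
  have hmem : MemLp ξ 2 volume := hξ.continuous.memLp_of_hasCompactSupport hξ'
  exact hmem.eLpNorm_lt_top

/-- Ambiguity function. -/
def amb {n : ℕ} (ϕ : X n → ℝ) (p v : X n) : ℂ :=
  ∫ b : X n, ee (b ⬝ᵥ p) * ((ϕ (b + v) : ℂ) * (ϕ b : ℂ))

/-- Matrix elements of phase space shifts. -/
def sh {n : ℕ} (ξ η : X n → ℂ) (p v : X n) : ℂ :=
  ∫ x : X n, ee (x ⬝ᵥ p) * ξ (x + v) * (starRingEnd ℂ) (η x)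

lemma VV_integrable {n : ℕ} {ϕ : X n → ℝ} (hϕ : Window ϕ) {ξ η : X n → ℂ} (hξ : ContDiff ℝ ∞ ξ)
    (hξ' : HasCompactSupport ξ) (hη : ContDiff ℝ ∞ η) (hη' : HasCompactSupport η) :
    Integrable (fun z => V ϕ ξ z * (starRingEnd ℂ) (V ϕ η z)) (volume.prod volume) := by
  have h1 := V_memLp hϕ hξ hξ'
  have h2 := (V_memLp hϕ hη hη').star
  exact h1.integrable_mul h2

lemma V_moyal {n : ℕ} {ϕ : X n → ℝ} (hϕ : Window ϕ) {ξ η : X n → ℂ} (hξ : ContDiff ℝ ∞ ξ)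
    (hξ' : HasCompactSupport ξ) (hη : ContDiff ℝ ∞ η) (hη' : HasCompactSupport η) (p v : X n) :
    ∫ z : X n × X n, ee (z.1 ⬝ᵥ p + z.2 ⬝ᵥ v) * (V ϕ ξ z * (starRingEnd ℂ) (V ϕ η z)) ∂(volume.prod volume)
      = amb ϕ (-p) v * sh ξ η p v := by
  have c1 := hϕ.smooth.continuous
  have c2 := hξ.continuous
  have c3 := hη.continuous
  have hi : Integrable (fun z : X n × X n => ee (z.1 ⬝ᵥ p + z.2 ⬝ᵥ v) *
      (V ϕ ξ z * (starRingEnd ℂ) (V ϕ η z))) (volume.prod volume) := by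
    refine (VV_integrable hϕ hξ hξ' hη hη').norm.mono' ?_ ?_
    · apply AEStronglyMeasurable.mul
      · apply Continuous.aestronglyMeasurable
        fun_prop
      · exact (VV_integrable hϕ hξ hξ' hη hη').aestronglyMeasurable
    · refine ae_of_all _ fun z => ?_
      simp [norm_ee]
  rw [integral_prod _ hi]
  calc ∫ a : X n, ∫ θ : X n, ee (a ⬝ᵥ p + θ ⬝ᵥ v) * (V ϕ ξ (a, θ) * (starRingEnd ℂ) (V ϕ η (a, θ)))
      = ∫ a : X n, ∫ x : X n, ee (a ⬝ᵥ p) * (win ϕ ξ a (x + v) * (starRingEnd ℂ) (win ϕ η a x)) := by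
        congr 1
        ext a
        rw [integral_const_mul, ← parseval_shift (win_smooth hϕ hξ a) (win_supp ϕ hξ' a)
          (win_smooth hϕ hη a) (win_supp ϕ hη' a) v, ← integral_const_mul]
        congr 1
        ext θ
        rw [ee_add, V, V]
        ring
    _ = ∫ x : X n, ∫ a : X n, ee (a ⬝ᵥ p) * (win ϕ ξ a (x + v) * (starRingEnd ℂ) (win ϕ η a x)) := by
        apply integral_integral_swap
        have i1 : Integrable ϕ volume := c1.integrable_of_hasCompactSupport hϕ.supp
        have i2 : Integrable η volume := c3.integrable_of_hasCompactSupport hη'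
        obtain ⟨C1, hC1⟩ := c1.bounded_above_of_compact_support hϕ.supp
        obtain ⟨C2, hC2⟩ := c2.bounded_above_of_compact_support hξ'
        have i3 : Integrable (fun z : X n × X n => ‖η z.1‖ * ‖ϕ z.2‖) (volume.prod volume) :=
          i2.norm.mul_prod i1.norm
        have i4 : Integrable (fun z : X n × X n => ‖η z.2‖ * ‖ϕ (z.2 - z.1)‖) (volume.prod volume) := by
          have := (measurePreserving_sub_prod_swap_aux n).integrable_comp_of_integrable i3
          exact this
        refine (i4.const_mul (C1 * C2)).mono' ?_ ?_
        · apply Continuous.aestronglyMeasurable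
          unfold win
          fun_prop
        · refine ae_of_all _ fun z => ?_
          simp only [Function.uncurry, win, norm_mul, norm_ee, RCLike.norm_conj, Complex.norm_real]
          have a1 := hC1 (z.2 + v - z.1)
          have a2 := hC2 (z.2 + v)
          have b1 : 0 ≤ C1 := (norm_nonneg _).trans a1
          rw [one_mul, mul_comm ‖ϕ (z.2 - z.1)‖]
          gcongr
    _ = ∫ x : X n, amb ϕ (-p) v * (ee (x ⬝ᵥ p) * ξ (x + v) * (starRingEnd ℂ) (η x)) := by
        congr 1
        ext x
        rw [← integral_sub_left_eq_self _ _ x, amb, ← integral_mul_const]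
        congr 1
        ext b
        simp only [win, map_mul, Complex.conj_ofReal]
        rw [sub_dotProduct, sub_eq_add_neg, ee_add, dotProduct_neg, sub_sub_cancel,
          show x + v - (x - b) = b + v by abel]
        ring
    _ = amb ϕ (-p) v * sh ξ η p v := by
        rw [sh, ← integral_const_mul]


/-- Rescaled ambiguity function. -/
def cf {n : ℕ} (ϕ : X n → ℝ) (t : ℝ) (p q : X n) : ℂ :=
  ∫ b : X n, ee (t * (b ⬝ᵥ p)) * ((ϕ (b + t • q) : ℂ) * (ϕ b : ℂ))

lemma cf_bound {n : ℕ} {ϕ : X n → ℝ} (hϕ : Window ϕ) :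
    ∃ K : ℝ, ∀ t p q, ‖cf ϕ t p q‖ ≤ K := by
  have c1 := hϕ.smooth.continuous
  have i1 : Integrable ϕ volume := c1.integrable_of_hasCompactSupport hϕ.supp
  obtain ⟨C, hC⟩ := c1.bounded_above_of_compact_support hϕ.supp
  refine ⟨∫ b, C * ‖ϕ b‖, fun t p q => ?_⟩
  refine norm_integral_le_of_norm_le (i1.norm.const_mul C) (ae_of_all _ fun b => ?_)
  simp only [norm_mul, norm_ee, one_mul, Complex.norm_real]
  gcongr
  exact hC _

lemma cf_continuous {n : ℕ} {ϕ : X n → ℝ} (hϕ : Window ϕ) :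
    Continuous (fun z : ℝ × X n × X n => cf ϕ z.1 z.2.1 z.2.2) := by
  have c1 := hϕ.smooth.continuous
  have i1 : Integrable ϕ volume := c1.integrable_of_hasCompactSupport hϕ.supp
  obtain ⟨C, hC⟩ := c1.bounded_above_of_compact_support hϕ.supp
  unfold cf
  refine continuous_of_dominated (bound := fun b => C * ‖ϕ b‖) (fun z => ?_) (fun z => ?_)
    (i1.norm.const_mul C) (ae_of_all _ fun b => ?_)
  · apply Continuous.aestronglyMeasurable
    fun_prop
  · refine ae_of_all _ fun b => ?_
    simp only [norm_mul, norm_ee, one_mul, Complex.norm_real]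
    gcongr
    exact hC _
  · fun_prop

lemma cf_zero {n : ℕ} {ϕ : X n → ℝ} (hϕ : Window ϕ) (p q : X n) : cf ϕ 0 p q = 1 := by
  unfold cf
  simp only [zero_mul, ee_zero, zero_smul, add_zero, one_mul]
  have : ∀ b, (ϕ b : ℂ) * (ϕ b : ℂ) = ((ϕ b ^ 2 : ℝ) : ℂ) := by
    intro b; push_cast; ring
  simp only [this]
  rw [integral_complex_ofReal, hϕ.norm]
  simp

lemma cf_tendsto {n : ℕ} {ϕ : X n → ℝ} (hϕ : Window ϕ) (p q : X n) :
    Tendsto (fun t => cf ϕ t p q) (𝓝 0) (𝓝 1) := by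
  rw [← cf_zero hϕ p q]
  have := (cf_continuous hϕ).comp (show Continuous (fun t : ℝ => (t, p, q)) by fun_prop)
  exact this.tendsto 0

/-- Rescaled window. -/
def sc {n : ℕ} (ϕ : X n → ℝ) (t : ℝ) (x : X n) : ℝ := √((t ^ n)⁻¹) * ϕ (t⁻¹ • x)

lemma sc_window {n : ℕ} {ϕ : X n → ℝ} (hϕ : Window ϕ) {t : ℝ} (ht : 0 < t) : Window (sc ϕ t) := by
  refine ⟨?_, ?_, ?_⟩
  · unfold sc
    exact contDiff_const.mul (hϕ.smooth.comp (contDiff_const_smul _))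
  · exact (hϕ.supp.comp_smul (inv_ne_zero ht.ne')).mul_left
  · unfold sc
    simp only [mul_pow]
    rw [Real.sq_sqrt (by positivity), integral_const_mul,
      Measure.integral_comp_smul volume (fun x : X n => ϕ x ^ 2) t⁻¹, hϕ.norm,
      Module.finrank_fin_fun, abs_of_pos (by positivity)]
    simp only [smul_eq_mul, mul_one, inv_pow, inv_inv]
    exact inv_mul_cancel₀ (by positivity)

lemma amb_sc {n : ℕ} (ϕ : X n → ℝ) {t : ℝ} (ht : 0 < t) (p q : X n) :
    amb (sc ϕ t) p (t ^ 2 • q) = cf ϕ t p q := by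
  unfold amb cf
  have s := Measure.integral_comp_smul (volume : Measure (X n)) (fun b : X n =>
    ee (b ⬝ᵥ p) * ((sc ϕ t (b + t ^ 2 • q) : ℂ) * (sc ϕ t b : ℂ))) t
  rw [Module.finrank_fin_fun, abs_of_pos (by positivity)] at s
  have htn : (t ^ n) ≠ 0 := by positivity
  have s' := congrArg (fun z : ℂ => (t ^ n) • z) s
  simp only [smul_smul, mul_inv_cancel₀ htn, one_smul] at s'
  rw [← s', ← integral_smul]
  congr 1
  ext b
  have e1 : t⁻¹ • (t • b + t ^ 2 • q) = b + t • q := by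
    rw [smul_add, smul_smul, smul_smul, inv_mul_cancel₀ ht.ne', one_smul]
    congr 2
    field_simp
  have e2 : t⁻¹ • t • b = b := by
    rw [smul_smul, inv_mul_cancel₀ ht.ne', one_smul]
  have e3 : (((√((t ^ n)⁻¹) : ℝ) : ℂ)) * ((√((t ^ n)⁻¹) : ℝ) : ℂ) = (((t ^ n)⁻¹ : ℝ) : ℂ) := by
    rw [← Complex.ofReal_mul, Real.mul_self_sqrt (by positivity)]
  have e4 : ((t ^ n : ℝ) : ℂ) * (((t ^ n)⁻¹ : ℝ) : ℂ) = 1 := by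
    rw [← Complex.ofReal_mul, mul_inv_cancel₀ htn, Complex.ofReal_one]
  simp only [sc, e1, e2, smul_dotProduct, smul_eq_mul, Complex.real_smul]
  push_cast [Complex.ofReal_mul] at e3 e4 ⊢
  linear_combination (ee (t * (b ⬝ᵥ p)) * ϕ (b + t • q) * ϕ b) * ((t : ℂ) ^ n * e3 + e4)

lemma exists_window (n : ℕ) : ∃ ϕ : X n → ℝ, Window ϕ := by
  let b : ContDiffBump (0 : X n) := ⟨1, 2, by norm_num, by norm_num⟩
  have c := b.continuous
  have hs : HasCompactSupport (fun x => b x ^ 2) :=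
    b.hasCompactSupport.comp_left (g := fun z => z ^ 2) (by simp)
  have hpos : 0 < ∫ x, b x ^ 2 := by
    refine Continuous.integral_pos_of_hasCompactSupport_nonneg_nonzero (x := 0) (by fun_prop) hs
      (fun x => by positivity) ?_
    have : b 0 = 1 := b.one_of_mem_closedBall (by simp [b])
    simp [this]
  refine ⟨fun x => (√(∫ x, b x ^ 2))⁻¹ * b x, contDiff_const.mul b.contDiff,
    b.hasCompactSupport.mul_left, ?_⟩
  simp only [mul_pow, inv_pow]
  rw [integral_const_mul, Real.sq_sqrt hpos.le, inv_mul_cancel₀ hpos.ne']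

lemma sh_bound {n : ℕ} {ξ η : X n → ℂ} (hξ : MemLp ξ 2 volume) (hη : MemLp η 2 volume) (p v : X n) :
    ‖sh ξ η p v‖ ≤ (eLpNorm ξ 2 volume).toReal * (eLpNorm η 2 volume).toReal := by
  rw [← ENNReal.toReal_mul]
  refine (norm_integral_le_lintegral_norm _).trans ?_
  refine ENNReal.toReal_mono (ENNReal.mul_lt_top hξ.2 hη.2).ne ?_
  refine le_trans (le_of_eq ?_) (cs_lintegral hξ.1 hη.1 v)
  refine lintegral_congr fun x => ?_
  rw [norm_mul, norm_mul, norm_ee, one_mul, RCLike.norm_conj, ENNReal.ofReal_mul (norm_nonneg _),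
    ofReal_norm, ofReal_norm]

lemma Fsh_integrable {n : ℕ} (F : SchwartzMap (X n × X n) ℂ) (h : ℝ) {ξ η : X n → ℂ}
    (hξ : MemLp ξ 2 volume) (hη : MemLp η 2 volume) :
    Integrable (fun w : X n × X n => F w * sh ξ η w.1 (h • w.2)) volume := by
  have := (Gint_integrable F h hξ hη).integral_prod_left
  refine this.congr (ae_of_all _ fun w => ?_)
  simp only [sh]
  rw [← integral_const_mul]
  congr 1
  ext x
  simp only [Gint]
  ring

lemma symbol_bdd {n : ℕ} (f : SchwartzMap (X n × X n) ℂ) : BddAbove (range fun p => ‖f p‖) := by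
  obtain ⟨C, hC⟩ := f.decay 0 0
  refine ⟨C, ?_⟩
  rintro _ ⟨p, rfl⟩
  simpa using hC.2 p

/-- The anti-Wick type form is bounded by the sup norm of the symbol. -/
lemma antiWick_bound {n : ℕ} {f F : SchwartzMap (X n × X n) ℂ} (hF : IsRep f F) {ϕ : X n → ℝ}
    (hϕ : Window ϕ) {ξ η : X n → ℂ} (hξ : ContDiff ℝ ∞ ξ)
    (hξ' : HasCompactSupport ξ) (hη : ContDiff ℝ ∞ η) (hη' : HasCompactSupport η) (h : ℝ) :
    ‖∫ w : X n × X n, F w * (amb ϕ (-w.1) (h • w.2) * sh ξ η w.1 (h • w.2))‖ ≤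
      (⨆ p : X n × X n, ‖f p‖) * ((eLpNorm ξ 2 volume).toReal * (eLpNorm η 2 volume).toReal) := by
  have iVV := VV_integrable hϕ hξ hξ' hη hη'
  have hM : 0 ≤ ⨆ p : X n × X n, ‖f p‖ := Real.iSup_nonneg fun _ => norm_nonneg _
  have key : ∫ w : X n × X n, F w * (amb ϕ (-w.1) (h • w.2) * sh ξ η w.1 (h • w.2)) =
      ∫ z : X n × X n, f (z.1, h • z.2) * (V ϕ ξ z * (starRingEnd ℂ) (V ϕ η z)) ∂(volume.prod volume) := by
    calc ∫ w : X n × X n, F w * (amb ϕ (-w.1) (h • w.2) * sh ξ η w.1 (h • w.2))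
        = ∫ w : X n × X n, ∫ z : X n × X n, F w * (ee (z.1 ⬝ᵥ w.1 + z.2 ⬝ᵥ (h • w.2)) *
            (V ϕ ξ z * (starRingEnd ℂ) (V ϕ η z))) ∂(volume.prod volume) := by
          congr 1
          ext w
          rw [← V_moyal hϕ hξ hξ' hη hη', ← integral_const_mul]
      _ = ∫ z : X n × X n, ∫ w : X n × X n, F w * (ee (z.1 ⬝ᵥ w.1 + z.2 ⬝ᵥ (h • w.2)) *
            (V ϕ ξ z * (starRingEnd ℂ) (V ϕ η z))) ∂volume ∂(volume.prod volume) := by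
          apply integral_integral_swap
          refine ((F_integrable F).norm.mul_prod iVV.norm).mono' ?_ ?_
          · unfold Function.uncurry
            refine AEStronglyMeasurable.mul (Continuous.aestronglyMeasurable (by fun_prop)) ?_
            refine AEStronglyMeasurable.mul (Continuous.aestronglyMeasurable (by fun_prop)) ?_
            exact iVV.aestronglyMeasurable.comp_snd
          · refine ae_of_all _ fun z => ?_
            simp [Function.uncurry, norm_ee]
      _ = _ := by
          congr 1
          ext z
          rw [hF, ← integral_mul_const]
          congr 1
          ext w
          rw [dotProduct_smul, smul_dotProduct]
          ring
  rw [key, ← ENNReal.toReal_mul]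
  refine (norm_integral_le_of_norm_le (iVV.norm.const_mul (⨆ p : X n × X n, ‖f p‖))
    (ae_of_all _ fun z => ?_)).trans ?_
  · rw [norm_mul]
    gcongr
    exact le_ciSup (symbol_bdd f) (z.1, h • z.2)
  · rw [integral_const_mul]
    gcongr
    have := eLpNorm_smul_le_mul_eLpNorm (p := 2) (q := 2) (r := 1) (V_memLp hϕ hη hη').star.1
      (V_memLp hϕ hξ hξ').1
    rw [integral_norm_eq_lintegral_enorm iVV.1]
    refine ENNReal.toReal_mono (ENNReal.mul_lt_top
      (hξ.continuous.memLp_of_hasCompactSupport hξ').2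
      (hη.continuous.memLp_of_hasCompactSupport hη').2).ne ?_
    rw [eLpNorm_star, V_norm hϕ hξ hξ', V_norm hϕ hη hη', eLpNorm_one_eq_lintegral_enorm] at this
    exact this


/-- The error term. -/
def dl {n : ℕ} (F : SchwartzMap (X n × X n) ℂ) (ϕ : X n → ℝ) (t : ℝ) : ℝ :=
  ∫ w : X n × X n, ‖F w‖ * ‖1 - cf ϕ t (-w.1) w.2‖

lemma cf_continuous_w {n : ℕ} {ϕ : X n → ℝ} (hϕ : Window ϕ) (t : ℝ) :
    Continuous (fun w : X n × X n => cf ϕ t w.1 w.2) :=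
  (cf_continuous hϕ).comp (g := fun z : ℝ × X n × X n => cf ϕ z.1 z.2.1 z.2.2)
    (f := fun w : X n × X n => (t, w.1, w.2)) (by fun_prop)

lemma cf_continuous_neg {n : ℕ} {ϕ : X n → ℝ} (hϕ : Window ϕ) (t : ℝ) :
    Continuous (fun w : X n × X n => cf ϕ t (-w.1) w.2) :=
  (cf_continuous_w hϕ t).comp (f := fun w : X n × X n => (-w.1, w.2)) (by fun_prop)

lemma dl_tendsto {n : ℕ} (F : SchwartzMap (X n × X n) ℂ) {ϕ : X n → ℝ} (hϕ : Window ϕ) :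
    Tendsto (dl F ϕ) (𝓝 0) (𝓝 0) := by
  obtain ⟨K, hK⟩ := cf_bound hϕ
  have h0 : (0 : ℝ) = ∫ _ : X n × X n, (0 : ℝ) := by simp
  conv => arg 3; rw [h0]
  unfold dl
  refine tendsto_integral_filter_of_dominated_convergence (fun w => ‖F w‖ * (1 + K)) ?_ ?_ ?_ ?_
  · refine Eventually.of_forall fun t => ?_
    have := cf_continuous_neg hϕ t
    exact Continuous.aestronglyMeasurable (by fun_prop)
  · refine Eventually.of_forall fun t => ae_of_all _ fun w => ?_
    rw [norm_mul, norm_norm, norm_norm]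
    gcongr
    refine (norm_sub_le _ _).trans ?_
    simpa using hK t (-w.1) w.2
  · exact (F_integrable F).norm.mul_const _
  · refine ae_of_all _ fun w => ?_
    have := (((cf_tendsto hϕ (-w.1) w.2).const_sub 1).norm).const_mul ‖F w‖
    simpa using this

lemma upper_smooth {n : ℕ} {f F : SchwartzMap (X n × X n) ℂ} (hF : IsRep f F) {ϕ : X n → ℝ}
    (hϕ : Window ϕ) {t : ℝ} (ht : 0 < t) {ξ η : X n → ℂ} (hξ : ContDiff ℝ ∞ ξ)
    (hξ' : HasCompactSupport ξ) (hη : ContDiff ℝ ∞ η) (hη' : HasCompactSupport η) :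
    ‖∫ w : X n × X n, F w * sh ξ η w.1 (t ^ 2 • w.2)‖ ≤
      ((⨆ p : X n × X n, ‖f p‖) + dl F ϕ t) *
        ((eLpNorm ξ 2 volume).toReal * (eLpNorm η 2 volume).toReal) := by
  obtain ⟨K, hK⟩ := cf_bound hϕ
  have mξ : MemLp ξ 2 volume := hξ.continuous.memLp_of_hasCompactSupport hξ'
  have mη : MemLp η 2 volume := hη.continuous.memLp_of_hasCompactSupport hη'
  have i0 := Fsh_integrable F (t ^ 2) mξ mη
  have cc := cf_continuous_neg hϕ t
  have i1 : Integrable (fun w : X n × X n =>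
      F w * (amb (sc ϕ t) (-w.1) (t ^ 2 • w.2) * sh ξ η w.1 (t ^ 2 • w.2))) volume := by
    refine ((i0.bdd_mul (c := K) cc.aestronglyMeasurable
      (ae_of_all _ fun w => hK t (-w.1) w.2))).congr (ae_of_all _ fun w => ?_)
    simp only [amb_sc ϕ ht]
    ring
  have i2 : Integrable (fun w : X n × X n =>
      (1 - cf ϕ t (-w.1) w.2) * (F w * sh ξ η w.1 (t ^ 2 • w.2))) volume := by
    refine (i0.sub i1).congr (ae_of_all _ fun w => ?_)
    simp only [amb_sc ϕ ht, Pi.sub_apply]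
    ring
  have e : ∫ w : X n × X n, F w * sh ξ η w.1 (t ^ 2 • w.2) =
      (∫ w : X n × X n, F w * (amb (sc ϕ t) (-w.1) (t ^ 2 • w.2) * sh ξ η w.1 (t ^ 2 • w.2))) +
      ∫ w : X n × X n, (1 - cf ϕ t (-w.1) w.2) * (F w * sh ξ η w.1 (t ^ 2 • w.2)) := by
    rw [← integral_add i1 i2]
    congr 1
    ext w
    rw [amb_sc ϕ ht]
    ring
  rw [e, add_mul]
  refine (norm_add_le _ _).trans (add_le_add
    (antiWick_bound hF (sc_window hϕ ht) hξ hξ' hη hη' (t ^ 2)) ?_)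
  unfold dl
  rw [← integral_mul_const]
  refine norm_integral_le_of_norm_le ?_ (ae_of_all _ fun w => ?_)
  · refine Integrable.mul_const ?_ _
    refine ((F_integrable F).norm.mul_const (1 + K)).mono'
      (Continuous.aestronglyMeasurable (by fun_prop)) (ae_of_all _ fun w => ?_)
    rw [norm_mul, norm_norm, norm_norm]
    gcongr
    refine (norm_sub_le _ _).trans ?_
    simpa using hK t (-w.1) w.2
  · rw [norm_mul, norm_mul]
    refine le_trans (le_of_eq (mul_left_comm _ _ _)) ?_
    rw [← mul_assoc]
    exact mul_le_mul_of_nonneg_left (sh_bound mξ mη w.1 (t ^ 2 • w.2)) (by positivity)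

lemma dl_nonneg {n : ℕ} (F : SchwartzMap (X n × X n) ℂ) (ϕ : X n → ℝ) (t : ℝ) : 0 ≤ dl F ϕ t :=
  integral_nonneg fun _ => by positivity

lemma upper {n : ℕ} {f F : SchwartzMap (X n × X n) ℂ} (hF : IsRep f F) {ϕ : X n → ℝ}
    (hϕ : Window ϕ) {t ℏ : ℝ} (ht : 0 < t) (hh : 0 < ℏ) (hth : t ^ 2 = 2 * Real.pi * ℏ)
    {T : L2X n →L[ℂ] L2X n} (hT : opSpec n ℏ (⇑f) T) :
    ‖T‖ ≤ (⨆ p : X n × X n, ‖f p‖) + dl F ϕ t := by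
  set C : ℝ := (⨆ p : X n × X n, ‖f p‖) + dl F ϕ t with hC
  have hC0 : 0 ≤ C := add_nonneg (Real.iSup_nonneg fun _ => norm_nonneg _) (dl_nonneg _ _ _)
  have hd := MeasureTheory.Lp.dense_hasCompactSupport_contDiff (E := X n) (F := ℂ)
    (μ := (volume : Measure (X n))) (p := 2) (by simp)
  have key : ∀ ξ η : L2X n, ‖inner ℂ η (T ξ)‖ ≤ C * (‖ξ‖ * ‖η‖) := by
    refine isClosed_property2 (p := fun ξ η : L2X n => ‖inner ℂ η (T ξ)‖ ≤ C * (‖ξ‖ * ‖η‖))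
      hd.denseRange_val ?_ ?_
    · exact isClosed_le (by fun_prop) (by fun_prop)
    · rintro ⟨ξL, ξ, he, hξ', hξ⟩ ⟨ηL, η, he', hη', hη⟩
      have h1 := opSpec_Hop hF hh hT ξL ηL ξ η
        (hξ.continuous.integrable_of_hasCompactSupport hξ') he he'
      have h2 := upper_smooth hF hϕ ht hξ hξ' hη hη'
      rw [hth] at h2
      simp only
      rw [h1, Lp.norm_def, Lp.norm_def, eLpNorm_congr_ae he, eLpNorm_congr_ae he']
      exact h2
  refine T.opNorm_le_bound hC0 fun ξ => ?_
  have := key ξ (T ξ)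
  rw [inner_self_eq_norm_sq_to_K] at this
  rcases eq_or_lt_of_le (norm_nonneg (T ξ)) with h0 | h0
  · rw [← h0]; positivity
  · simp only [norm_pow, Complex.coe_algebraMap, Complex.norm_real, norm_norm] at this
    nlinarith

/-- Coherent state. -/
def coh {n : ℕ} (ϕ : X n → ℝ) (t : ℝ) (x0 θ0 : X n) (x : X n) : ℂ :=
  (sc ϕ t (x - x0) : ℂ) * ee ((t ^ 2)⁻¹ * (x ⬝ᵥ θ0))

lemma coh_sh {n : ℕ} (ϕ : X n → ℝ) {t : ℝ} (ht : 0 < t) (x0 θ0 p q : X n) :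
    sh (coh ϕ t x0 θ0) (coh ϕ t x0 θ0) p (t ^ 2 • q) =
      ee (x0 ⬝ᵥ p + θ0 ⬝ᵥ q) * cf ϕ t p q := by
  unfold sh
  rw [← integral_add_right_eq_self _ x0, ← amb_sc ϕ ht, amb, ← integral_const_mul]
  congr 1
  ext x
  have a1 : x + x0 + t ^ 2 • q - x0 = x + t ^ 2 • q := by abel
  have a2 : x + x0 - x0 = x := by abel
  simp only [coh, a1, a2, map_mul, conj_ee, Complex.conj_ofReal]
  have a3 : ee (x0 ⬝ᵥ p + θ0 ⬝ᵥ q) * ee (x ⬝ᵥ p) = ee ((x + x0) ⬝ᵥ p) *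
      (ee ((t ^ 2)⁻¹ * ((x + x0 + t ^ 2 • q) ⬝ᵥ θ0)) * ee (-((t ^ 2)⁻¹ * ((x + x0) ⬝ᵥ θ0)))) := by
    rw [← ee_add, ← ee_add, ← ee_add]
    congr 1
    simp only [add_dotProduct, smul_dotProduct, smul_eq_mul, dotProduct_comm θ0 q]
    field_simp
    ring
  linear_combination (-(sc ϕ t (x + t ^ 2 • q) : ℂ) * (sc ϕ t x : ℂ)) * a3

lemma coh_cont {n : ℕ} {ϕ : X n → ℝ} (hϕ : Window ϕ) {t : ℝ} (ht : 0 < t) (x0 θ0 : X n) :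
    Continuous (coh ϕ t x0 θ0) := by
  unfold coh
  have := (sc_window hϕ ht).smooth.continuous
  fun_prop

lemma coh_supp {n : ℕ} {ϕ : X n → ℝ} (hϕ : Window ϕ) {t : ℝ} (ht : 0 < t) (x0 θ0 : X n) :
    HasCompactSupport (coh ϕ t x0 θ0) := by
  unfold coh
  refine HasCompactSupport.mul_right (f := fun x => (sc ϕ t (x - x0) : ℂ)) ?_
  have := ((sc_window hϕ ht).supp.comp_homeomorph (Homeomorph.subRight x0))
  exact this.comp_left (g := fun r : ℝ => (r : ℂ)) (by simp)

lemma coh_norm {n : ℕ} {ϕ : X n → ℝ} (hϕ : Window ϕ) {t : ℝ} (ht : 0 < t) (x0 θ0 : X n) :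
    eLpNorm (coh ϕ t x0 θ0) 2 volume = 1 := by
  rw [eLpNorm_two_eq]
  simp only [coh, enorm_mul]
  have : ∀ s, ‖ee s‖ₑ = 1 := fun s => by rw [← ofReal_norm, norm_ee]; simp
  simp only [this, mul_one]
  rw [lintegral_sub_right_eq_self (fun x => ‖(sc ϕ t x : ℂ)‖ₑ ^ 2) x0, (sc_window hϕ ht).lint]
  simp

lemma lower {n : ℕ} {f F : SchwartzMap (X n × X n) ℂ} (hF : IsRep f F) {ϕ : X n → ℝ}
    (hϕ : Window ϕ) {t ℏ : ℝ} (ht : 0 < t) (hh : 0 < ℏ) (hth : t ^ 2 = 2 * Real.pi * ℏ)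
    {T : L2X n →L[ℂ] L2X n} (hT : opSpec n ℏ (⇑f) T) (x0 θ0 : X n) :
    ‖∫ w : X n × X n, F w * (ee (x0 ⬝ᵥ w.1 + θ0 ⬝ᵥ w.2) * cf ϕ t w.1 w.2)‖ ≤ ‖T‖ := by
  have hc := coh_cont hϕ ht x0 θ0
  have hs := coh_supp hϕ ht x0 θ0
  have m : MemLp (coh ϕ t x0 θ0) 2 volume := hc.memLp_of_hasCompactSupport hs
  have h1 := opSpec_Hop hF hh hT (m.toLp _) (m.toLp _) _ _
    (hc.integrable_of_hasCompactSupport hs) m.coeFn_toLp m.coeFn_toLp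
  have hn : ‖m.toLp‖ = 1 := by
    rw [Lp.norm_toLp, coh_norm hϕ ht]
    simp
  have h2 : inner ℂ (m.toLp _) (T (m.toLp _)) =
      ∫ w : X n × X n, F w * (ee (x0 ⬝ᵥ w.1 + θ0 ⬝ᵥ w.2) * cf ϕ t w.1 w.2) := by
    rw [h1]
    congr 1
    ext w
    rw [← coh_sh ϕ ht, hth]
    rfl
  rw [← h2]
  refine (norm_inner_le_norm _ _).trans ?_
  rw [hn, one_mul]
  simpa [hn] using T.le_opNorm (m.toLp _)

lemma lower_tendsto {n : ℕ} {f F : SchwartzMap (X n × X n) ℂ} (hF : IsRep f F) {ϕ : X n → ℝ}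
    (hϕ : Window ϕ) (x0 θ0 : X n) :
    Tendsto (fun t => ‖∫ w : X n × X n, F w * (ee (x0 ⬝ᵥ w.1 + θ0 ⬝ᵥ w.2) * cf ϕ t w.1 w.2)‖)
      (𝓝 0) (𝓝 ‖f (x0, θ0)‖) := by
  obtain ⟨K, hK⟩ := cf_bound hϕ
  rw [hF x0 θ0]
  refine Tendsto.norm ?_
  refine tendsto_integral_filter_of_dominated_convergence (fun w => ‖F w‖ * K) ?_ ?_ ?_ ?_
  · refine Eventually.of_forall fun t => ?_
    have := cf_continuous_w hϕ t
    exact Continuous.aestronglyMeasurable (by fun_prop)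
  · refine Eventually.of_forall fun t => ae_of_all _ fun w => ?_
    rw [norm_mul, norm_mul, norm_ee, one_mul]
    gcongr
    exact hK _ _ _
  · exact (F_integrable F).norm.mul_const _
  · refine ae_of_all _ fun w => ?_
    simpa using ((cf_tendsto hϕ w.1 w.2).const_mul (ee (x0 ⬝ᵥ w.1 + θ0 ⬝ᵥ w.2))).const_mul (F w)

lemma main_limit {n : ℕ} (f : SchwartzMap (X n × X n) ℂ) (T : ℝ → (L2X n →L[ℂ] L2X n))
    (hT : ∀ ℏ ∈ Ioc (0:ℝ) 1, opSpec n ℏ (⇑f) (T ℏ)) :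
    Tendsto (fun ℏ => ‖T ℏ‖) (𝓝[>] (0:ℝ)) (𝓝 (⨆ p : X n × X n, ‖f p‖)) := by
  obtain ⟨F, hF⟩ := exists_rep f
  obtain ⟨ϕ, hϕ⟩ := exists_window n
  have hpi := Real.pi_pos
  have ht : Tendsto (fun ℏ : ℝ => √(2 * Real.pi * ℏ)) (𝓝[>] 0) (𝓝 0) := by
    have : Continuous (fun ℏ : ℝ => √(2 * Real.pi * ℏ)) := by fun_prop
    have h := this.tendsto 0
    simp only [mul_zero, Real.sqrt_zero] at h
    exact h.mono_left nhdsWithin_le_nhds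
  have hev : ∀ᶠ ℏ : ℝ in 𝓝[>] 0, ℏ ∈ Ioc (0:ℝ) 1 := Ioc_mem_nhdsGT one_pos
  rw [tendsto_order]
  constructor
  · intro a ha
    obtain ⟨⟨x0, θ0⟩, hp⟩ := exists_lt_of_lt_ciSup ha
    have h1 := ((lower_tendsto hF hϕ x0 θ0).comp ht).eventually (lt_mem_nhds hp)
    filter_upwards [h1, hev] with ℏ h2 h3
    have h4 : 0 < 2 * Real.pi * ℏ := by have := h3.1; positivity
    exact lt_of_lt_of_le h2 (lower hF hϕ (Real.sqrt_pos.2 h4) h3.1 (Real.sq_sqrt h4.le) (hT ℏ h3) x0 θ0)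
  · intro a ha
    have h0 := ((dl_tendsto F hϕ).comp ht).const_add (⨆ p : X n × X n, ‖f p‖)
    rw [add_zero] at h0
    have h1 := h0.eventually (gt_mem_nhds ha)
    filter_upwards [h1, hev] with ℏ h2 h3
    have h4 : 0 < 2 * Real.pi * ℏ := by have := h3.1; positivity
    exact lt_of_le_of_lt (upper hF hϕ (Real.sqrt_pos.2 h4) h3.1 (Real.sq_sqrt h4.le) (hT ℏ h3)) h2


end PsiDO

/-- For every Schwartz function `f` on `ℝⁿ×ℝⁿ`, the ℏ-scaled pseudodifferential operator
`op_ℏ(f)` is a bounded operator on `L²(ℝⁿ)` for each `0 < ℏ ≤ 1`, and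
`lim_{ℏ→0⁺} ‖op_ℏ(f)‖ = sup_{(x,θ)} |f(x,θ)|`. -/
theorem statement0 (n : ℕ) (hn : 1 ≤ n) (f : SchwartzMap (X n × X n) ℂ) :
    (∀ ℏ ∈ Ioc (0:ℝ) 1, ∃ T : L2X n →L[ℂ] L2X n, opSpec n ℏ (⇑f) T) ∧
    (∀ T : ℝ → (L2X n →L[ℂ] L2X n), (∀ ℏ ∈ Ioc (0:ℝ) 1, opSpec n ℏ (⇑f) (T ℏ)) →
      Tendsto (fun ℏ => ‖T ℏ‖) (𝓝[>] (0:ℝ)) (𝓝 (⨆ p : X n × X n, ‖f p‖))) := by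
  exact ⟨fun ℏ hℏ => PsiDO.exists_op f hℏ.1, fun T hT => PsiDO.main_limit f T hT⟩
end
end

section
/- For all Schwartz functions f,g on ℝⁿ×ℝⁿ, lim_{ℏ→0⁺} ‖op_ℏ(f) op_ℏ(g) − op_ℏ(fg)‖ = 0, where fg denotes the pointwise product and ‖·‖ is the operator norm on L²(ℝⁿ); i.e., the quantization op_ℏ is asymptotically multiplicative. -/
open MeasureTheory Filter Topology Set
open scoped ContDiff

noncomputable section

/-- Dot product. -/
def dt {n : ℕ} (x y : X n) : ℝ := ∑ i, x i * y i

/-- `e^{it}`. -/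
def ee (t : ℝ) : ℂ := Complex.exp (Complex.I * Complex.ofReal t)

lemma norm_ee (t : ℝ) : ‖ee t‖ = 1 := by
  rw [ee, mul_comm, Complex.norm_exp_ofReal_mul_I]

lemma ee_add (s t : ℝ) : ee (s + t) = ee s * ee t := by
  simp only [ee, ← Complex.exp_add]; push_cast; ring_nf

lemma ee_zero : ee 0 = 1 := by simp [ee]

@[fun_prop]
lemma continuous_ee : Continuous ee := by unfold ee; fun_prop

@[fun_prop]
lemma continuous_dt {n : ℕ} : Continuous (fun z : X n × X n => dt z.1 z.2) := by
  unfold dt; fun_prop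

lemma measurable_ee : Measurable ee := continuous_ee.measurable

lemma measurable_dt {n : ℕ} {Ω : Type} [MeasurableSpace Ω] {p q : Ω → X n}
    (hp : Measurable p) (hq : Measurable q) : Measurable (fun w => dt (p w) (q w)) :=
  continuous_dt.measurable.comp (hp.prodMk hq)

lemma dt_add_left {n : ℕ} (x y z : X n) : dt (x + y) z = dt x z + dt y z := by
  simp [dt, add_mul, Finset.sum_add_distrib]

lemma dt_add_right {n : ℕ} (x y z : X n) : dt x (y + z) = dt x y + dt x z := by
  simp [dt, mul_add, Finset.sum_add_distrib]

lemma dt_smul_right {n : ℕ} (c : ℝ) (x y : X n) : dt x (c • y) = c * dt x y := by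
  simp only [dt, Pi.smul_apply, smul_eq_mul, Finset.mul_sum]
  exact Finset.sum_congr rfl fun i _ => by ring

lemma dt_smul_left {n : ℕ} (c : ℝ) (x y : X n) : dt (c • x) y = c * dt x y := by
  simp only [dt, Pi.smul_apply, smul_eq_mul, Finset.mul_sum]
  exact Finset.sum_congr rfl fun i _ => by ring

lemma dt_comm {n : ℕ} (x y : X n) : dt x y = dt y x := by
  simp only [dt, mul_comm]

/-- The `L²` norm of a function. -/
def N2 {n : ℕ} (η : X n → ℂ) : ℝ := (eLpNorm η 2 volume).toReal

lemma N2_nonneg {n : ℕ} (η : X n → ℂ) : 0 ≤ N2 η := ENNReal.toReal_nonneg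

lemma holder_int {n : ℕ} {η ξ : X n → ℂ} (hη : MemLp η 2 volume) (hξ : MemLp ξ 2 volume) :
    Integrable (fun x => η x * ξ x) volume := hη.integrable_mul hξ

lemma holder_le {n : ℕ} {η ξ : X n → ℂ} (hη : MemLp η 2 volume) (hξ : MemLp ξ 2 volume) :
    ∫ x, ‖η x * ξ x‖ ≤ N2 η * N2 ξ := by
  rw [integral_norm_eq_lintegral_enorm (holder_int hη hξ).1, ← eLpNorm_one_eq_lintegral_enorm,
    N2, N2, ← ENNReal.toReal_mul]
  apply ENNReal.toReal_mono (ENNReal.mul_ne_top hη.2.ne hξ.2.ne)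
  have := eLpNorm_smul_le_mul_eLpNorm (p := 2) (q := 2) (r := 1) hξ.1 hη.1
  exact this

/-- Phase-space translate. -/
def tr {n : ℕ} (a b : X n) (ξ : X n → ℂ) : X n → ℂ := fun x => ee (dt a x) * ξ (x + b)

lemma sm_tr {n : ℕ} (a b : X n) {ξ : X n → ℂ} (hξ : Measurable ξ) : Measurable (tr a b ξ) := by
  unfold tr
  exact (measurable_ee.comp (measurable_dt measurable_const measurable_id)).mul
    (hξ.comp (by fun_prop : Measurable (fun x : X n => x + b)))

lemma norm_tr {n : ℕ} (a b : X n) (ξ : X n → ℂ) (x : X n) : ‖tr a b ξ x‖ = ‖ξ (x + b)‖ := by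
  simp [tr, norm_ee]

lemma eLpNorm_tr {n : ℕ} (a b : X n) {ξ : X n → ℂ} (hξ : Measurable ξ) :
    eLpNorm (tr a b ξ) 2 volume = eLpNorm ξ 2 volume := by
  rw [← eLpNorm_comp_measurePreserving (f := fun x => x + b) hξ.aestronglyMeasurable
    (measurePreserving_add_right volume b)]
  exact eLpNorm_congr_norm_ae (Eventually.of_forall fun x => by simp [norm_tr])

lemma memLp_tr {n : ℕ} (a b : X n) {ξ : X n → ℂ} (hm : Measurable ξ) (hξ : MemLp ξ 2 volume) :
    MemLp (tr a b ξ) 2 volume :=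
  ⟨(sm_tr a b hm).aestronglyMeasurable, by rw [eLpNorm_tr a b hm]; exact hξ.2⟩

lemma N2_tr {n : ℕ} (a b : X n) {ξ : X n → ℂ} (hξ : Measurable ξ) :
    N2 (tr a b ξ) = N2 ξ := by rw [N2, eLpNorm_tr a b hξ, N2]

/-- matrix coefficient -/
def BB {n : ℕ} (η ξ : X n → ℂ) (a b : X n) : ℂ := ∫ x, η x * tr a b ξ x

lemma norm_BB_le {n : ℕ} {η ξ : X n → ℂ} (hη : MemLp η 2 volume) (hm : Measurable ξ)
    (hξ : MemLp ξ 2 volume) (a b : X n) : ‖BB η ξ a b‖ ≤ N2 η * N2 ξ := by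
  rw [← N2_tr a b hm]
  exact (norm_integral_le_integral_norm _).trans (holder_le hη (memLp_tr a b hm hξ))

section rep
variable {n : ℕ} {Ω : Type} [MeasurableSpace Ω] {μ : Measure Ω}
  {h : Ω → ℂ} {p q : Ω → X n}

lemma meas_joint {η ξ : X n → ℂ} (mη : Measurable η) (mξ : Measurable ξ)
    (hp : Measurable p) (hq : Measurable q) :
    Measurable (fun z : Ω × X n => η z.2 * tr (p z.1) (q z.1) ξ z.2) := by
  unfold tr
  exact (mη.comp measurable_snd).mul ((measurable_ee.comp
    (measurable_dt (hp.comp measurable_fst) measurable_snd)).mul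
    (mξ.comp (by fun_prop : Measurable (fun z : Ω × X n => z.2 + q z.1))))

lemma meas_BB {η ξ : X n → ℂ} (mη : Measurable η) (mξ : Measurable ξ)
    (hp : Measurable p) (hq : Measurable q) :
    StronglyMeasurable (fun w => BB η ξ (p w) (q w)) :=
  (meas_joint mη mξ hp hq).stronglyMeasurable.integral_prod_right

lemma int_BB {η ξ : X n → ℂ} (mη : Measurable η) (mξ : Measurable ξ)
    (hη : MemLp η 2 volume) (hξ : MemLp ξ 2 volume)
    (hp : Measurable p) (hq : Measurable q) (hh : Integrable h μ) :
    Integrable (fun w => h w * BB η ξ (p w) (q w)) μ :=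
  hh.mul_bdd (c := N2 η * N2 ξ) (meas_BB mη mξ hp hq).aestronglyMeasurable
    (Eventually.of_forall fun _ => norm_BB_le hη mξ hξ _ _)

lemma int_joint {η ξ : X n → ℂ} (mη : Measurable η) (mξ : Measurable ξ)
    (hη : MemLp η 2 volume) (hξ : MemLp ξ 2 volume)
    (hp : Measurable p) (hq : Measurable q) (hh : Integrable h μ) :
    Integrable (fun z : Ω × X n => h z.1 * (η z.2 * tr (p z.1) (q z.1) ξ z.2))
      (μ.prod volume) := by
  have hm : AEStronglyMeasurable (fun z : Ω × X n => h z.1 * (η z.2 * tr (p z.1) (q z.1) ξ z.2))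
      (μ.prod volume) := hh.1.comp_fst.mul (meas_joint mη mξ hp hq).aestronglyMeasurable
  rw [integrable_prod_iff hm]
  refine ⟨Eventually.of_forall fun w =>
    (holder_int hη (memLp_tr (p w) (q w) mξ hξ)).const_mul (h w), ?_⟩
  refine Integrable.mono' (hh.norm.mul_const (N2 η * N2 ξ)) hm.norm.integral_prod_right'
    (Eventually.of_forall fun w => ?_)
  rw [Real.norm_of_nonneg (integral_nonneg fun _ => norm_nonneg _)]
  simp_rw [norm_mul (h w)]
  rw [integral_const_mul]
  gcongr
  rw [← N2_tr (p w) (q w) mξ]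
  exact holder_le hη (memLp_tr _ _ mξ hξ)

end rep

open scoped FourierTransform in
lemma schwartz_rep {n : ℕ} (f : SchwartzMap (X n × X n) ℂ) :
    ∃ (h : EuclideanSpace ℝ (Fin n ⊕ Fin n) → ℂ) (p q : EuclideanSpace ℝ (Fin n ⊕ Fin n) → X n),
      Integrable h volume ∧ Measurable p ∧ Measurable q ∧
      ∀ x θ, f (x, θ) = ∫ w, h w * ee (dt (p w) x + dt (q w) θ) := by
  let L : EuclideanSpace ℝ (Fin n ⊕ Fin n) ≃L[ℝ] X n × X n :=
    (EuclideanSpace.equiv (Fin n ⊕ Fin n) ℝ).trans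
      (ContinuousLinearEquiv.sumPiEquivProdPi ℝ (Fin n) (Fin n) (fun _ => ℝ))
  let F : SchwartzMap (EuclideanSpace ℝ (Fin n ⊕ Fin n)) ℂ :=
    SchwartzMap.compCLMOfContinuousLinearEquiv ℝ L f
  let F' : SchwartzMap (EuclideanSpace ℝ (Fin n ⊕ Fin n)) ℂ := 𝓕 F
  refine ⟨fun w => F' w, fun w => (2 * Real.pi) • (L w).1, fun w => (2 * Real.pi) • (L w).2,
    F'.integrable, ?_, ?_, ?_⟩
  · exact Continuous.measurable (by fun_prop)
  · exact Continuous.measurable (by fun_prop)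
  intro (x : X n) (θ : X n)
  have h1 : f (x, θ) = (𝓕⁻ (𝓕 F)) (L.symm (x, θ)) := by
    rw [FourierTransform.fourierInv_fourier_eq]
    simp [F]
  rw [h1, SchwartzMap.fourierInv_coe, Real.fourierInv_eq']
  refine integral_congr_ae (Eventually.of_forall fun w => ?_)
  simp only [smul_eq_mul]
  rw [mul_comm]
  congr 1
  rw [ee, mul_comm]
  congr 3
  rw [dt_smul_left, dt_smul_left, ← mul_add]
  congr 1
  rw [PiLp.inner_apply, Fintype.sum_sum_type, dt_comm, dt_comm (L w).2]
  rfl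

open scoped FourierTransform in
lemma schwartz_inv {n : ℕ} (ξ : SchwartzMap (X n) ℂ) :
    ∃ F : X n → ℂ, Integrable F volume ∧
      (∀ θ, F θ = ∫ y : X n, Complex.exp (-(Complex.I) * Complex.ofReal (∑ i, y i * θ i)) * ξ y) ∧
      ∀ x, ξ x = (((2 * Real.pi) ^ n)⁻¹ : ℝ) • ∫ θ : X n, ee (dt x θ) * F θ := by
  let L : EuclideanSpace ℝ (Fin n) ≃L[ℝ] X n := EuclideanSpace.equiv (Fin n) ℝ
  let G : SchwartzMap (EuclideanSpace ℝ (Fin n)) ℂ :=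
    SchwartzMap.compCLMOfContinuousLinearEquiv ℝ L ξ
  have hmp : MeasurePreserving L volume volume := PiLp.volume_preserving_ofLp (Fin n)
  have hme : MeasurableEmbedding L := L.toHomeomorph.measurableEmbedding
  let FF : X n → ℂ := fun y => (𝓕 G) (L.symm y)
  have hFF : Integrable FF volume := by
    rw [← hmp.integrable_comp_emb hme]
    simpa [FF, Function.comp_def] using (𝓕 G).integrable
  have h2pi : (2 * Real.pi) ≠ 0 := by positivity
  refine ⟨fun θ => FF ((2 * Real.pi)⁻¹ • θ), hFF.comp_smul (inv_ne_zero h2pi), ?_, ?_⟩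
  · intro θ
    rw [← hmp.integral_comp hme]
    simp only [FF]
    rw [SchwartzMap.fourier_coe, Real.fourier_eq']
    refine integral_congr_ae (Eventually.of_forall fun w => ?_)
    simp only [smul_eq_mul]
    congr 1
    rw [neg_mul Complex.I, mul_comm Complex.I (Complex.ofReal (∑ i, L w i * θ i)), ← neg_mul (Complex.ofReal _), ← Complex.ofReal_neg]
    congr 3
    rw [PiLp.inner_apply, Finset.mul_sum, ← Finset.sum_neg_distrib]
    refine Finset.sum_congr rfl fun i _ => ?_
    have : (L.symm ((2 * Real.pi)⁻¹ • θ)) i = (2 * Real.pi)⁻¹ * θ i := rfl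
    rw [this]
    have : L w i = w i := rfl
    rw [this]
    simp
    field_simp
  · intro x
    have h1 : ξ x = (𝓕⁻ (𝓕 G)) (L.symm x) := by
      rw [FourierTransform.fourierInv_fourier_eq]
      simp [G]
    have h2 : (∫ θ : X n, ee (dt x θ) * FF ((2 * Real.pi)⁻¹ • θ)) =
        ∫ θ : X n, (fun t => ee (2 * Real.pi * dt x t) * FF t) ((2 * Real.pi)⁻¹ • θ) := by
      refine integral_congr_ae (Eventually.of_forall fun w => ?_)
      simp only [dt_smul_right]
      rw [mul_inv_cancel_left₀ h2pi]
    rw [h2, Measure.integral_comp_inv_smul (volume : Measure (X n))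
        (fun t => ee (2 * Real.pi * dt x t) * FF t), Module.finrank_fin_fun, smul_smul,
      abs_of_nonneg (by positivity), inv_mul_cancel₀ (by positivity), one_smul, h1,
      SchwartzMap.fourierInv_coe, Real.fourierInv_eq', ← hmp.integral_comp hme]
    refine integral_congr_ae (Eventually.of_forall fun w => ?_)
    simp only [smul_eq_mul, FF, ContinuousLinearEquiv.symm_apply_apply]
    congr 1
    rw [ee, mul_comm]
    congr 3

lemma BB_congr {n : ℕ} {η ξ ξ' : X n → ℂ} (hξ : ξ =ᵐ[volume] ξ') (a b : X n) :
    BB η ξ a b = BB η ξ' a b := by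
  have h1 : ∀ᵐ x : X n, ξ (x + b) = ξ' (x + b) :=
    (measurePreserving_add_right volume b).quasiMeasurePreserving.ae hξ
  refine integral_congr_ae ?_
  filter_upwards [h1] with x hx
  simp only [tr, hx]

lemma BB_zero {n : ℕ} (η ξ : X n → ℂ) : BB η ξ 0 0 = ∫ x, η x * ξ x := by
  simp [BB, tr, dt, ee]

lemma measL {n : ℕ} (ξ : L2X n) : Measurable (⇑ξ) := (Lp.stronglyMeasurable ξ).measurable

lemma BB_add {n : ℕ} {η : X n → ℂ} (hη : MemLp η 2 volume) (ξ ξ' : L2X n) (a b : X n) :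
    BB η (⇑(ξ + ξ')) a b = BB η ξ a b + BB η ξ' a b := by
  rw [BB_congr (Lp.coeFn_add ξ ξ'), BB, BB, BB, ← integral_add
    (holder_int hη (memLp_tr a b (measL ξ) (Lp.memLp ξ)))
    (holder_int hη (memLp_tr a b (measL ξ') (Lp.memLp ξ')))]
  refine integral_congr_ae (Eventually.of_forall fun x => ?_)
  simp only [tr, Pi.add_apply]
  ring

lemma BB_smul {n : ℕ} (η : X n → ℂ) (c : ℂ) (ξ : L2X n) (a b : X n) :
    BB η (⇑(c • ξ)) a b = c * BB η ξ a b := by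
  rw [BB_congr (Lp.coeFn_smul c ξ), BB, BB, ← integral_const_mul]
  refine integral_congr_ae (Eventually.of_forall fun x => ?_)
  simp only [tr, Pi.smul_apply, smul_eq_mul]
  ring

lemma norm_int_BB_le {n : ℕ} {Ω : Type} [MeasurableSpace Ω] {μ : Measure Ω}
    {h : Ω → ℂ} (hh : Integrable h μ) {η ξ : X n → ℂ} (hη : MemLp η 2 volume)
    (mξ : Measurable ξ) (hξ : MemLp ξ 2 volume) (p q : Ω → X n) :
    ‖∫ w, h w * BB η ξ (p w) (q w) ∂μ‖ ≤ (∫ w, ‖h w‖ ∂μ) * (N2 η * N2 ξ) := by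
  rw [← integral_mul_const]
  refine norm_integral_le_of_norm_le (hh.norm.mul_const _) (Eventually.of_forall fun w => ?_)
  rw [norm_mul]
  gcongr
  exact norm_BB_le hη mξ hξ _ _

section rep2
variable {n : ℕ} {Ω : Type} [MeasurableSpace Ω] {μ : Measure Ω}
  {h : Ω → ℂ} {p q : Ω → X n}

lemma cont_BB {η : X n → ℂ} (mη : Measurable η) (hη : MemLp η 2 volume)
    (hp : Measurable p) (hq : Measurable q) (hh : Integrable h μ) :
    Continuous (fun ξ : L2X n => ∫ w, h w * BB η ξ (p w) (q w) ∂μ) := by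
  let Λ : L2X n →ₗ[ℂ] ℂ :=
    { toFun := fun ξ => ∫ w, h w * BB η ξ (p w) (q w) ∂μ
      map_add' := by
        intro ξ ξ'
        rw [← integral_add (int_BB mη (measL ξ) hη (Lp.memLp ξ) hp hq hh)
          (int_BB mη (measL ξ') hη (Lp.memLp ξ') hp hq hh)]
        refine integral_congr_ae (Eventually.of_forall fun w => ?_)
        simp only [BB_add hη]
        ring
      map_smul' := by
        intro c ξ
        simp only [RingHom.id_apply, smul_eq_mul]
        rw [← integral_const_mul]
        refine integral_congr_ae (Eventually.of_forall fun w => ?_)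
        simp only [BB_smul]
        ring }
  exact (Λ.mkContinuous ((∫ w, ‖h w‖ ∂μ) * N2 η) (fun ξ => by
    rw [mul_assoc]
    exact norm_int_BB_le hh hη (measL ξ) (Lp.memLp ξ) p q)).continuous

lemma cont_pair {η : X n → ℂ} (mη : Measurable η) (hη : MemLp η 2 volume) :
    Continuous (fun ξ : L2X n => ∫ x, η x * ξ x) := by
  have := cont_BB (Ω := Unit) (μ := Measure.dirac ()) (h := fun _ => 1) (p := fun _ => 0)
    (q := fun _ => 0) mη hη measurable_const measurable_const (integrable_const _)
  simpa [BB_zero] using this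

lemma pointwise_op [SFinite μ] (ℏ : ℝ) {φ : X n × X n → ℂ}
    (hφ : ∀ x θ, φ (x, θ) = ∫ w, h w * ee (dt (p w) x + dt (q w) θ) ∂μ)
    (hp : Measurable p) (hq : Measurable q) (hh : Integrable h μ)
    (ξ : SchwartzMap (X n) ℂ) (x : X n) :
    (((2 * Real.pi) ^ n)⁻¹ : ℝ) •
        ∫ θ : X n, Complex.exp (Complex.I * Complex.ofReal (∑ i, x i * θ i)) * φ (x, ℏ • θ) *
          (∫ y : X n, Complex.exp (-(Complex.I) * Complex.ofReal (∑ i, y i * θ i)) * ξ y)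
      = ∫ w, h w * tr (p w) (ℏ • q w) ξ x ∂μ := by
  obtain ⟨F, hF, hF1, hF2⟩ := schwartz_inv ξ
  simp_rw [← hF1]
  have e1 : (∫ θ : X n, Complex.exp (Complex.I * Complex.ofReal (∑ i, x i * θ i)) *
        φ (x, ℏ • θ) * F θ)
      = ∫ θ : X n, ∫ w, (ee (dt x θ) * ee (dt (p w) x + dt (q w) (ℏ • θ))) * (F θ * h w) ∂μ := by
    refine integral_congr_ae (Eventually.of_forall fun θ => ?_)
    simp only [hφ]
    rw [← integral_const_mul, ← integral_mul_const]
    refine integral_congr_ae (Eventually.of_forall fun w => ?_)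
    simp only [ee, dt]
    ring
  have hint : Integrable (Function.uncurry fun (θ : X n) (w : Ω) =>
      (ee (dt x θ) * ee (dt (p w) x + dt (q w) (ℏ • θ))) * (F θ * h w)) (volume.prod μ) := by
    refine (hF.mul_prod hh).bdd_mul (c := 1) ?_ ?_
    · refine Measurable.aestronglyMeasurable ?_
      exact (measurable_ee.comp (measurable_dt measurable_const measurable_fst)).mul
        (measurable_ee.comp ((measurable_dt (hp.comp measurable_snd) measurable_const).add
          (measurable_dt (hq.comp measurable_snd) (measurable_fst.const_smul ℏ))))
    · exact Eventually.of_forall fun z => by simp [norm_ee]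
  rw [e1, integral_integral_swap hint, ← integral_smul]
  refine integral_congr_ae (Eventually.of_forall fun w => ?_)
  simp only [tr]
  rw [hF2, mul_smul_comm, mul_smul_comm]
  congr 1
  rw [← integral_const_mul, ← integral_const_mul]
  refine integral_congr_ae (Eventually.of_forall fun θ => ?_)
  simp only [dt_add_left, dt_smul_left, dt_smul_right, ee_add]
  ring

lemma key [SFinite μ] (ℏ : ℝ) {φ : X n × X n → ℂ} {T : L2X n →L[ℂ] L2X n}
    (hT : opSpec n ℏ φ T)
    (hφ : ∀ x θ, φ (x, θ) = ∫ w, h w * ee (dt (p w) x + dt (q w) θ) ∂μ)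
    (hp : Measurable p) (hq : Measurable q) (hh : Integrable h μ)
    {η : X n → ℂ} (mη : Measurable η) (hη : MemLp η 2 volume) (ξ : L2X n) :
    ∫ x, η x * T ξ x = ∫ w, h w * BB η ξ (p w) (ℏ • q w) ∂μ := by
  have hq' : Measurable (fun w => ℏ • q w) := hq.const_smul ℏ
  have hd : DenseRange (SchwartzMap.toLpCLM ℝ ℂ 2 (volume : Measure (X n))) :=
    SchwartzMap.denseRange_toLpCLM (by simp)
  refine congrFun (hd.equalizer ((cont_pair mη hη).comp T.continuous)
    (cont_BB mη hη hp hq' hh) ?_) ξ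
  funext s
  simp only [Function.comp_apply, SchwartzMap.toLpCLM_apply]
  have hs := s.coeFn_toLp 2 (volume : Measure (X n))
  have h1 := hT (s.toLp 2) s s.integrable hs
  have ms : Measurable s := s.continuous.measurable
  calc ∫ x, η x * T (s.toLp 2) x
      = ∫ x, ∫ w, h w * (η x * tr (p w) (ℏ • q w) s x) ∂μ := by
        refine integral_congr_ae ?_
        filter_upwards [h1] with x hx
        rw [hx, pointwise_op ℏ hφ hp hq hh s x, ← integral_const_mul]
        refine integral_congr_ae (Eventually.of_forall fun w => ?_)
        ring
    _ = ∫ w, (∫ x : X n, h w * (η x * tr (p w) (ℏ • q w) s x)) ∂μ :=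
        (integral_integral_swap (int_joint mη ms hη (s.memLp 2) hp hq' hh)).symm
    _ = ∫ w, h w * BB η (s.toLp 2) (p w) (ℏ • q w) ∂μ := by
        refine integral_congr_ae (Eventually.of_forall fun w => ?_)
        simp only
        rw [integral_const_mul, BB_congr hs, BB]

end rep2

lemma BB_shift {n : ℕ} (η ζ : X n → ℂ) (a b : X n) :
    BB η ζ a b = ∫ x, tr 0 (-b) (tr a 0 η) x * ζ x := by
  rw [← integral_add_right_eq_self _ b]
  refine integral_congr_ae (Eventually.of_forall fun x => ?_)
  simp [tr, dt, ee_zero]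
  ring

lemma BB_shift2 {n : ℕ} (η ξ : X n → ℂ) (a b a' b' : X n) :
    BB (tr 0 (-b) (tr a 0 η)) ξ a' b' = ee (dt a' b) * BB η ξ (a + a') (b + b') := by
  rw [BB, ← integral_add_right_eq_self _ b, BB, ← integral_const_mul]
  refine integral_congr_ae (Eventually.of_forall fun x => ?_)
  have h0 : ∀ y : X n, dt 0 y = 0 := fun y => by simp [dt]
  simp only [tr, h0, ee_zero, one_mul, add_neg_cancel_right, add_zero]
  simp only [dt_add_left, dt_add_right, ee_add, add_assoc]
  ring

lemma N2_coe {n : ℕ} (ξ : L2X n) : N2 ξ = ‖ξ‖ := rfl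

lemma norm_le_of_pair {n : ℕ} (D : L2X n →L[ℂ] L2X n) (C : ℝ) (hC : 0 ≤ C)
    (hD : ∀ (η : X n → ℂ), Measurable η → MemLp η 2 volume → ∀ ξ : L2X n,
      ‖∫ x, η x * D ξ x‖ ≤ C * (N2 η * N2 ξ)) : ‖D‖ ≤ C := by
  refine D.opNorm_le_bound hC fun ξ => ?_
  let η : X n → ℂ := fun x => star (D ξ x)
  have mη : Measurable η := continuous_star.measurable.comp (measL (D ξ))
  have hη : MemLp η 2 volume := (Lp.memLp (D ξ)).star
  have hN : N2 η = ‖D ξ‖ := by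
    rw [← N2_coe, N2, N2]
    congr 1
    exact eLpNorm_congr_norm_ae (Eventually.of_forall fun x => norm_star _)
  have h1 := hD η mη hη ξ
  have h2 : ∫ x, η x * D ξ x = ((‖D ξ‖ ^ 2 : ℝ) : ℂ) := by
    have := inner_self_eq_norm_sq_to_K (𝕜 := ℂ) (D ξ)
    rw [L2.inner_def] at this
    push_cast
    rw [← Complex.coe_algebraMap] at *
    rw [← this]
    refine integral_congr_ae (Eventually.of_forall fun x => ?_)
    simp [η, mul_comm, Complex.mul_conj']
  rw [h2, Complex.norm_of_nonneg (by positivity), hN, N2_coe] at h1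
  by_cases h0 : ‖D ξ‖ = 0
  · rw [h0]; positivity
  · have hpos : 0 < ‖D ξ‖ := lt_of_le_of_ne (norm_nonneg _) (Ne.symm h0)
    nlinarith

lemma bound_main {n : ℕ} {Ω Ω' : Type} [MeasurableSpace Ω] [MeasurableSpace Ω']
    {μ : Measure Ω} {μ' : Measure Ω'} [SFinite μ] [SFinite μ']
    {h : Ω → ℂ} {p q : Ω → X n} {h' : Ω' → ℂ} {p' q' : Ω' → X n}
    (hp : Measurable p) (hq : Measurable q) (hh : Integrable h μ)
    (hp' : Measurable p') (hq' : Measurable q') (hh' : Integrable h' μ')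
    {f g : X n × X n → ℂ}
    (hf : ∀ x θ, f (x, θ) = ∫ w, h w * ee (dt (p w) x + dt (q w) θ) ∂μ)
    (hg : ∀ x θ, g (x, θ) = ∫ w, h' w * ee (dt (p' w) x + dt (q' w) θ) ∂μ')
    (ℏ : ℝ) {T S R : L2X n →L[ℂ] L2X n}
    (hT : opSpec n ℏ f T) (hS : opSpec n ℏ g S) (hR : opSpec n ℏ (fun z => f z * g z) R) :
    ‖T.comp S - R‖ ≤ ∫ z : Ω × Ω', ‖h z.1 * h' z.2‖ * ‖ee (ℏ * dt (p' z.2) (q z.1)) - 1‖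
      ∂(μ.prod μ') := by
  have hprod : Integrable (fun z : Ω × Ω' => h z.1 * h' z.2) (μ.prod μ') := hh.mul_prod hh'
  have hpp : Measurable (fun z : Ω × Ω' => p z.1 + p' z.2) :=
    (hp.comp measurable_fst).add (hp'.comp measurable_snd)
  have hqq : Measurable (fun z : Ω × Ω' => q z.1 + q' z.2) :=
    (hq.comp measurable_fst).add (hq'.comp measurable_snd)
  have hqq' : Measurable (fun z : Ω × Ω' => ℏ • (q z.1 + q' z.2)) := hqq.const_smul ℏ
  have hfg : ∀ x θ, (fun z => f z * g z) (x, θ) = ∫ z : Ω × Ω', (h z.1 * h' z.2) *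
      ee (dt (p z.1 + p' z.2) x + dt (q z.1 + q' z.2) θ) ∂(μ.prod μ') := by
    intro x θ
    simp only [hf, hg]
    rw [← integral_prod_mul]
    refine integral_congr_ae (Eventually.of_forall fun z => ?_)
    simp only [dt_add_left, ee_add]
    ring
  have hph : Measurable (fun z : Ω × Ω' => ee (ℏ * dt (p' z.2) (q z.1))) :=
    measurable_ee.comp ((measurable_dt (hp'.comp measurable_snd)
      (hq.comp measurable_fst)).const_mul ℏ)
  have hprod2 : Integrable (fun z : Ω × Ω' => (h z.1 * h' z.2) * ee (ℏ * dt (p' z.2) (q z.1)))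
      (μ.prod μ') :=
    hprod.mul_bdd (c := 1) hph.aestronglyMeasurable
      (Eventually.of_forall fun z => (norm_ee _).le)
  have hprod3 : Integrable (fun z : Ω × Ω' => (h z.1 * h' z.2) *
      (ee (ℏ * dt (p' z.2) (q z.1)) - 1)) (μ.prod μ') := by
    refine (hprod2.sub hprod).congr (Eventually.of_forall fun z => ?_)
    simp only [Pi.sub_apply]
    ring
  refine norm_le_of_pair _ _ (integral_nonneg fun z => by positivity) fun η mη hη ξ => ?_
  have hTS : ∫ x, η x * T (S ξ) x = ∫ z : Ω × Ω', (h z.1 * h' z.2 *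
      ee (ℏ * dt (p' z.2) (q z.1))) * BB η ξ (p z.1 + p' z.2) (ℏ • (q z.1 + q' z.2))
        ∂(μ.prod μ') := by
    rw [key ℏ hT hf hp hq hh mη hη (S ξ), integral_prod _ (int_BB mη (measL ξ) hη (Lp.memLp ξ)
      hpp hqq' hprod2)]
    refine integral_congr_ae (Eventually.of_forall fun w => ?_)
    simp only
    have m1 : Measurable (tr (p w) 0 η) := sm_tr _ _ mη
    rw [BB_shift, key ℏ hS hg hp' hq' hh' (sm_tr _ _ m1)
      (memLp_tr _ _ m1 (memLp_tr _ _ mη hη)) ξ, ← integral_const_mul]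
    refine integral_congr_ae (Eventually.of_forall fun w' => ?_)
    simp only [BB_shift2, dt_smul_right, smul_add]
    ring
  have hRR := key ℏ hR hfg hpp hqq hprod mη hη ξ
  have hD : ∫ x, η x * (T.comp S - R) ξ x =
      (∫ x, η x * T (S ξ) x) - (∫ x, η x * R ξ x) := by
    rw [← integral_sub (holder_int hη (Lp.memLp _)) (holder_int hη (Lp.memLp _))]
    refine integral_congr_ae ?_
    filter_upwards [Lp.coeFn_sub (T (S ξ)) (R ξ)] with x hx
    rw [← mul_sub]
    congr 1
  have i2 := int_BB mη (measL ξ) hη (Lp.memLp ξ) hpp hqq' hprod2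
  have i1 := int_BB mη (measL ξ) hη (Lp.memLp ξ) hpp hqq' hprod
  rw [hD, hTS, hRR, ← integral_sub i2 i1]
  have e : ∀ z : Ω × Ω', (h z.1 * h' z.2 * ee (ℏ * dt (p' z.2) (q z.1))) *
        BB η ξ (p z.1 + p' z.2) (ℏ • (q z.1 + q' z.2)) -
      (h z.1 * h' z.2) * BB η ξ (p z.1 + p' z.2) (ℏ • (q z.1 + q' z.2)) =
      ((h z.1 * h' z.2) * (ee (ℏ * dt (p' z.2) (q z.1)) - 1)) *
        BB η ξ (p z.1 + p' z.2) (ℏ • (q z.1 + q' z.2)) := fun z => by ring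
  simp_rw [e]
  refine (norm_int_BB_le hprod3 hη (measL ξ) (Lp.memLp ξ) _ _).trans_eq ?_
  congr 1
  refine integral_congr_ae (Eventually.of_forall fun z => ?_)
  simp only [norm_mul]

/-- For all Schwartz functions `f, g` on `ℝⁿ×ℝⁿ`,
`lim_{ℏ→0⁺} ‖op_ℏ(f) op_ℏ(g) − op_ℏ(fg)‖ = 0`: the quantization `op_ℏ` is
asymptotically multiplicative. -/
theorem statement1 (n : ℕ) (hn : 1 ≤ n) (f g : SchwartzMap (X n × X n) ℂ)
    (T S R : ℝ → (L2X n →L[ℂ] L2X n))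
    (hT : ∀ ℏ ∈ Ioc (0:ℝ) 1, opSpec n ℏ (⇑f) (T ℏ))
    (hS : ∀ ℏ ∈ Ioc (0:ℝ) 1, opSpec n ℏ (⇑g) (S ℏ))
    (hR : ∀ ℏ ∈ Ioc (0:ℝ) 1, opSpec n ℏ (fun p => f p * g p) (R ℏ)) :
    Tendsto (fun ℏ => ‖(T ℏ).comp (S ℏ) - R ℏ‖) (𝓝[>] (0:ℝ)) (𝓝 0) := by
  obtain ⟨h, p, q, hh, hp, hq, hf⟩ := schwartz_rep f
  obtain ⟨h', p', q', hh', hp', hq', hg⟩ := schwartz_rep g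
  have hprod := (hh.mul_prod hh').norm
  refine squeeze_zero' (Eventually.of_forall fun _ => norm_nonneg _) (g := fun ℏ : ℝ =>
    ∫ z, ‖h z.1 * h' z.2‖ * ‖ee (ℏ * dt (p' z.2) (q z.1)) - 1‖ ∂(volume.prod volume)) ?_ ?_
  · filter_upwards [Ioc_mem_nhdsGT (zero_lt_one' ℝ)] with ℏ hℏ
    exact bound_main hp hq hh hp' hq' hh' hf hg ℏ (hT ℏ hℏ) (hS ℏ hℏ) (hR ℏ hℏ)
  · have hlim : Tendsto (fun ℏ : ℝ =>
        ∫ z, ‖h z.1 * h' z.2‖ * ‖ee (ℏ * dt (p' z.2) (q z.1)) - 1‖ ∂(volume.prod volume))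
        (𝓝[>] (0:ℝ)) (𝓝 (∫ z : EuclideanSpace ℝ (Fin n ⊕ Fin n) ×
          EuclideanSpace ℝ (Fin n ⊕ Fin n), (0:ℝ) ∂(volume.prod volume))) := by
      refine tendsto_integral_filter_of_dominated_convergence
        (fun z => ‖h z.1 * h' z.2‖ * 2) (Eventually.of_forall fun ℏ => ?_)
        (Eventually.of_forall fun ℏ => Eventually.of_forall fun z => ?_)
        (hprod.mul_const 2) (Eventually.of_forall fun z => ?_)
      · refine hprod.1.mul (Measurable.aestronglyMeasurable ?_)
        exact ((measurable_ee.comp ((measurable_dt (hp'.comp measurable_snd)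
          (hq.comp measurable_fst)).const_mul ℏ)).sub_const 1).norm
      · rw [norm_mul, norm_norm, norm_norm]
        gcongr
        refine (norm_sub_le _ _).trans ?_
        rw [norm_ee, norm_one]
        norm_num
      · have hc : Continuous (fun ℏ : ℝ =>
            ‖h z.1 * h' z.2‖ * ‖ee (ℏ * dt (p' z.2) (q z.1)) - 1‖) := by fun_prop
        have := hc.tendsto 0
        simp only [zero_mul, ee_zero, sub_self, norm_zero, mul_zero] at this
        exact this.mono_left nhdsWithin_le_nhds
    simpa using hlim
end
end

section
/- For every f ∈ C_c^∞(ℝⁿ×ℝⁿ), the operator ρ_ℏ(f) is bounded on L²(ℝⁿ) for each 0<ℏ≤1 and lim_{ℏ→0⁺} ‖ρ_ℏ(f)‖ = sup_{(x,ξ)∈ℝⁿ×ℝⁿ} |f̂(x,ξ)|, where ‖·‖ is the operator norm on L²(ℝⁿ). -/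
open MeasureTheory Filter Topology Set
open scoped ContDiff

noncomputable section

/-- `T` is the ℏ-scaled operator `ρ_ℏ(f)` on `L²(ℝⁿ)`:
`(ρ_ℏ(f)ξ)(x) = ∫ f(x,w) ξ(x−ℏw) dw`. -/
def rhoFullSpec (n : ℕ) (ℏ : ℝ) (f : X n × X n → ℂ) (T : L2X n →L[ℂ] L2X n) : Prop :=
  ∀ ξ : L2X n, ⇑(T ξ) =ᵐ[volume] fun x => ∫ w : X n, f (x, w) * (ξ (x - ℏ • w))

/-- Fourier transform of `f` in the second (fiber) variable:
`f̂(x,ξ) = ∫ e^{−i⟨w,ξ⟩} f(x,w) dw`. -/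
def fhat (n : ℕ) (f : X n × X n → ℂ) : X n × X n → ℂ :=
  fun p => ∫ w : X n, Complex.exp (-(Complex.I) * Complex.ofReal (∑ i, w i * p.2 i)) * f (p.1, w)


open scoped FourierTransform Convolution SchwartzMap

lemma planch_conv {E : Type*} [NormedAddCommGroup E] [InnerProductSpace ℝ E]
    [FiniteDimensional ℝ E] [MeasurableSpace E] [BorelSpace E]
    (a b : 𝓢(E, ℂ)) (M : ℝ) (hM : ∀ ξ, ‖𝓕 (a : E → ℂ) ξ‖ ≤ M) :
    Integrable (fun x => ‖∫ w, a w * b (x - w)‖ ^ 2) ∧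
    ∫ x, ‖∫ w, a w * b (x - w)‖ ^ 2 ≤ M ^ 2 * ∫ x, ‖b x‖ ^ 2 := by
  set c := SchwartzMap.convolution (ContinuousLinearMap.mul ℂ ℂ) a b with hc
  have hcx : ∀ x, c x = ∫ w, a w * b (x - w) := by
    intro x
    rw [hc, SchwartzMap.convolution_apply]
    simp [convolution]
  have int2 : ∀ g : 𝓢(E, ℂ), Integrable (fun x => ‖g x‖ ^ 2) := fun g =>
    (g.memLp 2 volume).integrable_norm_pow (by norm_num)
  simp_rw [← hcx]
  refine ⟨int2 c, ?_⟩
  rw [← SchwartzMap.integral_norm_sq_fourier c, ← SchwartzMap.integral_norm_sq_fourier b,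
    ← integral_const_mul]
  refine integral_mono (int2 _) ((int2 _).const_mul _) fun ξ => ?_
  simp only [hc, SchwartzMap.fourier_convolution, SchwartzMap.pairing_apply_apply]
  rw [ContinuousLinearMap.mul_apply', norm_mul, mul_pow]
  gcongr
  rw [SchwartzMap.fourier_coe]
  exact hM ξ

lemma planch_scaled {E : Type*} [NormedAddCommGroup E] [InnerProductSpace ℝ E]
    [FiniteDimensional ℝ E] [MeasurableSpace E] [BorelSpace E]
    (a v : E → ℂ) (ha : ContDiff ℝ ∞ a) (ha' : HasCompactSupport a)
    (hv : ContDiff ℝ ∞ v) (hv' : HasCompactSupport v) (ℏ : ℝ) (hh : 0 < ℏ)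
    (M : ℝ) (hM : ∀ ξ, ‖𝓕 a ξ‖ ≤ M) :
    Integrable (fun x => ‖∫ w, a w * v (x - ℏ • w)‖ ^ 2) ∧
    ∫ x, ‖∫ w, a w * v (x - ℏ • w)‖ ^ 2 ≤ M ^ 2 * ∫ x, ‖v x‖ ^ 2 := by
  have hs : HasCompactSupport (fun x => v (ℏ • x)) := hv'.comp_smul hh.ne'
  have hs' : ContDiff ℝ ∞ (fun x => v (ℏ • x)) := hv.comp (contDiff_const_smul ℏ)
  have := planch_conv (ha'.toSchwartzMap ha) (hs.toSchwartzMap hs') M hM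
  have e1 : ∀ x, (ha'.toSchwartzMap ha) x = a x := fun _ => rfl
  have e2 : ∀ x, (hs.toSchwartzMap hs') x = v (ℏ • x) := fun _ => rfl
  simp only [e1, e2, smul_sub] at this
  obtain ⟨h1, h2⟩ := this
  constructor
  · exact (integrable_comp_smul_iff volume (fun x => ‖∫ w, a w * v (x - ℏ • w)‖ ^ 2) hh.ne').1 h1
  · rw [Measure.integral_comp_smul volume (fun x => ‖∫ w, a w * v (x - ℏ • w)‖ ^ 2) ℏ,
      Measure.integral_comp_smul volume (fun x => ‖v x‖ ^ 2) ℏ] at h2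
    simp only [smul_eq_mul] at h2
    rw [mul_left_comm] at h2
    refine le_of_mul_le_mul_left h2 (by positivity)

lemma planch_X (n : ℕ) (a v : X n → ℂ) (ha : ContDiff ℝ ∞ a) (ha' : HasCompactSupport a)
    (hv : ContDiff ℝ ∞ v) (hv' : HasCompactSupport v) (ℏ : ℝ) (hh : 0 < ℏ)
    (M : ℝ) (hM0 : 0 ≤ M) (hM : ∀ ξ : X n, ‖∫ w : X n,
      Complex.exp (-(Complex.I) * Complex.ofReal (∑ i, w i * ξ i)) * a w‖ ≤ M) :
    ∫⁻ x, ‖∫ w, a w * v (x - ℏ • w)‖ₑ ^ 2 ≤ ENNReal.ofReal M ^ 2 * ∫⁻ x, ‖v x‖ₑ ^ 2 := by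
  let L := EuclideanSpace.equiv (Fin n) ℝ
  have hmp : MeasurePreserving (L : EuclideanSpace ℝ (Fin n) → X n) :=
    PiLp.volume_preserving_ofLp (Fin n)
  have hme : MeasurableEmbedding (L : EuclideanSpace ℝ (Fin n) → X n) :=
    L.toHomeomorph.measurableEmbedding
  have key := planch_scaled (fun x => a (L x)) (fun x => v (L x))
    (ha.comp L.contDiff) (ha'.comp_homeomorph L.toHomeomorph)
    (hv.comp L.contDiff) (hv'.comp_homeomorph L.toHomeomorph) ℏ hh M (by
      intro ξ
      rw [Real.fourier_eq']
      have := hM ((2 * Real.pi) • (L ξ))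
      rw [← hmp.integral_comp hme] at this
      refine le_of_eq_of_le ?_ this
      congr 1
      refine integral_congr_ae (ae_of_all _ fun w => ?_)
      simp only [smul_eq_mul]
      congr 2
      simp only [PiLp.inner_apply, L]
      push_cast
      simp [Finset.mul_sum, Finset.sum_mul]
      refine Finset.sum_congr rfl fun i _ => ?_
      ring)
  simp only [map_sub, map_smul] at key
  have e1 : ∀ x : X n, ∫ w, a (L w) * v (x - ℏ • L w) = ∫ w, a w * v (x - ℏ • w) := fun x =>
    hmp.integral_comp hme (fun w => a w * v (x - ℏ • w))
  simp only [e1] at key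
  have e2 := hmp.integral_comp hme (fun x => ‖∫ w, a w * v (x - ℏ • w)‖ ^ 2)
  have e3 := hmp.integral_comp hme (fun x => ‖v x‖ ^ 2)
  have i2 := hmp.integrable_comp_emb hme (g := fun x => ‖∫ w, a w * v (x - ℏ • w)‖ ^ 2)
  simp only [Function.comp_def] at i2
  rw [e2, e3, i2] at key
  obtain ⟨k1, k2⟩ := key
  have iv : Integrable (fun x => ‖v x‖ ^ 2) :=
    (hv.continuous.memLp_of_hasCompactSupport hv' (p := 2)).integrable_norm_pow (by norm_num)
  have c1 := ofReal_integral_eq_lintegral_ofReal k1 (ae_of_all _ fun x => by positivity)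
  have c2 := ofReal_integral_eq_lintegral_ofReal iv (ae_of_all _ fun x => by positivity)
  simp only [ENNReal.ofReal_pow (norm_nonneg _), ofReal_norm] at c1 c2
  rw [← c1, ← c2, ← ENNReal.ofReal_pow hM0, ← ENNReal.ofReal_mul (by positivity)]
  exact ENNReal.ofReal_le_ofReal k2

lemma eLpNorm_two_sq {α : Type*} [MeasurableSpace α] (μ : Measure α) (g : α → ℂ) :
    eLpNorm g 2 μ ^ 2 = ∫⁻ x, ‖g x‖ₑ ^ 2 ∂μ := by
  have := eLpNorm_nnreal_pow_eq_lintegral (μ := μ) (f := g) (p := 2) (by norm_num)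
  simpa using this

lemma cs_bound (n : ℕ) (K : Set (X n)) (hK : MeasurableSet K) (a : X n → ℂ)
    (ha : AEStronglyMeasurable a volume) (h0 : ∀ w, w ∉ K → a w = 0) :
    ‖∫ w, a w‖ₑ ^ 2 ≤ volume K * ∫⁻ w, ‖a w‖ₑ ^ 2 := by
  have h1 : ‖∫ w, a w‖ₑ ≤ ∫⁻ w, ‖a w‖ₑ := enorm_integral_le_lintegral_enorm a
  have h2 : ∫⁻ w, ‖a w‖ₑ = ∫⁻ w, (K.indicator (fun _ => (1 : ENNReal)) * fun w => ‖a w‖ₑ) w := by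
    congr 1
    ext w
    by_cases hw : w ∈ K
    · simp [hw]
    · simp [hw, h0 w hw]
  have h3 := ENNReal.lintegral_mul_le_Lp_mul_Lq (volume : Measure (X n))
    (p := 2) (q := 2) (Real.HolderConjugate.two_two)
    (f := K.indicator (fun _ => (1 : ENNReal))) (g := fun w => ‖a w‖ₑ)
    ((measurable_const.indicator hK).aemeasurable) ha.enorm
  have h4 : ∫⁻ w, (K.indicator (fun _ => (1 : ENNReal)) w) ^ (2 : ℝ) = volume K := by
    rw [← lintegral_indicator_one hK]
    congr 1
    ext w
    by_cases hw : w ∈ K <;> simp [hw]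
  rw [h4, ← ENNReal.mul_rpow_of_nonneg _ _ (by norm_num)] at h3
  rw [← h2] at h3
  calc ‖∫ w, a w‖ₑ ^ 2 ≤ ((volume K * ∫⁻ w, ‖a w‖ₑ ^ (2 : ℝ)) ^ (1 / (2:ℝ))) ^ 2 := by
        gcongr; exact h1.trans h3
    _ = _ := by
      rw [← ENNReal.rpow_natCast, ← ENNReal.rpow_mul]
      norm_num

lemma schur_one (n : ℕ) (K : Set (X n)) (hK : MeasurableSet K) (u : X n → ℂ)
    (hu : Measurable u) (ℏ : ℝ) (c : ENNReal) (p : X n → X n → ENNReal)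
    (hp : ∀ x w, p x w ≤ K.indicator (fun _ => c) w) :
    ∫⁻ x, ∫⁻ w, p x w * ‖u (x - ℏ • w)‖ₑ ^ 2 ≤ c * volume K * ∫⁻ x, ‖u x‖ₑ ^ 2 := by
  have hm : Measurable (fun q : X n × X n =>
      K.indicator (fun _ => c) q.2 * ‖u (q.1 - ℏ • q.2)‖ₑ ^ 2) := by
    refine Measurable.mul ((measurable_const.indicator hK).comp measurable_snd) ?_
    refine Measurable.pow_const (Measurable.enorm (hu.comp ?_)) 2
    fun_prop
  calc ∫⁻ x, ∫⁻ w, p x w * ‖u (x - ℏ • w)‖ₑ ^ 2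
      ≤ ∫⁻ x, ∫⁻ w, K.indicator (fun _ => c) w * ‖u (x - ℏ • w)‖ₑ ^ 2 := by
        gcongr with x w; exact hp x w
    _ = ∫⁻ w, ∫⁻ x, K.indicator (fun _ => c) w * ‖u (x - ℏ • w)‖ₑ ^ 2 :=
        lintegral_lintegral_swap hm.aemeasurable
    _ = ∫⁻ w, K.indicator (fun _ => c) w * ∫⁻ x, ‖u x‖ₑ ^ 2 := by
        congr 1
        ext w
        rw [lintegral_const_mul]
        · rw [lintegral_sub_right_eq_self (fun x => ‖u x‖ₑ ^ 2)]
        · fun_prop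
    _ = c * volume K * ∫⁻ x, ‖u x‖ₑ ^ 2 := by
        rw [lintegral_mul_const _ (measurable_const.indicator hK), lintegral_indicator_const hK]

lemma exists_support (n : ℕ) (f : X n × X n → ℂ) (hf : Continuous f) (hf' : HasCompactSupport f) :
    ∃ R A : ℝ, 0 < R ∧ 0 < A ∧ (∀ x w, w ∉ Metric.closedBall (0 : X n) R → f (x, w) = 0) ∧
      ∀ p, ‖f p‖ ≤ A := by
  obtain ⟨R, hR⟩ := hf'.isCompact.isBounded.subset_closedBall 0
  obtain ⟨A, hA⟩ := hf.bounded_above_of_compact_support hf'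
  refine ⟨max R 1, max A 1, by positivity, by positivity, ?_, fun p => (hA p).trans (le_max_left _ _)⟩
  intro x w hw
  by_contra h
  have := hR (subset_tsupport f h)
  rw [mem_closedBall_zero_iff] at this hw
  exact hw ((le_trans (norm_snd_le (x, w)) this).trans (le_max_left _ _))

lemma rho_integrable (n : ℕ) (f : X n × X n → ℂ) (hf : Continuous f) (hf' : HasCompactSupport f)
    (ℏ : ℝ) (hh : 0 < ℏ) (ξ : X n → ℂ) (hξ : MemLp ξ 2 volume) (x : X n) :
    Integrable (fun w => f (x, w) * ξ (x - ℏ • w)) := by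
  have h1 : MemLp (fun w => f (x, w)) 2 volume := by
    refine Continuous.memLp_of_hasCompactSupport (by fun_prop) ?_
    obtain ⟨R, A, _, _, h, _⟩ := exists_support n f hf hf'
    exact HasCompactSupport.intro (isCompact_closedBall 0 R) (fun w hw => h x w hw)
  have h2 : MemLp (fun w => ξ (x - ℏ • w)) 2 volume := by
    have a1 : MemLp (fun w => ξ (x - w)) 2 volume :=
      hξ.comp_measurePreserving (Measure.measurePreserving_sub_left volume x)
    change MemLp ((fun w => ξ (x - w)) ∘ fun w : X n => ℏ • w) 2 volume
    rw [← memLp_map_measure_iff (f := fun w : X n => ℏ • w) (g := fun w => ξ (x - w))]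
    · rw [Measure.map_addHaar_smul _ hh.ne']
      exact a1.smul_measure (by simp)
    · rw [Measure.map_addHaar_smul _ hh.ne']
      exact (a1.smul_measure (by simp)).1
    · fun_prop
  exact h1.integrable_mul h2

lemma rho_ae (n : ℕ) (f : X n × X n → ℂ) (ℏ : ℝ) (hh : 0 < ℏ) (ξ η : X n → ℂ)
    (h : ξ =ᵐ[volume] η) (x : X n) :
    (fun w => f (x, w) * ξ (x - ℏ • w)) =ᵐ[volume] (fun w => f (x, w) * η (x - ℏ • w)) := by
  have q : Measure.QuasiMeasurePreserving (fun w : X n => x - ℏ • w) volume volume := by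
    refine (Measure.measurePreserving_sub_left volume x).quasiMeasurePreserving.comp
      (f := fun w : X n => ℏ • w) ⟨by fun_prop, ?_⟩
    rw [Measure.map_addHaar_smul _ hh.ne']
    exact Measure.smul_absolutelyContinuous
  filter_upwards [q.ae_eq_comp h] with w hw
  simp only [Function.comp] at hw
  rw [hw]

lemma rho_meas (n : ℕ) (f : X n × X n → ℂ) (hf : Continuous f) (ℏ : ℝ) (ξ : X n → ℂ)
    (hξ : Measurable ξ) :
    StronglyMeasurable (fun x => ∫ w, f (x, w) * ξ (x - ℏ • w)) := by
  refine StronglyMeasurable.integral_prod_right (f := fun x w => f (x, w) * ξ (x - ℏ • w)) ?_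
  refine Measurable.stronglyMeasurable ?_
  refine Measurable.mul hf.measurable (hξ.comp ?_)
  fun_prop

lemma rho_exists (n : ℕ) (f : X n × X n → ℂ) (hf : Continuous f) (hf' : HasCompactSupport f)
    (ℏ : ℝ) (hh : 0 < ℏ) : ∃ T : L2X n →L[ℂ] L2X n, rhoFullSpec n ℏ f T := by
  obtain ⟨R, A, hR, hA, hK, hfA⟩ := exists_support n f hf hf'
  set K := Metric.closedBall (0 : X n) R with hKdef
  have hKm : MeasurableSet K := measurableSet_closedBall
  have hKf : volume K ≠ ⊤ := measure_closedBall_lt_top.ne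
  have bound : ∀ ξ : L2X n, eLpNorm (fun x => ∫ w, f (x, w) * ξ (x - ℏ • w)) 2 volume ≤
      ENNReal.ofReal A * volume K * eLpNorm ξ 2 volume := by
    intro ξ
    have hm : Measurable (ξ : X n → ℂ) := (Lp.stronglyMeasurable ξ).measurable
    rw [← ENNReal.pow_le_pow_left_iff (n := 2) (by norm_num), mul_pow, eLpNorm_two_sq, eLpNorm_two_sq]
    calc ∫⁻ x, ‖∫ w, f (x, w) * ξ (x - ℏ • w)‖ₑ ^ 2
        ≤ ∫⁻ x, volume K * ∫⁻ w, ‖f (x, w)‖ₑ ^ 2 * ‖ξ (x - ℏ • w)‖ₑ ^ 2 := by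
          gcongr with x
          have := cs_bound n K hKm (fun w => f (x, w) * ξ (x - ℏ • w))
            (rho_integrable n f hf hf' ℏ hh ξ (Lp.memLp ξ) x).1 (fun w hw => by simp [hK x w hw])
          simpa only [enorm_mul, mul_pow] using this
      _ = volume K * ∫⁻ x, ∫⁻ w, ‖f (x, w)‖ₑ ^ 2 * ‖ξ (x - ℏ • w)‖ₑ ^ 2 :=
          lintegral_const_mul' _ _ hKf
      _ ≤ volume K * (ENNReal.ofReal A ^ 2 * volume K * ∫⁻ x, ‖ξ x‖ₑ ^ 2) := by
          gcongr
          refine schur_one n K hKm ξ hm ℏ _ (fun x w => ‖f (x, w)‖ₑ ^ 2) ?_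
          intro x w
          by_cases hw : w ∈ K
          · simp only [hw, indicator_of_mem]
            gcongr
            rw [← ofReal_norm]
            exact ENNReal.ofReal_le_ofReal (hfA _)
          · simp [hw, hK x w hw]
      _ = _ := by ring
  have mem : ∀ ξ : L2X n, MemLp (fun x => ∫ w, f (x, w) * ξ (x - ℏ • w)) 2 volume := fun ξ =>
    ⟨(rho_meas n f hf ℏ ξ (Lp.stronglyMeasurable ξ).measurable).aestronglyMeasurable,
      (bound ξ).trans_lt (ENNReal.mul_lt_top (ENNReal.mul_lt_top ENNReal.ofReal_lt_top hKf.lt_top)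
        (Lp.memLp ξ).2)⟩
  let T0 : L2X n →ₗ[ℂ] L2X n :=
    { toFun := fun ξ => (mem ξ).toLp
      map_add' := by
        intro ξ η
        rw [← MemLp.toLp_add]
        refine MemLp.toLp_congr _ _ (ae_of_all _ fun x => ?_)
        simp only [Pi.add_apply]
        rw [← integral_add (rho_integrable n f hf hf' ℏ hh ξ (Lp.memLp ξ) x)
          (rho_integrable n f hf hf' ℏ hh η (Lp.memLp η) x),
          integral_congr_ae (rho_ae n f ℏ hh _ _ (Lp.coeFn_add ξ η) x)]
        simp only [Pi.add_apply, mul_add]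
      map_smul' := by
        intro c ξ
        simp only [RingHom.id_apply]
        rw [← MemLp.toLp_const_smul]
        refine MemLp.toLp_congr _ _ (ae_of_all _ fun x => ?_)
        simp only [Pi.smul_apply]
        rw [← integral_smul, integral_congr_ae (rho_ae n f ℏ hh _ _ (Lp.coeFn_smul c ξ) x)]
        simp only [Pi.smul_apply, mul_smul_comm] }
  refine ⟨T0.mkContinuous (ENNReal.ofReal A * volume K).toReal ?_, ?_⟩
  · intro ξ
    change ‖(mem ξ).toLp‖ ≤ _
    rw [Lp.norm_toLp, Lp.norm_def, ← ENNReal.toReal_mul]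
    exact ENNReal.toReal_mono (ENNReal.mul_lt_top (ENNReal.mul_lt_top ENNReal.ofReal_lt_top hKf.lt_top)
        (Lp.memLp ξ).2).ne (bound ξ)
  · intro ξ
    exact (mem ξ).coeFn_toLp

lemma kernel_ptwise (n : ℕ) (f : X n × X n → ℂ) (φ : X n → ℂ) (R A r s δ η ℏ : ℝ)
    (hA : 0 < A)
    (hK : ∀ x w, w ∉ Metric.closedBall (0 : X n) R → f (x, w) = 0)
    (hfA : ∀ p, ‖f p‖ ≤ A)
    (hfu : ∀ x y w, ‖x - y‖ ≤ 2 * r → ‖f (x, w) - f (y, w)‖ ≤ δ)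
    (hφ : ∀ x, r ≤ ‖x‖ → φ x = 0)
    (hφu : ∀ x y, ‖x - y‖ < s → ‖φ x - φ y‖ ≤ η)
    (hℏ : 0 < ℏ) (hℏr : ℏ * R ≤ r) (hℏs : ℏ * R < s)
    (x y w s1 s2 : X n) (h12 : ‖s1 - s2‖ ≤ ℏ * ‖w‖) (h1 : ‖s1 - (x - y)‖ ≤ ℏ * ‖w‖)
    (h2 : ‖s2 - (x - y)‖ ≤ ℏ * ‖w‖) :
    ‖f (x, w) * φ s1 - f (y, w) * φ s2‖ₑ ^ 2 ≤
      (Metric.closedBall (0 : X n) (2 * r)).indicator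
        (fun _ => ENNReal.ofReal (2 * A ^ 2 * η ^ 2)) (x - y)
        + ENNReal.ofReal (2 * δ ^ 2) * ‖φ s2‖ₑ ^ 2 := by
  by_cases hw : w ∈ Metric.closedBall (0 : X n) R
  swap
  · simp [hK _ w hw]
  rw [mem_closedBall_zero_iff] at hw
  have hw' : ℏ * ‖w‖ ≤ ℏ * R := by gcongr
  by_cases hxy : x - y ∈ Metric.closedBall (0 : X n) (2 * r)
  swap
  · rw [mem_closedBall_zero_iff, not_le] at hxy
    have z : ∀ t : X n, ‖t - (x - y)‖ ≤ ℏ * ‖w‖ → φ t = 0 := by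
      intro t ht
      apply hφ
      have : ‖x - y‖ ≤ ‖t‖ + ‖t - (x - y)‖ := by
        have := norm_sub_le t (t - (x - y))
        simpa using this
      linarith
    simp [z s1 h1, z s2 h2]
  rw [indicator_of_mem hxy]
  rw [mem_closedBall_zero_iff] at hxy
  rw [← ofReal_norm, ← ofReal_norm, ← ENNReal.ofReal_pow (norm_nonneg _),
    ← ENNReal.ofReal_pow (norm_nonneg _), ← ENNReal.ofReal_mul (by positivity),
    ← ENNReal.ofReal_add (by positivity) (by positivity)]
  apply ENNReal.ofReal_le_ofReal
  have e : f (x, w) * φ s1 - f (y, w) * φ s2 =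
      f (x, w) * (φ s1 - φ s2) + (f (x, w) - f (y, w)) * φ s2 := by ring
  have b : ‖f (x, w) * φ s1 - f (y, w) * φ s2‖ ≤ A * η + δ * ‖φ s2‖ := by
    rw [e]
    refine (norm_add_le _ _).trans ?_
    rw [norm_mul, norm_mul]
    gcongr
    · exact hfA _
    · exact hφu _ _ (by linarith)
    · exact hfu _ _ _ hxy
  calc ‖f (x, w) * φ s1 - f (y, w) * φ s2‖ ^ 2 ≤ (A * η + δ * ‖φ s2‖) ^ 2 := by gcongr
    _ ≤ _ := by nlinarith [sq_nonneg (A * η - δ * ‖φ s2‖)]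

lemma exists_bump (n : ℕ) (r : ℝ) (hr : 0 < r) : ∃ φ : X n → ℂ, ContDiff ℝ ∞ φ ∧
    HasCompactSupport φ ∧ (∀ x, r ≤ ‖x‖ → φ x = 0) ∧ ∫⁻ x, ‖φ x‖ₑ ^ 2 = 1 := by
  let b : ContDiffBump (0 : X n) := ⟨r / 2, r, by positivity, by linarith⟩
  have hb : ContDiff ℝ ∞ (fun x => (b x : ℂ)) := Complex.ofRealCLM.contDiff.comp b.contDiff
  have hbc : HasCompactSupport (fun x => (b x : ℂ)) := by
    exact b.hasCompactSupport.comp_left (g := fun t : ℝ => (t : ℂ)) (by simp)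
  have hfin : ∫⁻ x, ‖(b x : ℂ)‖ₑ ^ 2 ≠ ⊤ := by
    rw [← eLpNorm_two_sq]
    exact ENNReal.pow_ne_top (hb.continuous.memLp_of_hasCompactSupport hbc).2.ne
  have hpos : ∫⁻ x, ‖(b x : ℂ)‖ₑ ^ 2 ≠ 0 := by
    intro h
    rw [lintegral_eq_zero_iff (hb.continuous.measurable.enorm.pow_const 2)] at h
    have h2 : volume (Metric.ball (0 : X n) (r / 2)) = 0 := by
      refine measure_mono_null ?_ (ae_iff.1 h)
      intro x hx
      have : b x = 1 := b.one_of_mem_closedBall (Metric.ball_subset_closedBall hx)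
      simp [this]
    exact (Metric.measure_ball_pos volume (0 : X n) (by positivity : 0 < r / 2)).ne' h2
  set I := ∫⁻ x, ‖(b x : ℂ)‖ₑ ^ 2 with hI
  have hI0 : 0 < I.toReal := ENNReal.toReal_pos hpos hfin
  refine ⟨fun x => ((Real.sqrt I.toReal)⁻¹ : ℂ) * (b x : ℂ), contDiff_const.mul hb, hbc.mul_left,
    ?_, ?_⟩
  · intro x hx
    have : b x = 0 := b.zero_of_le_dist (by simpa using hx)
    simp [this]
  · simp_rw [enorm_mul, mul_pow]
    rw [lintegral_const_mul' _ _ (by simp), ← hI]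
    have : ‖((Real.sqrt I.toReal)⁻¹ : ℂ)‖ₑ ^ 2 = I⁻¹ := by
      rw [← ofReal_norm, ← ENNReal.ofReal_pow (norm_nonneg _), norm_inv, inv_pow]
      simp only [Complex.norm_real, Real.norm_eq_abs, sq_abs]
      rw [Real.sq_sqrt hI0.le, ENNReal.ofReal_inv_of_pos hI0, ENNReal.ofReal_toReal hfin]
    rw [this, ENNReal.inv_mul_cancel hpos hfin]

lemma kernel_small (n : ℕ) (f : X n × X n → ℂ) (hf : Continuous f) (hf' : HasCompactSupport f)
    (ε : ℝ) (hε : 0 < ε) : ∃ φ : X n → ℂ, ContDiff ℝ ∞ φ ∧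
    HasCompactSupport φ ∧ ∫⁻ x, ‖φ x‖ₑ ^ 2 = 1 ∧ ∀ᶠ ℏ in 𝓝[>] (0:ℝ),
      (∀ x w, ∫⁻ y, ‖f (x, w) * φ (x - y) - f (y, w) * φ (x - ℏ • w - y)‖ₑ ^ 2
        ≤ ENNReal.ofReal ε) ∧
      (∀ y w, ∫⁻ x, ‖f (x, w) * φ (x - ℏ • w - y) - f (y, w) * φ (x - y)‖ₑ ^ 2
        ≤ ENNReal.ofReal ε) := by
  obtain ⟨R, A, hR, hA, hK, hfA⟩ := exists_support n f hf hf'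
  set δ := Real.sqrt (ε / 4) with hδ
  have hδ0 : 0 < δ := by positivity
  have hδ2 : δ ^ 2 = ε / 4 := Real.sq_sqrt (by positivity)
  obtain ⟨r3, hr3, hfu⟩ := Metric.uniformContinuous_iff.1
    (hf'.uniformContinuous_of_continuous hf) δ hδ0
  set r := r3 / 3 with hr
  have hr0 : 0 < r := by positivity
  obtain ⟨φ, hφ, hφc, hφ0, hφ1⟩ := exists_bump n r hr0
  set B := (volume (Metric.closedBall (0 : X n) (2 * r))).toReal with hB
  have hB0 : 0 ≤ B := ENNReal.toReal_nonneg
  set η := Real.sqrt (ε / (4 * (A ^ 2 * B + 1))) with hη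
  have hη0 : 0 < η := by positivity
  have hη2 : η ^ 2 = ε / (4 * (A ^ 2 * B + 1)) := Real.sq_sqrt (by positivity)
  obtain ⟨s, hs, hφu⟩ := Metric.uniformContinuous_iff.1
    (hφc.uniformContinuous_of_continuous hφ.continuous) η hη0
  refine ⟨φ, hφ, hφc, hφ1, ?_⟩
  have hev : ∀ᶠ ℏ in 𝓝[>] (0:ℝ), ℏ * R < min r s := by
    have : Tendsto (fun ℏ : ℝ => ℏ * R) (𝓝[>] 0) (𝓝 (0 * R)) :=
      ((continuous_id.mul continuous_const).tendsto 0).mono_left nhdsWithin_le_nhds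
    rw [zero_mul] at this
    exact this.eventually_lt_const (by positivity)
  have pw := fun ℏ => kernel_ptwise n f φ R A r s δ η ℏ hA hK hfA
    (fun x y w h => by
      rw [← dist_eq_norm]
      refine (hfu ?_).le
      rw [Prod.dist_eq, dist_self, dist_eq_norm]
      simp only [max_lt_iff]
      constructor
      · linarith
      · exact hr3) hφ0
    (fun x y h => by
      rw [← dist_eq_norm]
      exact (hφu (by rwa [dist_eq_norm])).le)
  have tot : ENNReal.ofReal (2 * A ^ 2 * η ^ 2) * volume (Metric.closedBall (0 : X n) (2 * r))
      + ENNReal.ofReal (2 * δ ^ 2) * 1 ≤ ENNReal.ofReal ε := by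
    have : volume (Metric.closedBall (0 : X n) (2 * r)) = ENNReal.ofReal B := by
      rw [hB, ENNReal.ofReal_toReal measure_closedBall_lt_top.ne]
    rw [this, mul_one, ← ENNReal.ofReal_mul (by positivity),
      ← ENNReal.ofReal_add (by positivity) (by positivity)]
    apply ENNReal.ofReal_le_ofReal
    have : 2 * A ^ 2 * η ^ 2 * B ≤ ε / 2 := by
      rw [hη2]
      have : 2 * A ^ 2 * (ε / (4 * (A ^ 2 * B + 1))) * B
          = (ε / 2) * ((A ^ 2 * B) / (A ^ 2 * B + 1)) := by
        field_simp
        ring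
      rw [this]
      refine mul_le_of_le_one_right (by positivity) ?_
      rw [div_le_one (by positivity)]
      linarith
    linarith
  have mball : Measurable ((Metric.closedBall (0 : X n) (2 * r)).indicator
        (fun _ => ENNReal.ofReal (2 * A ^ 2 * η ^ 2))) :=
    measurable_const.indicator measurableSet_closedBall
  have hm1 : ∀ x : X n, Measurable (fun y => (Metric.closedBall (0 : X n) (2 * r)).indicator
        (fun _ => ENNReal.ofReal (2 * A ^ 2 * η ^ 2)) (x - y)) := fun x =>
    mball.comp (measurable_const.sub measurable_id)
  have hm2 : ∀ y : X n, Measurable (fun x => (Metric.closedBall (0 : X n) (2 * r)).indicator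
        (fun _ => ENNReal.ofReal (2 * A ^ 2 * η ^ 2)) (x - y)) := fun y =>
    mball.comp (measurable_id.sub measurable_const)
  filter_upwards [hev, self_mem_nhdsWithin] with ℏ h1 h2
  have h2' : 0 < ℏ := h2
  have hb := pw ℏ h2' ((h1.le).trans (min_le_left _ _)) (h1.trans_le (min_le_right _ _))
  have nw : ∀ w : X n, ‖ℏ • w‖ = ℏ * ‖w‖ := fun w => by
    rw [norm_smul, Real.norm_of_nonneg h2'.le]
  constructor
  · intro x w
    refine (lintegral_mono fun y => hb x y w (x - y) (x - ℏ • w - y) ?_ ?_ ?_).trans ?_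
    · rw [← nw]; apply le_of_eq; congr 1; abel
    · simp; positivity
    · rw [← nw, ← norm_neg]; apply le_of_eq; congr 1; abel
    · rw [lintegral_add_left (hm1 x), lintegral_const_mul' _ _ ENNReal.ofReal_ne_top]
      rw [lintegral_sub_left_eq_self (fun y => ‖φ y‖ₑ ^ 2), hφ1,
        lintegral_sub_left_eq_self ((Metric.closedBall (0 : X n) (2 * r)).indicator
        (fun _ => ENNReal.ofReal (2 * A ^ 2 * η ^ 2))),
        lintegral_indicator_const measurableSet_closedBall]
      exact tot
  · intro y w
    refine (lintegral_mono fun x => hb x y w (x - ℏ • w - y) (x - y) ?_ ?_ ?_).trans ?_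
    · rw [← nw, ← norm_neg]; apply le_of_eq; congr 1; abel
    · rw [← nw, ← norm_neg]; apply le_of_eq; congr 1; abel
    · simp; positivity
    · rw [lintegral_add_left (hm2 y), lintegral_const_mul' _ _ ENNReal.ofReal_ne_top]
      rw [lintegral_sub_right_eq_self (fun y => ‖φ y‖ₑ ^ 2), hφ1,
        lintegral_sub_right_eq_self ((Metric.closedBall (0 : X n) (2 * r)).indicator
        (fun _ => ENNReal.ofReal (2 * A ^ 2 * η ^ 2))),
        lintegral_indicator_const measurableSet_closedBall]
      exact tot

lemma ennreal_sq_inj {a b : ENNReal} (h : a ^ 2 = b ^ 2) : a = b :=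
  le_antisymm ((ENNReal.pow_le_pow_left_iff (by norm_num)).1 h.le)
    ((ENNReal.pow_le_pow_left_iff (by norm_num)).1 h.ge)

lemma upper_bound (n : ℕ) (f : X n × X n → ℂ) (hf : ContDiff ℝ ∞ f) (K : Set (X n))
    (hKc : IsCompact K) (hK : ∀ x w, w ∉ K → f (x, w) = 0)
    (u φ : X n → ℂ) (hu : ContDiff ℝ ∞ u) (hu' : HasCompactSupport u)
    (hφ : ContDiff ℝ ∞ φ) (hφ1 : ∫⁻ x, ‖φ x‖ₑ ^ 2 = 1)
    (ℏ : ℝ) (hh : 0 < ℏ) (e : ENNReal) (M : ℝ) (hM0 : 0 ≤ M) (hM : ∀ p, ‖fhat n f p‖ ≤ M)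
    (hk : ∀ x w, ∫⁻ y, ‖f (x, w) * φ (x - y) - f (y, w) * φ (x - ℏ • w - y)‖ₑ ^ 2 ≤ e ^ 2) :
    eLpNorm (fun x => ∫ w, f (x, w) * u (x - ℏ • w)) 2 volume ≤
      (ENNReal.ofReal M + e * volume K) * eLpNorm u 2 volume := by
  have hKm : MeasurableSet K := hKc.measurableSet
  have hKf : volume K ≠ ⊤ := hKc.measure_lt_top.ne
  have cf := hf.continuous
  have cu := hu.continuous
  have cφ := hφ.continuous
  set h : X n → ℂ := fun x => ∫ w, f (x, w) * u (x - ℏ • w) with hh_def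
  have hhm : StronglyMeasurable h := rho_meas n f cf ℏ u cu.measurable
  set G : X n × X n → ℂ := fun p => φ (p.1 - p.2) * h p.1 with hG
  set F : X n × X n → ℂ := fun p => ∫ w, f (p.2, w) * (φ (p.1 - ℏ • w - p.2) * u (p.1 - ℏ • w))
    with hF
  have hGm : StronglyMeasurable G :=
    (Continuous.stronglyMeasurable (by fun_prop)).mul (hhm.comp_measurable measurable_fst)
  have hFm : StronglyMeasurable F := by
    refine StronglyMeasurable.integral_prod_right
      (f := fun (p : X n × X n) w => f (p.2, w) * (φ (p.1 - ℏ • w - p.2) * u (p.1 - ℏ • w))) ?_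
    exact Continuous.stronglyMeasurable (by fun_prop)
  have cs : ∀ (y : X n), HasCompactSupport (fun w => f (y, w)) := fun y =>
    HasCompactSupport.intro hKc (fun w hw => hK y w hw)
  have hD : ∀ p, (G - F) p = ∫ w, (f (p.1, w) * φ (p.1 - p.2)
      - f (p.2, w) * φ (p.1 - ℏ • w - p.2)) * u (p.1 - ℏ • w) := by
    intro p
    simp only [hG, hF, hh_def, Pi.sub_apply]
    rw [← integral_const_mul, ← integral_sub]
    · congr 1
      ext w
      ring
    · exact Continuous.integrable_of_hasCompactSupport (by fun_prop)
        ((cs p.1).mul_right.mul_left)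
    · exact Continuous.integrable_of_hasCompactSupport (by fun_prop) ((cs p.2).mul_right)
  have nG : eLpNorm G 2 (volume.prod volume) = eLpNorm h 2 volume := by
    apply ennreal_sq_inj
    simp only [eLpNorm_two_sq]
    rw [lintegral_prod _ (hGm.measurable.enorm.pow_const 2).aemeasurable]
    congr 1
    ext x
    simp only [hG, enorm_mul, mul_pow]
    rw [lintegral_mul_const _ (Continuous.measurable (by fun_prop)),
      lintegral_sub_left_eq_self (fun y => ‖φ y‖ₑ ^ 2), hφ1, one_mul]
  have nF : eLpNorm F 2 (volume.prod volume) ≤ ENNReal.ofReal M * eLpNorm u 2 volume := by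
    rw [← ENNReal.pow_le_pow_left_iff (n := 2) (by norm_num), mul_pow, eLpNorm_two_sq,
      eLpNorm_two_sq, lintegral_prod_symm _ (hFm.measurable.enorm.pow_const 2).aemeasurable]
    calc ∫⁻ y, ∫⁻ x, ‖F (x, y)‖ₑ ^ 2
        ≤ ∫⁻ y, ENNReal.ofReal M ^ 2 * ∫⁻ x, ‖φ (x - y) * u x‖ₑ ^ 2 := by
          gcongr with y
          exact planch_X n (fun w => f (y, w)) (fun x => φ (x - y) * u x)
            (hf.comp (by fun_prop)) (cs y)
            ((hφ.comp (by fun_prop)).mul hu) hu'.mul_left ℏ hh M hM0 (fun ξ => hM (y, ξ))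
      _ = ENNReal.ofReal M ^ 2 * ∫⁻ y, ∫⁻ x, ‖φ (x - y) * u x‖ₑ ^ 2 :=
          lintegral_const_mul' _ _ (ENNReal.pow_ne_top ENNReal.ofReal_ne_top)
      _ = ENNReal.ofReal M ^ 2 * ∫⁻ x, ∫⁻ y, ‖φ (x - y) * u x‖ₑ ^ 2 := by
          rw [lintegral_lintegral_swap]
          exact Measurable.aemeasurable
            (f := fun p : X n × X n => ‖φ (p.2 - p.1) * u p.2‖ₑ ^ 2) (by fun_prop)
      _ = ENNReal.ofReal M ^ 2 * ∫⁻ x, ‖u x‖ₑ ^ 2 := by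
          congr 2
          ext x
          simp only [enorm_mul, mul_pow]
          rw [lintegral_mul_const _ (Continuous.measurable (by fun_prop)),
            lintegral_sub_left_eq_self (fun y => ‖φ y‖ₑ ^ 2), hφ1, one_mul]
  have nD : eLpNorm (G - F) 2 (volume.prod volume) ≤ e * volume K * eLpNorm u 2 volume := by
    rw [← ENNReal.pow_le_pow_left_iff (n := 2) (by norm_num), mul_pow, eLpNorm_two_sq,
      eLpNorm_two_sq, lintegral_prod _ ((hGm.sub hFm).measurable.enorm.pow_const 2).aemeasurable]
    calc ∫⁻ x, ∫⁻ y, ‖(G - F) (x, y)‖ₑ ^ 2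
        ≤ ∫⁻ x, ∫⁻ y, volume K * ∫⁻ w, ‖f (x, w) * φ (x - y)
            - f (y, w) * φ (x - ℏ • w - y)‖ₑ ^ 2 * ‖u (x - ℏ • w)‖ₑ ^ 2 := by
          gcongr with x y
          rw [hD]
          have := cs_bound n K hKm (fun w => (f (x, w) * φ (x - y)
            - f (y, w) * φ (x - ℏ • w - y)) * u (x - ℏ • w))
            (Continuous.aestronglyMeasurable (by fun_prop))
            (fun w hw => by simp [hK _ w hw])
          simpa only [enorm_mul, mul_pow] using this
      _ = volume K * ∫⁻ x, ∫⁻ y, ∫⁻ w, ‖f (x, w) * φ (x - y)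
            - f (y, w) * φ (x - ℏ • w - y)‖ₑ ^ 2 * ‖u (x - ℏ • w)‖ₑ ^ 2 := by
          rw [← lintegral_const_mul' _ _ hKf]
          congr 1
          ext x
          rw [lintegral_const_mul' _ _ hKf]
      _ = volume K * ∫⁻ x, ∫⁻ w, (∫⁻ y, ‖f (x, w) * φ (x - y)
            - f (y, w) * φ (x - ℏ • w - y)‖ₑ ^ 2) * ‖u (x - ℏ • w)‖ₑ ^ 2 := by
          congr 2
          ext x
          rw [lintegral_lintegral_swap]
          · congr 1
            ext w
            rw [lintegral_mul_const]
            exact Continuous.measurable (by fun_prop)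
          · exact Measurable.aemeasurable
              (f := fun p : X n × X n => ‖f (x, p.2) * φ (x - p.1)
                - f (p.1, p.2) * φ (x - ℏ • p.2 - p.1)‖ₑ ^ 2 * ‖u (x - ℏ • p.2)‖ₑ ^ 2)
                  (((Continuous.measurable (by fun_prop)).enorm.pow_const 2).mul
                    ((Continuous.measurable (by fun_prop)).enorm.pow_const 2))
      _ ≤ volume K * (e ^ 2 * volume K * ∫⁻ x, ‖u x‖ₑ ^ 2) := by
          gcongr
          refine schur_one n K hKm u cu.measurable ℏ (e ^ 2) (fun x w => ∫⁻ y, ‖f (x, w) * φ (x - y)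
            - f (y, w) * φ (x - ℏ • w - y)‖ₑ ^ 2) ?_
          intro x w
          by_cases hw : w ∈ K
          · simp only [hw, indicator_of_mem]
            exact hk x w
          · simp [hw, hK _ w hw]
      _ = _ := by ring
  calc eLpNorm h 2 volume = eLpNorm (F + (G - F)) 2 (volume.prod volume) := by
        rw [← nG]; congr 1; abel
    _ ≤ eLpNorm F 2 (volume.prod volume) + eLpNorm (G - F) 2 (volume.prod volume) :=
        eLpNorm_add_le hFm.aestronglyMeasurable (hGm.sub hFm).aestronglyMeasurable (by norm_num)
    _ ≤ _ := by
        rw [add_mul]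
        exact add_le_add nF nD

lemma lower_bound (n : ℕ) (f : X n × X n → ℂ) (hf : ContDiff ℝ ∞ f) (K : Set (X n))
    (hKc : IsCompact K) (hK : ∀ x w, w ∉ K → f (x, w) = 0)
    (φ : X n → ℂ) (hφ : ContDiff ℝ ∞ φ) (hφc : HasCompactSupport φ)
    (hφ1 : ∫⁻ x, ‖φ x‖ₑ ^ 2 = 1)
    (ℏ : ℝ) (hh : 0 < ℏ) (e : ENNReal) (y ξ : X n)
    (hk : ∀ w, ∫⁻ x, ‖f (x, w) * φ (x - ℏ • w - y) - f (y, w) * φ (x - y)‖ₑ ^ 2 ≤ e ^ 2) :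
    ∃ u : X n → ℂ, Continuous u ∧ HasCompactSupport u ∧ eLpNorm u 2 volume = 1 ∧
      ‖fhat n f (y, ξ)‖ₑ ≤
        eLpNorm (fun x => ∫ w, f (x, w) * u (x - ℏ • w)) 2 volume + e * volume K := by
  have hKm : MeasurableSet K := hKc.measurableSet
  have hKf : volume K ≠ ⊤ := hKc.measure_lt_top.ne
  have cf := hf.continuous
  have cφ := hφ.continuous
  set ψ : X n → ℂ := fun x => Complex.exp (Complex.I * Complex.ofReal (∑ i, x i * ξ i / ℏ)) with hψ
  have cψ : Continuous ψ := by fun_prop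
  have nψ : ∀ x, ‖ψ x‖ₑ = 1 := by
    intro x
    simp only [hψ]
    rw [← ofReal_norm, mul_comm Complex.I, Complex.norm_exp_ofReal_mul_I, ENNReal.ofReal_one]
  have sψ : ∀ x w, ψ (x - ℏ • w) =
      Complex.exp (-(Complex.I) * Complex.ofReal (∑ i, w i * ξ i)) * ψ x := by
    intro x w
    simp only [hψ]
    rw [← Complex.exp_add]
    congr 1
    have : ∑ i, (x - ℏ • w) i * ξ i / ℏ = ∑ i, x i * ξ i / ℏ - ∑ i, w i * ξ i := by
      rw [← Finset.sum_sub_distrib]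
      refine Finset.sum_congr rfl fun i _ => ?_
      simp only [Pi.sub_apply, Pi.smul_apply, smul_eq_mul]
      field_simp
    rw [this, Complex.ofReal_sub]
    ring
  have cs : ∀ (y : X n), HasCompactSupport (fun w => f (y, w)) := fun y =>
    HasCompactSupport.intro hKc (fun w hw => hK y w hw)
  set u : X n → ℂ := fun x => ψ x * φ (x - y) with hu
  have cu : Continuous u := by fun_prop
  have nu : eLpNorm u 2 volume = 1 := by
    apply ennreal_sq_inj
    simp only [eLpNorm_two_sq, hu, enorm_mul, nψ, one_mul, one_pow]
    rw [lintegral_sub_right_eq_self (fun y => ‖φ y‖ₑ ^ 2), hφ1]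
  refine ⟨u, cu, ?_, nu, ?_⟩
  · exact HasCompactSupport.mul_left (hφc.comp_homeomorph (Homeomorph.subRight y))
  set h : X n → ℂ := fun x => ∫ w, f (x, w) * u (x - ℏ • w) with hh_def
  have hhm : StronglyMeasurable h := rho_meas n f cf ℏ u cu.measurable
  set c := fhat n f (y, ξ) with hc
  have hD : ∀ x, (c • u - h) x = ∫ w, -((f (x, w) * φ (x - ℏ • w - y)
      - f (y, w) * φ (x - y)) * ψ (x - ℏ • w)) := by
    intro x
    simp only [hc, fhat, hh_def, Pi.sub_apply, Pi.smul_apply, smul_eq_mul]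
    rw [← integral_mul_const, ← integral_sub]
    · congr 1
      ext w
      simp only [hu, sψ]
      ring
    · exact Continuous.integrable_of_hasCompactSupport (by fun_prop)
        ((cs y).mul_left.mul_right)
    · exact Continuous.integrable_of_hasCompactSupport (by fun_prop) ((cs x).mul_right)
  have nD : eLpNorm (c • u - h) 2 volume ≤ e * volume K := by
    rw [← ENNReal.pow_le_pow_left_iff (n := 2) (by norm_num), eLpNorm_two_sq]
    calc ∫⁻ x, ‖(c • u - h) x‖ₑ ^ 2
        ≤ ∫⁻ x, volume K * ∫⁻ w, ‖f (x, w) * φ (x - ℏ • w - y) - f (y, w) * φ (x - y)‖ₑ ^ 2 := by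
          gcongr with x
          rw [hD]
          have := cs_bound n K hKm (fun w => -((f (x, w) * φ (x - ℏ • w - y)
            - f (y, w) * φ (x - y)) * ψ (x - ℏ • w)))
            (Continuous.aestronglyMeasurable (by fun_prop))
            (fun w hw => by simp [hK _ w hw])
          simpa only [enorm_neg, enorm_mul, mul_pow, nψ, one_pow, mul_one] using this
      _ = volume K * ∫⁻ w, ∫⁻ x, ‖f (x, w) * φ (x - ℏ • w - y) - f (y, w) * φ (x - y)‖ₑ ^ 2 := by
          rw [lintegral_const_mul' _ _ hKf, lintegral_lintegral_swap]
          exact Measurable.aemeasurable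
            (f := fun p : X n × X n => ‖f (p.1, p.2) * φ (p.1 - ℏ • p.2 - y)
              - f (y, p.2) * φ (p.1 - y)‖ₑ ^ 2) (Continuous.measurable (by fun_prop))
      _ ≤ volume K * ∫⁻ w, K.indicator (fun _ => e ^ 2) w := by
          gcongr with w
          by_cases hw : w ∈ K
          · simp only [hw, indicator_of_mem]
            exact hk w
          · simp [hw, hK _ w hw]
      _ = _ := by
          rw [lintegral_indicator_const hKm]
          ring
  calc ‖c‖ₑ = eLpNorm (c • u) 2 volume := by
        rw [eLpNorm_const_smul, nu, mul_one]
    _ = eLpNorm (h + (c • u - h)) 2 volume := by congr 1; abel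
    _ ≤ eLpNorm h 2 volume + eLpNorm (c • u - h) 2 volume :=
        eLpNorm_add_le hhm.aestronglyMeasurable
          ((cu.const_smul c).aestronglyMeasurable.sub hhm.aestronglyMeasurable) (by norm_num)
    _ ≤ _ := by gcongr

/-- For every `f ∈ C_c^∞(ℝⁿ×ℝⁿ)`, the operator `ρ_ℏ(f)` is bounded on `L²(ℝⁿ)` for each
`0 < ℏ ≤ 1` and `lim_{ℏ→0⁺} ‖ρ_ℏ(f)‖ = sup_{(x,ξ)} |f̂(x,ξ)|`. -/
theorem statement2 (n : ℕ) (hn : 1 ≤ n) (f : X n × X n → ℂ)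
    (hf : ContDiff ℝ ∞ f) (hf' : HasCompactSupport f) :
    (∀ ℏ ∈ Ioc (0:ℝ) 1, ∃ T : L2X n →L[ℂ] L2X n, rhoFullSpec n ℏ f T) ∧
    (∀ T : ℝ → (L2X n →L[ℂ] L2X n), (∀ ℏ ∈ Ioc (0:ℝ) 1, rhoFullSpec n ℏ f (T ℏ)) →
      Tendsto (fun ℏ => ‖T ℏ‖) (𝓝[>] (0:ℝ)) (𝓝 (⨆ p : X n × X n, ‖fhat n f p‖))) := by

  have hc := hf.continuous
  refine ⟨fun ℏ h => rho_exists n f hc hf' ℏ h.1, fun T hT => ?_⟩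
  obtain ⟨R, A, hR, hA, hK, hfA⟩ := exists_support n f hc hf'
  set K := Metric.closedBall (0 : X n) R with hKdef
  have hKc : IsCompact K := isCompact_closedBall 0 R
  set v := (volume K).toReal with hv
  have hv0 : 0 ≤ v := ENNReal.toReal_nonneg
  have hVv : volume K = ENNReal.ofReal v := by
    rw [hv, ENNReal.ofReal_toReal hKc.measure_lt_top.ne]
  have hbdd : BddAbove (range fun p : X n × X n => ‖fhat n f p‖) := by
    refine ⟨A * v, ?_⟩
    rintro _ ⟨p, rfl⟩
    simp only [fhat]
    rw [← setIntegral_eq_integral_of_forall_compl_eq_zero (s := K)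
      (fun w hw => by simp [hK p.1 w hw])]
    refine norm_setIntegral_le_of_norm_le_const hKc.measure_lt_top (fun w _ => ?_)
    rw [norm_mul]
    have : ‖Complex.exp (-Complex.I * Complex.ofReal (∑ i, w i * p.2 i))‖ = 1 := by
      rw [Complex.norm_exp]; simp
    rw [this, one_mul]
    exact hfA _
  set M := ⨆ p : X n × X n, ‖fhat n f p‖ with hMdef
  have hM : ∀ p, ‖fhat n f p‖ ≤ M := fun p => le_ciSup hbdd p
  have hM0 : 0 ≤ M := (norm_nonneg _).trans (hM (0, 0))
  -- the operator applied to a class with given representative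
  have rep : ∀ ℏ ∈ Ioc (0:ℝ) 1, ∀ (ξ : L2X n) (g : X n → ℂ), ξ =ᵐ[volume] g →
      ‖T ℏ ξ‖ₑ = eLpNorm (fun x => ∫ w, f (x, w) * g (x - ℏ • w)) 2 volume := by
    intro ℏ hℏ ξ g hg
    rw [Lp.enorm_def]
    refine eLpNorm_congr_ae ((hT ℏ hℏ ξ).trans (ae_of_all _ fun x => ?_))
    exact integral_congr_ae (rho_ae n f ℏ hℏ.1 _ _ hg x)
  rw [Metric.tendsto_nhds]
  intro ε hε
  set e := ε / (2 * (v + 1)) with he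
  have he0 : 0 < e := by positivity
  have hev : e * v ≤ ε / 2 := by
    have : e * (v + 1) = ε / 2 := by rw [he]; field_simp
    nlinarith
  obtain ⟨φ, hφ, hφc, hφ1, hker⟩ := kernel_small n f hc hf' (e ^ 2) (by positivity)
  have hmem : ∀ᶠ ℏ in 𝓝[>] (0:ℝ), ℏ ∈ Ioc (0:ℝ) 1 := Ioc_mem_nhdsGT one_pos
  filter_upwards [hker, hmem] with ℏ hk hℏ
  rw [ENNReal.ofReal_pow he0.le] at hk
  have hup : ‖T ℏ‖ ≤ M + e * v := by
    refine ContinuousLinearMap.opNorm_le_bound _ (by positivity) ?_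
    have hd := Lp.dense_hasCompactSupport_contDiff (E := X n) (F := ℂ) (p := 2)
      (μ := (volume : Measure (X n))) (by norm_num)
    have hcl : IsClosed {ξ : L2X n | ‖T ℏ ξ‖ ≤ (M + e * v) * ‖ξ‖} :=
      isClosed_le (by fun_prop) (by fun_prop)
    intro ξ
    refine closure_minimal ?_ hcl (hd ξ)
    rintro η ⟨g, hg, hgc, hgs⟩
    have := upper_bound n f hf K hKc hK g φ hgs hgc hφ hφ1 ℏ hℏ.1 (ENNReal.ofReal e) M hM0 hM hk.1
    rw [← rep ℏ hℏ η g hg, ← eLpNorm_congr_ae hg, ← Lp.enorm_def, hVv,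
      ← ENNReal.ofReal_mul he0.le, ← ENNReal.ofReal_add hM0 (by positivity), ← ofReal_norm,
      ← ofReal_norm, ← ENNReal.ofReal_mul (by positivity),
      ENNReal.ofReal_le_ofReal_iff (by positivity)] at this
    exact this
  have hlow : ∀ p, ‖fhat n f p‖ ≤ ‖T ℏ‖ + e * v := by
    rintro ⟨y, ξ⟩
    obtain ⟨u, cu, hu, nu, hb⟩ := lower_bound n f hf K hKc hK φ hφ hφc hφ1 ℏ hℏ.1
      (ENNReal.ofReal e) y ξ (hk.2 y)
    have mu : MemLp u 2 (volume : Measure (X n)) := cu.memLp_of_hasCompactSupport hu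
    rw [← rep ℏ hℏ mu.toLp u mu.coeFn_toLp, hVv, ← ENNReal.ofReal_mul he0.le, ← ofReal_norm,
      ← ofReal_norm, ← ENNReal.ofReal_add (norm_nonneg _) (by positivity),
      ENNReal.ofReal_le_ofReal_iff (by positivity)] at hb
    have := (T ℏ).le_opNorm mu.toLp
    rw [Lp.norm_toLp, nu] at this
    simp only [ENNReal.toReal_one, mul_one] at this
    linarith
  obtain ⟨p, hp⟩ := exists_lt_of_lt_ciSup (show M - ε / 2 < M by linarith)
  have := hlow p
  rw [Real.dist_eq, abs_lt]
  constructor <;> linarith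
end
end

section
/- For all f,g ∈ C_c^∞(ℝⁿ×ℝⁿ), lim_{ℏ→0⁺} ‖ρ_ℏ(f) ρ_ℏ(g) − ρ_ℏ(f*g)‖ = 0, where ‖·‖ is the operator norm on L²(ℝⁿ). -/
open MeasureTheory Filter Topology Set
open scoped ContDiff

noncomputable section

lemma aux_map (n : ℕ) (ℏ : ℝ) (hh : ℏ ≠ 0) (x : X n) :
    ∃ c : ENNReal, c ≠ ⊤ ∧ Measure.map (fun v : X n => x - ℏ • v) volume = c • volume := by
  refine ⟨ENNReal.ofReal (abs (ℏ ^ Module.finrank ℝ (X n))⁻¹), ENNReal.ofReal_ne_top, ?_⟩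
  have h1 : (fun v : X n => x - ℏ • v) = (fun v => x - v) ∘ (fun v => ℏ • v) := rfl
  have h2 : Measure.map (fun v : X n => x - v) volume = volume :=
    (Measure.measurePreserving_sub_left (volume : Measure (X n)) x).map_eq
  rw [h1, ← Measure.map_map (by fun_prop) (by fun_prop), Measure.map_addHaar_smul _ hh,
    Measure.map_smul, h2]

lemma aux_CS {α : Type*} [MeasurableSpace α] (μ : Measure α) (F : α → ENNReal)
    (hF : AEMeasurable F μ) : (∫⁻ x, F x ∂μ) ^ 2 ≤ μ univ * ∫⁻ x, F x ^ 2 ∂μ := by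
  have h := ENNReal.lintegral_mul_le_Lp_mul_Lq μ Real.HolderConjugate.two_two
    (f := fun _ => 1) (g := F) aemeasurable_const hF
  simp only [Pi.mul_apply, one_mul, ENNReal.one_rpow, lintegral_one] at h
  calc (∫⁻ x, F x ∂μ) ^ 2 ≤ (μ univ ^ (1 / 2 : ℝ) * (∫⁻ x, F x ^ (2 : ℝ) ∂μ) ^ (1 / 2 : ℝ)) ^ 2 := by
        gcongr
    _ = _ := by
        rw [mul_pow, ← ENNReal.rpow_natCast, ← ENNReal.rpow_natCast, ← ENNReal.rpow_mul,
          ← ENNReal.rpow_mul]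
        norm_num

lemma aux_schur (n : ℕ) (ℏ : ℝ) (ξ : X n → ℂ) (hξ : Measurable ξ) (h : X n → ℂ)
    (B : Set (X n)) (c : ENNReal)
    (hb : ∀ᵐ x, ‖h x‖ₑ ≤ c * ∫⁻ w in B, ‖ξ (x - ℏ • w)‖ₑ) :
    eLpNorm h 2 volume ≤ c * volume B * eLpNorm ξ 2 volume := by
  have e2 : ∀ u : X n → ℂ, eLpNorm u 2 volume ^ 2 = ∫⁻ x, ‖u x‖ₑ ^ 2 := by
    intro u
    have := eLpNorm_nnreal_pow_eq_lintegral (f := u) (μ := (volume : Measure (X n)))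
      (p := 2) (by norm_num)
    simpa using this
  rw [← ENNReal.pow_le_pow_left_iff (n := 2) (by norm_num), mul_pow, mul_pow, e2, e2]
  have hm : Measurable (fun p : X n × X n => ‖ξ (p.1 - ℏ • p.2)‖ₑ ^ 2) := by fun_prop
  calc ∫⁻ x, ‖h x‖ₑ ^ 2 ≤ ∫⁻ x, c ^ 2 * (volume B * ∫⁻ w in B, ‖ξ (x - ℏ • w)‖ₑ ^ 2) := by
        apply lintegral_mono_ae
        filter_upwards [hb] with x hx
        calc ‖h x‖ₑ ^ 2 ≤ (c * ∫⁻ w in B, ‖ξ (x - ℏ • w)‖ₑ) ^ 2 := by gcongr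
          _ ≤ _ := by
            rw [mul_pow]
            gcongr
            have := aux_CS (volume.restrict B) (fun w => ‖ξ (x - ℏ • w)‖ₑ)
              (by fun_prop)
            simpa using this
    _ = c ^ 2 * (volume B * ∫⁻ x, ∫⁻ w in B, ‖ξ (x - ℏ • w)‖ₑ ^ 2) := by
        have hm' : Measurable fun x => ∫⁻ w in B, ‖ξ (x - ℏ • w)‖ₑ ^ 2 :=
          Measurable.lintegral_prod_right' (f := fun p : X n × X n => ‖ξ (p.1 - ℏ • p.2)‖ₑ ^ 2) hm
        rw [lintegral_const_mul _ (by fun_prop), lintegral_const_mul _ hm']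
    _ = _ := by
        rw [lintegral_lintegral_swap (by exact hm.aemeasurable)]
        have : ∀ w : X n, ∫⁻ x, ‖ξ (x - ℏ • w)‖ₑ ^ 2 = ∫⁻ x, ‖ξ x‖ₑ ^ 2 := fun w =>
          lintegral_sub_right_eq_self (fun x => ‖ξ x‖ₑ ^ 2) (ℏ • w)
        simp only [this, lintegral_const, Measure.restrict_apply MeasurableSet.univ, univ_inter]
        ring

lemma aux_int (n : ℕ) (F : X n × X n → ℂ) (hF : Continuous F) (C r : ℝ)
    (hC : ∀ p, ‖F p‖ ≤ C)
    (hs : ∀ p, F p ≠ 0 → ‖p.1‖ ≤ r ∧ ‖p.2‖ ≤ 2 * r)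
    (η : X n → ℂ) (hη : IntegrableOn η (Metric.closedBall 0 (2 * r))) :
    Integrable (fun p : X n × X n => F p * η p.2) (volume.prod volume) := by
  have h1 : Integrable ((Metric.closedBall (0 : X n) r).indicator (fun _ => (1 : ℂ))) volume := by
    rw [integrable_indicator_iff measurableSet_closedBall]
    exact integrableOn_const measure_closedBall_lt_top.ne
  have h2 : Integrable ((Metric.closedBall (0 : X n) (2 * r)).indicator η) volume := by
    rwa [integrable_indicator_iff measurableSet_closedBall]
  have h3 := (h1.mul_prod h2).bdd_mul (c := C) hF.aestronglyMeasurable (ae_of_all _ hC)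
  refine h3.congr (ae_of_all _ fun p => ?_)
  by_cases hp : F p = 0
  · simp [hp]
  · obtain ⟨ha, hb⟩ := hs p hp
    have hb' : p.2 ∈ Metric.closedBall (0 : X n) (2 * r) := by simpa using hb
    have ha' : p.1 ∈ Metric.closedBall (0 : X n) r := by simpa using ha
    simp [indicator_of_mem hb', indicator_of_mem ha']

lemma aux_point (n : ℕ) (ℏ : ℝ) (hh : ℏ ≠ 0) (f g : X n × X n → ℂ)
    (hf : Continuous f) (hg : Continuous g) (M N r ε : ℝ)
    (hM : ∀ p, ‖f p‖ ≤ M) (hN : ∀ p, ‖g p‖ ≤ N)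
    (hfr : ∀ p, f p ≠ 0 → ‖p.2‖ ≤ r) (hgr : ∀ p, g p ≠ 0 → ‖p.2‖ ≤ r)
    (hε : ∀ x v u : X n, ‖v‖ ≤ r → ‖g (x - ℏ • v, u) - g (x, u)‖ ≤ ε)
    (ξ ζ : L2X n) (hζ : ⇑ζ =ᵐ[volume] fun x => ∫ w : X n, g (x, w) * (ξ (x - ℏ • w)))
    (x : X n) :
    ‖(∫ v : X n, f (x, v) * ζ (x - ℏ • v)) -
      ∫ w : X n, (∫ v : X n, f (x, v) * g (x, w - v)) * ξ (x - ℏ • w)‖ₑ ≤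
      ENNReal.ofReal (M * ε) * volume (Metric.closedBall (0 : X n) r) *
        ∫⁻ w in Metric.closedBall (0 : X n) (2 * r), ‖ξ (x - ℏ • w)‖ₑ := by
  obtain ⟨c, hc, hmap⟩ := aux_map n ℏ hh x
  have hM0 : 0 ≤ M := (norm_nonneg _).trans (hM 0)
  have hξm : Measurable ξ := (Lp.stronglyMeasurable ξ).measurable
  have hη : IntegrableOn (fun w => ξ (x - ℏ • w)) (Metric.closedBall (0 : X n) (2 * r)) := by
    have h1 : MemLp ξ 2 (Measure.map (fun v : X n => x - ℏ • v) volume) := by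
      rw [hmap]; exact (Lp.memLp ξ).smul_measure hc
    have h2 : MemLp (fun w => ξ (x - ℏ • w)) 2 volume :=
      (memLp_map_measure_iff h1.1 (by fun_prop)).1 h1
    exact (h2.locallyIntegrable (by norm_num)).integrableOn_isCompact (isCompact_closedBall _ _)
  have hq : Measure.QuasiMeasurePreserving (fun v : X n => x - ℏ • v) volume volume :=
    ⟨by fun_prop, by rw [hmap]; exact Measure.smul_absolutelyContinuous⟩
  have hsupp : ∀ y : X n → X n, ∀ p : X n × X n, f (x, p.1) * g (y p.1, p.2 - p.1) ≠ 0 →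
      ‖p.1‖ ≤ r ∧ ‖p.2‖ ≤ 2 * r := by
    intro y p hp
    have h1 := hfr _ (left_ne_zero_of_mul hp)
    have h2 := hgr _ (right_ne_zero_of_mul hp)
    refine ⟨h1, ?_⟩
    have := norm_add_le (p.2 - p.1) p.1
    simp only [sub_add_cancel] at this
    simp only at h1 h2
    linarith
  have hbd : ∀ y : X n → X n, ∀ p : X n × X n, ‖f (x, p.1) * g (y p.1, p.2 - p.1)‖ ≤ M * N := by
    intro y p
    rw [norm_mul]
    exact mul_le_mul (hM _) (hN _) (norm_nonneg _) hM0
  have I1 := aux_int n (fun p => f (x, p.1) * g (x - ℏ • p.1, p.2 - p.1)) (by fun_prop) (M * N) r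
    (hbd fun v => x - ℏ • v) (hsupp fun v => x - ℏ • v) _ hη
  have I2 := aux_int n (fun p => f (x, p.1) * g (x, p.2 - p.1)) (by fun_prop) (M * N) r
    (hbd fun v => x) (hsupp fun v => x) _ hη
  have E1 : (∫ v : X n, f (x, v) * ζ (x - ℏ • v)) =
      ∫ p : X n × X n, f (x, p.1) * g (x - ℏ • p.1, p.2 - p.1) * ξ (x - ℏ • p.2)
        ∂(volume.prod volume) := by
    rw [integral_prod _ I1]
    apply integral_congr_ae
    filter_upwards [hq.ae hζ] with v hv
    rw [hv, ← integral_sub_right_eq_self _ v, ← integral_const_mul]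
    refine integral_congr_ae (ae_of_all _ fun w => ?_)
    have : x - ℏ • v - ℏ • (w - v) = x - ℏ • w := by rw [smul_sub]; abel
    simp only [this, mul_assoc]
  have E2 : (∫ w : X n, (∫ v : X n, f (x, v) * g (x, w - v)) * ξ (x - ℏ • w)) =
      ∫ p : X n × X n, f (x, p.1) * g (x, p.2 - p.1) * ξ (x - ℏ • p.2)
        ∂(volume.prod volume) := by
    rw [integral_prod_symm _ I2]
    simp only [integral_mul_const]
  rw [E1, E2, ← integral_sub I1 I2]
  refine (enorm_integral_le_lintegral_enorm _).trans ?_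
  have key : ∀ p : X n × X n, ‖f (x, p.1) * g (x - ℏ • p.1, p.2 - p.1) * ξ (x - ℏ • p.2) -
      f (x, p.1) * g (x, p.2 - p.1) * ξ (x - ℏ • p.2)‖ₑ ≤
      (Metric.closedBall (0 : X n) r).indicator (fun _ => ENNReal.ofReal (M * ε)) p.1 *
      (Metric.closedBall (0 : X n) (2 * r)).indicator (fun w => ‖ξ (x - ℏ • w)‖ₑ) p.2 := by
    intro p
    by_cases h0 : f (x, p.1) * g (x - ℏ • p.1, p.2 - p.1) = 0 ∧ f (x, p.1) * g (x, p.2 - p.1) = 0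
    · simp [h0.1, h0.2]
    · have hp : ‖p.1‖ ≤ r ∧ ‖p.2‖ ≤ 2 * r := by
        by_cases h1 : f (x, p.1) * g (x - ℏ • p.1, p.2 - p.1) = 0
        · exact hsupp (fun _ => x) p fun h => h0 ⟨h1, h⟩
        · exact hsupp (fun v => x - ℏ • v) p h1
      have hb' : p.2 ∈ Metric.closedBall (0 : X n) (2 * r) := by simpa using hp.2
      have ha' : p.1 ∈ Metric.closedBall (0 : X n) r := by simpa using hp.1
      rw [indicator_of_mem hb', indicator_of_mem ha', ← sub_mul, enorm_mul]
      gcongr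
      rw [← mul_sub, ← ofReal_norm, norm_mul]
      exact ENNReal.ofReal_le_ofReal
        (mul_le_mul (hM _) (hε _ _ _ hp.1) (norm_nonneg _) hM0)
  refine (lintegral_mono key).trans ?_
  rw [lintegral_prod_mul, lintegral_indicator measurableSet_closedBall,
    lintegral_indicator measurableSet_closedBall, lintegral_const]
  · simp
  · exact (measurable_const.indicator measurableSet_closedBall).aemeasurable
  · exact ((by fun_prop : Measurable fun w => ‖ξ (x - ℏ • w)‖ₑ).indicator
      measurableSet_closedBall).aemeasurable

/-- For all `f, g ∈ C_c^∞(ℝⁿ×ℝⁿ)`,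
`lim_{ℏ→0⁺} ‖ρ_ℏ(f) ρ_ℏ(g) − ρ_ℏ(f*g)‖ = 0`, where
`(f*g)(x,w) = ∫ f(x,v) g(x,w−v) dv` is the fiberwise convolution. -/
theorem statement3 (n : ℕ) (hn : 1 ≤ n) (f g : X n × X n → ℂ)
    (hf : ContDiff ℝ ∞ f) (hf' : HasCompactSupport f)
    (hg : ContDiff ℝ ∞ g) (hg' : HasCompactSupport g)
    (T S R : ℝ → (L2X n →L[ℂ] L2X n))
    (hT : ∀ ℏ ∈ Ioc (0:ℝ) 1, rhoFullSpec n ℏ f (T ℏ))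
    (hS : ∀ ℏ ∈ Ioc (0:ℝ) 1, rhoFullSpec n ℏ g (S ℏ))
    (hR : ∀ ℏ ∈ Ioc (0:ℝ) 1,
      rhoFullSpec n ℏ (fun p => ∫ v : X n, f (p.1, v) * g (p.1, p.2 - v)) (R ℏ)) :
    Tendsto (fun ℏ => ‖(T ℏ).comp (S ℏ) - R ℏ‖) (𝓝[>] (0:ℝ)) (𝓝 0) := by
  obtain ⟨M, hM⟩ := hf'.exists_bound_of_continuous hf.continuous
  obtain ⟨N, hN⟩ := hg'.exists_bound_of_continuous hg.continuous
  have hM0 : 0 ≤ M := (norm_nonneg _).trans (hM 0)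
  obtain ⟨r1, hr1⟩ := hf'.isCompact.isBounded.exists_norm_le
  obtain ⟨r2, hr2⟩ := hg'.isCompact.isBounded.exists_norm_le
  set r := max 1 (max r1 r2) with hr
  have hr0 : 0 < r := lt_of_lt_of_le one_pos (le_max_left _ _)
  have hfr : ∀ p, f p ≠ 0 → ‖p.2‖ ≤ r := fun p hp =>
    (norm_snd_le p).trans ((hr1 p (subset_tsupport _ hp)).trans
      ((le_max_left _ _).trans (le_max_right _ _)))
  have hgr : ∀ p, g p ≠ 0 → ‖p.2‖ ≤ r := fun p hp =>
    (norm_snd_le p).trans ((hr2 p (subset_tsupport _ hp)).trans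
      ((le_max_right _ _).trans (le_max_right _ _)))
  have huc : UniformContinuous g := hg'.uniformContinuous_of_continuous hg.continuous
  set V1 := (volume (Metric.closedBall (0 : X n) r)).toReal with hV1
  set V2 := (volume (Metric.closedBall (0 : X n) (2 * r))).toReal with hV2
  have hV10 : 0 ≤ V1 := ENNReal.toReal_nonneg
  have hV20 : 0 ≤ V2 := ENNReal.toReal_nonneg
  rw [Metric.tendsto_nhds]
  intro e he
  set K := M * V1 * V2 + 1 with hK
  have hK0 : 0 < K := by positivity
  set ε := e / 2 / K with hεdef
  have hε0 : 0 < ε := by positivity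
  obtain ⟨δ, hδ, hgδ⟩ := Metric.uniformContinuous_iff.1 huc ε hε0
  have hev : ∀ᶠ ℏ in 𝓝[>] (0 : ℝ), ℏ ∈ Ioo 0 (min 1 (δ / r)) :=
    Ioo_mem_nhdsGT (by positivity)
  filter_upwards [hev] with ℏ hℏ
  have h1 : ℏ ∈ Ioc (0 : ℝ) 1 := ⟨hℏ.1, (hℏ.2.trans_le (min_le_left _ _)).le⟩
  have h2 : ℏ * r < δ := by
    have := hℏ.2.trans_le (min_le_right _ _)
    rwa [lt_div_iff₀ hr0] at this
  have hε : ∀ x v u : X n, ‖v‖ ≤ r → ‖g (x - ℏ • v, u) - g (x, u)‖ ≤ ε := by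
    intro x v u hv
    rw [← dist_eq_norm]
    refine (hgδ ?_).le
    rw [Prod.dist_eq, dist_self, dist_eq_norm]
    have h3 : ‖x - ℏ • v - x‖ = ℏ * ‖v‖ := by
      rw [sub_sub_cancel_left, norm_neg, norm_smul, Real.norm_of_nonneg hℏ.1.le]
    simp only [h3]
    exact max_lt ((mul_le_mul_of_nonneg_left hv hℏ.1.le).trans_lt h2) hδ
  have hbound : ‖(T ℏ).comp (S ℏ) - R ℏ‖ ≤ M * ε * V1 * V2 := by
    refine ContinuousLinearMap.opNorm_le_bound _ (by positivity) fun ξ => ?_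
    have hae : ∀ᵐ x, ‖(((T ℏ).comp (S ℏ) - R ℏ) ξ : L2X n) x‖ₑ ≤
        ENNReal.ofReal (M * ε) * volume (Metric.closedBall (0 : X n) r) *
        ∫⁻ w in Metric.closedBall (0 : X n) (2 * r), ‖ξ (x - ℏ • w)‖ₑ := by
      have hsub := Lp.coeFn_sub ((T ℏ) ((S ℏ) ξ)) ((R ℏ) ξ)
      filter_upwards [hsub, hT ℏ h1 (S ℏ ξ), hR ℏ h1 ξ] with x hx hx1 hx2
      have := aux_point n ℏ hℏ.1.ne' f g hf.continuous hg.continuous M N r ε hM hN hfr hgr hε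
        ξ (S ℏ ξ) (hS ℏ h1 ξ) x
      rw [← hx1, ← hx2] at this
      rw [Pi.sub_apply] at hx
      rw [← hx] at this
      exact this
    have hfin := aux_schur n ℏ ξ (Lp.stronglyMeasurable ξ).measurable _ _ _ hae
    rw [Lp.norm_def, Lp.norm_def]
    have := ENNReal.toReal_mono (ENNReal.mul_ne_top (ENNReal.mul_ne_top (ENNReal.mul_ne_top
      ENNReal.ofReal_ne_top measure_closedBall_lt_top.ne) measure_closedBall_lt_top.ne)
      (Lp.eLpNorm_ne_top ξ)) hfin
    rwa [ENNReal.toReal_mul, ENNReal.toReal_mul, ENNReal.toReal_mul,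
      ENNReal.toReal_ofReal (by positivity)] at this
  rw [Real.dist_eq, sub_zero, abs_of_nonneg (norm_nonneg _)]
  refine hbound.trans_lt ?_
  have h5 : ε * K = e / 2 := by rw [hεdef]; field_simp
  have h6 : M * ε * V1 * V2 = ε * K - ε := by rw [hK]; ring
  linarith
end
end

section
/- For all f,g ∈ C_c^∞(ℝⁿ×ℝⁿ) and every 0<ℏ≤1, the functions f*_ℏg and l_ℏ(f,g) are smooth and compactly supported, and one has the exact operator identity ρ_ℏ(f) ρ_ℏ(g) = ρ_ℏ(f*_ℏ g) + κ_ℏ(l_ℏ(f,g)) on L²(ℝⁿ₊). -/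
open MeasureTheory Filter Topology Set
open scoped ContDiff

noncomputable section

/-- `ℝ^{n−1}`, the boundary directions. -/
abbrev Eb (n : ℕ) : Type := Fin (n - 1) → ℝ

/-- `ℝⁿ` written as `ℝ^{n−1} × ℝ`; a point is `x = (x', xₙ)`. -/
abbrev Ef (n : ℕ) : Type := Eb n × ℝ

/-- Lebesgue measure restricted to the closed half-space `ℝⁿ₊ = {x : xₙ ≥ 0}`. -/
def muPlus (n : ℕ) : Measure (Ef n) := volume.restrict {p : Ef n | 0 ≤ p.2}

/-- `L²(ℝⁿ₊)`. -/
abbrev HS (n : ℕ) := Lp ℂ 2 (muPlus n)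

/-- `T` is the ℏ-scaled truncated operator `ρ_ℏ(f)` on `L²(ℝⁿ₊)`:
`(ρ_ℏ(f)ξ)(x) = ∫_{v : xₙ ≥ ℏvₙ} f(x,v) ξ(x−ℏv) dv`. -/
def rhoSpec (n : ℕ) (ℏ : ℝ) (f : Ef n × Ef n → ℂ) (T : HS n →L[ℂ] HS n) : Prop :=
  ∀ ξ : HS n, ⇑(T ξ) =ᵐ[muPlus n]
    fun x => ∫ v in {v : Ef n | ℏ * v.2 ≤ x.2},
      f (x, v) * (ξ (x.1 - ℏ • v.1, x.2 - ℏ * v.2))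

/-- `S` is the ℏ-scaled Green-type operator `κ_ℏ(K)` on `L²(ℝⁿ₊)`:
`(κ_ℏ(K)ξ)(x',xₙ) = ∫_{ℝ^{n−1}} ∫₀^∞ K(x',y',xₙ/ℏ,yₙ) ξ(x'−ℏy', ℏyₙ) dyₙ dy'`. -/
def kappaSpec (n : ℕ) (ℏ : ℝ) (K : Eb n × Eb n × ℝ × ℝ → ℂ) (S : HS n →L[ℂ] HS n) : Prop :=
  ∀ ξ : HS n, ⇑(S ξ) =ᵐ[muPlus n]
    fun x => ∫ y' : Eb n, ∫ yn in Ioi (0:ℝ),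
      K (x.1, y', x.2 / ℏ, yn) * (ξ (x.1 - ℏ • y', ℏ * yn))

/-- The measure on `ℝⁿ₊ × ℝⁿ` (base point in the half-space, tangent vector free). -/
def muT (n : ℕ) : Measure (Ef n × Ef n) := (muPlus n).prod volume

/-- `L²(ℝⁿ₊ × ℝⁿ)`. -/
abbrev HT (n : ℕ) := Lp ℂ 2 (muT n)

/-- `P` is the fiberwise convolution operator `π₀(f)` on `L²(ℝⁿ₊×ℝⁿ)`:
`(π₀(f)ξ)(x,v) = ∫ f(x,w) ξ(x,v−w) dw`. -/
def pi0Spec (n : ℕ) (f : Ef n × Ef n → ℂ) (P : HT n →L[ℂ] HT n) : Prop :=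
  ∀ ξ : HT n, ⇑(P ξ) =ᵐ[muT n] fun p => ∫ w : Ef n, f (p.1, w) * (ξ (p.1, p.2 - w))

/-- Lebesgue measure on `ℝ^{n−1} × ℝ^{n−1} × ℝ` restricted to `ℝ^{n−1} × ℝ^{n−1} × ℝ₊`. -/
def muB (n : ℕ) : Measure (Eb n × Eb n × ℝ) :=
  volume.restrict {q : Eb n × Eb n × ℝ | 0 ≤ q.2.2}

/-- `L²(ℝ^{n−1} × ℝ^{n−1} × ℝ₊)`. -/
abbrev HB (n : ℕ) := Lp ℂ 2 (muB n)

/-- `B` is the boundary operator `π₀^∂(f⊕K)` on `L²(ℝ^{n−1}×ℝ^{n−1}×ℝ₊)`: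
`(π₀^∂(f⊕K)ξ)(x',v',vₙ) = ∫_{ℝ^{n−1}} ∫₀^∞ [f(x',0,v'−w',vₙ−wₙ) + K(x',v'−w',vₙ,wₙ)]
ξ(x',w',wₙ) dwₙ dw'`. -/
def piBSpec (n : ℕ) (f : Ef n × Ef n → ℂ) (K : Eb n × Eb n × ℝ × ℝ → ℂ)
    (B : HB n →L[ℂ] HB n) : Prop :=
  ∀ ξ : HB n, ⇑(B ξ) =ᵐ[muB n]
    fun q => ∫ w' : Eb n, ∫ wn in Ioi (0:ℝ),
      (f ((q.1, (0:ℝ)), (q.2.1 - w', q.2.2 - wn)) + K (q.1, q.2.1 - w', q.2.2, wn)) *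
        (ξ (q.1, w', wn))

/-- Fiberwise convolution `(f*g)(x,w) = ∫ f(x,v) g(x,w−v) dv`. -/
def fconv (n : ℕ) (f g : Ef n × Ef n → ℂ) : Ef n × Ef n → ℂ :=
  fun p => ∫ v : Ef n, f (p.1, v) * g (p.1, p.2 - v)

/-- The Green symbol `l(f,g)(x',y',xₙ,yₙ) =
−∫_{ℝ^{n−1}} ∫_{xₙ}^∞ f(x',0,y'−v',vₙ) g(x',0,v',xₙ−vₙ−yₙ) dvₙ dv'`. -/
def lGreen (n : ℕ) (f g : Ef n × Ef n → ℂ) : Eb n × Eb n × ℝ × ℝ → ℂ :=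
  fun q => -(∫ v' : Eb n, ∫ vn in Ici q.2.2.1,
    f ((q.1, (0:ℝ)), (q.2.1 - v', vn)) * g ((q.1, (0:ℝ)), (v', q.2.2.1 - vn - q.2.2.2)))

/-- The ℏ-twisted convolution `(f*_ℏg)(x,w) = ∫ f(x,v) g(x−ℏv, w−v) dv`. -/
def fconvH (n : ℕ) (ℏ : ℝ) (f g : Ef n × Ef n → ℂ) : Ef n × Ef n → ℂ :=
  fun p => ∫ v : Ef n, f (p.1, v) * g (p.1 - ℏ • v, p.2 - v)

/-- The ℏ-dependent Green symbol `l_ℏ(f,g)(x',y',xₙ,yₙ) =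
−∫_{ℝ^{n−1}} ∫_{xₙ}^∞ f(x',ℏxₙ,v',vₙ) g(x'−ℏv', ℏ(xₙ−vₙ), y'−v', xₙ−yₙ−vₙ) dvₙ dv'`. -/
def lGreenH (n : ℕ) (ℏ : ℝ) (f g : Ef n × Ef n → ℂ) : Eb n × Eb n × ℝ × ℝ → ℂ :=
  fun q => -(∫ v' : Eb n, ∫ vn in Ici q.2.2.1,
    f ((q.1, ℏ * q.2.2.1), (v', vn)) *
      g ((q.1 - ℏ • v', ℏ * (q.2.2.1 - vn)), (q.2.1 - v', q.2.2.1 - q.2.2.2 - vn)))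

instance aux_haar (n : ℕ) : (volume : Measure (Eb n × ℝ)).IsAddHaarMeasure := by
  rw [Measure.volume_eq_prod]
  infer_instance

theorem aux_slice {P G : Type} [TopologicalSpace P] [TopologicalSpace G] [T2Space G]
    (H : P × G → ℂ) (hc : HasCompactSupport H) (p : P) :
    HasCompactSupport (fun v => H (p, v)) := by
  have hK : IsCompact (tsupport H) := hc
  refine HasCompactSupport.intro (hK.image continuous_snd) ?_
  intro v hv
  exact image_eq_zero_of_notMem_tsupport fun hh => hv ⟨_, hh, rfl⟩

/-- Partial integrals of smooth compactly supported functions. -/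
theorem aux_param {P G : Type} [NormedAddCommGroup P] [NormedSpace ℝ P]
    [NormedAddCommGroup G] [NormedSpace ℝ G] [MeasurableSpace G] [BorelSpace G]
    [FiniteDimensional ℝ G]
    (μ : Measure G) [μ.IsAddHaarMeasure]
    (H : P × G → ℂ) (hH : ContDiff ℝ ∞ H) (hc : HasCompactSupport H) (A : Set G)
    (hA : MeasurableSet A) :
    ContDiff ℝ ∞ (fun p => ∫ v in A, H (p, v) ∂μ) ∧
      HasCompactSupport (fun p => ∫ v in A, H (p, v) ∂μ) := by
  have hK : IsCompact (tsupport H) := hc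
  have hz : ∀ z, z ∉ tsupport H → H z = 0 := fun z hz => image_eq_zero_of_notMem_tsupport hz
  constructor
  · have hloc : LocallyIntegrable (A.indicator (fun _ => (1:ℝ))) μ :=
      (locallyIntegrable_const _).indicator hA
    have key := contDiffOn_convolution_right_with_param_comp (𝕜 := ℝ) (μ := μ) (n := ⊤)
      (ContinuousLinearMap.lsmul ℝ ℝ : ℝ →L[ℝ] ℂ →L[ℝ] ℂ)
      (s := (univ : Set P)) (v := fun _ => (0:G)) contDiffOn_const
      (f := A.indicator (fun _ => (1:ℝ))) (g := fun p x => H (p, -x))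
      (k := (fun z : P × G => -z.2) '' tsupport H) isOpen_univ
      (hK.image (by fun_prop)) (by
        intro p x _ hx
        apply hz
        intro hh
        exact hx ⟨_, hh, by simp⟩) hloc (by
        apply ContDiff.contDiffOn
        exact hH.comp (contDiff_fst.prodMk contDiff_snd.neg))
    rw [contDiffOn_univ] at key
    convert key using 2 with p
    rw [convolution, ← integral_indicator hA]
    congr 1
    ext t
    by_cases ht : t ∈ A <;> simp [ht]
  · refine HasCompactSupport.intro (hK.image continuous_fst) ?_
    intro p hp
    have : ∀ v, H (p, v) = 0 := fun v => hz _ fun hh => hp ⟨_, hh, rfl⟩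
    simp [this]

/-- `f(a z) g(b z)` is smooth and compactly supported when `(a,b)` is linear injective. -/
theorem aux_comp {V W W' : Type} [NormedAddCommGroup V] [NormedSpace ℝ V] [FiniteDimensional ℝ V]
    [NormedAddCommGroup W] [NormedSpace ℝ W] [FiniteDimensional ℝ W]
    [NormedAddCommGroup W'] [NormedSpace ℝ W'] [FiniteDimensional ℝ W']
    (f : W → ℂ) (g : W' → ℂ) 
    (hf : ContDiff ℝ ∞ f) (hf' : HasCompactSupport f)
    (hg : ContDiff ℝ ∞ g) (hg' : HasCompactSupport g)
    (L : V →ₗ[ℝ] W × W') (hL : Function.Injective L) :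
    ContDiff ℝ ∞ (fun z => f (L z).1 * g (L z).2) ∧
      HasCompactSupport (fun z => f (L z).1 * g (L z).2) := by
  constructor
  · have h := (LinearMap.toContinuousLinearMap L).contDiff (n := ∞)
    exact (hf.comp (contDiff_fst.comp h)).mul (hg.comp (contDiff_snd.comp h))
  · have h1 : HasCompactSupport (fun w : W × W' => f w.1 * g w.2) := by
      refine HasCompactSupport.intro (IsCompact.prod hf' hg') ?_
      rintro ⟨a, b⟩ hab
      by_cases h : a ∈ tsupport f
      · have : b ∉ tsupport g := fun hb => hab ⟨h, hb⟩
        simp [image_eq_zero_of_notMem_tsupport this]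
      · simp [image_eq_zero_of_notMem_tsupport h]
    exact h1.comp_isClosedEmbedding
      (LinearMap.isClosedEmbedding_of_injective (LinearMap.ker_eq_bot.2 hL))

/-- The linear map for `fconvH`. -/
def LA (n : ℕ) (ℏ : ℝ) : ((Ef n × Ef n) × Ef n) →ₗ[ℝ] (Ef n × Ef n) × (Ef n × Ef n) where
  toFun p := ((p.1.1, p.2), (p.1.1 - ℏ • p.2, p.1.2 - p.2))
  map_add' a b := by ext <;> simp <;> ring
  map_smul' a b := by ext <;> simp <;> ring

theorem LA_inj (n : ℕ) (ℏ : ℝ) : Function.Injective (LA n ℏ) := by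
  rintro ⟨⟨a, b⟩, c⟩ ⟨⟨a', b'⟩, c'⟩ h
  simp only [LA, LinearMap.coe_mk, AddHom.coe_mk, Prod.mk.injEq] at h
  obtain ⟨⟨rfl, rfl⟩, -, h⟩ := h
  simp at h
  simp [h]

/-- The linear map for `lGreenH`. -/
def LB (n : ℕ) (ℏ : ℝ) :
    ((Eb n × Eb n × ℝ × ℝ) × (Eb n × ℝ)) →ₗ[ℝ] (Ef n × Ef n) × (Ef n × Ef n) where
  toFun p := (((p.1.1, ℏ * p.1.2.2.1), (p.2.1, p.1.2.2.1 + p.2.2)),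
    ((p.1.1 - ℏ • p.2.1, -(ℏ * p.2.2)), (p.1.2.1 - p.2.1, - p.1.2.2.2 - p.2.2)))
  map_add' a b := by ext <;> simp <;> ring
  map_smul' a b := by ext <;> simp <;> ring

theorem LB_inj (n : ℕ) (ℏ : ℝ) (h0 : ℏ ≠ 0) : Function.Injective (LB n ℏ) := by
  rintro ⟨⟨a, b, c, d⟩, e, t⟩ ⟨⟨a', b', c', d'⟩, e', t'⟩ h
  simp only [LB, LinearMap.coe_mk, AddHom.coe_mk, Prod.mk.injEq] at h
  obtain ⟨⟨⟨rfl, h1⟩, rfl, h2⟩, ⟨-, h3⟩, h4, h5⟩ := h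
  have h1 := mul_left_cancel₀ h0 h1
  subst h1
  have h2 : t = t' := by linarith
  subst h2
  have h5 : d = d' := by linarith
  have h4 : b = b' := by simpa using h4
  simp [h4, h5]

theorem aux_meas (n : ℕ) (s : Set ℝ) (hs : MeasurableSet s) : 
    MeasurableSet ((univ : Set (Eb n)) ×ˢ s) := MeasurableSet.univ.prod hs

theorem aux_fconv (n : ℕ) (ℏ : ℝ) (f g : Ef n × Ef n → ℂ)
    (hf : ContDiff ℝ ∞ f) (hf' : HasCompactSupport f)
    (hg : ContDiff ℝ ∞ g) (hg' : HasCompactSupport g) :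
    ContDiff ℝ ∞ (fconvH n ℏ f g) ∧ HasCompactSupport (fconvH n ℏ f g) := by
  obtain ⟨h1, h2⟩ := aux_comp f g hf hf' hg hg' (LA n ℏ) (LA_inj n ℏ)
  have := aux_param (volume : Measure (Ef n)) _ h1 h2 univ MeasurableSet.univ
  simp only [setIntegral_univ] at this
  exact this

theorem lGreen_eq (n : ℕ) (ℏ : ℝ) (f g : Ef n × Ef n → ℂ)
    (h0 : ℏ ≠ 0)
    (hf : ContDiff ℝ ∞ f) (hf' : HasCompactSupport f)
    (hg : ContDiff ℝ ∞ g) (hg' : HasCompactSupport g) :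
    lGreenH n ℏ f g = fun q => - ∫ v in (univ : Set (Eb n)) ×ˢ Ici (0:ℝ),
      f (LB n ℏ (q, v)).1 * g (LB n ℏ (q, v)).2 := by
  obtain ⟨h1, h2⟩ := aux_comp f g hf hf' hg hg' (LB n ℏ) (LB_inj n ℏ h0)
  funext q
  have hi : Integrable (fun v : Eb n × ℝ => f (LB n ℏ (q, v)).1 * g (LB n ℏ (q, v)).2) := by
    have hc : Continuous (fun v : Eb n × ℝ => (q, v)) := by fun_prop
    apply Continuous.integrable_of_hasCompactSupport
    · exact h1.continuous.comp hc
    · exact aux_slice _ h2 q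
  rw [lGreenH]
  congr 1
  rw [Measure.volume_eq_prod, setIntegral_prod _ hi.integrableOn, setIntegral_univ]
  congr 1
  funext v'
  rw [← integral_indicator measurableSet_Ici, ← integral_indicator measurableSet_Ici,
    ← integral_add_left_eq_self _ q.2.2.1]
  congr 1
  funext t
  by_cases ht : 0 ≤ t
  · rw [indicator_of_mem (by simpa using ht), indicator_of_mem (by simpa using ht)]
    simp only [LB, LinearMap.coe_mk, AddHom.coe_mk]
    congr 4
    · ring
    · ring
  · rw [indicator_of_notMem (by simpa using ht), indicator_of_notMem (by simpa using ht)]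

theorem aux_lGreen (n : ℕ) (ℏ : ℝ) (f g : Ef n × Ef n → ℂ)
    (h0 : ℏ ≠ 0)
    (hf : ContDiff ℝ ∞ f) (hf' : HasCompactSupport f)
    (hg : ContDiff ℝ ∞ g) (hg' : HasCompactSupport g) :
    ContDiff ℝ ∞ (lGreenH n ℏ f g) ∧ HasCompactSupport (lGreenH n ℏ f g) := by
  rw [lGreen_eq n ℏ f g h0 hf hf' hg hg']
  obtain ⟨h1, h2⟩ := aux_comp f g hf hf' hg hg' (LB n ℏ) (LB_inj n ℏ h0)
  have := aux_param (volume : Measure (Eb n × ℝ)) _ h1 h2 _ (aux_meas n (Ici 0) measurableSet_Ici)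
  exact ⟨this.1.neg, this.2.neg⟩

theorem aux_snd {G G' : Type} [TopologicalSpace G] [T2Space G] [MeasurableSpace G] [BorelSpace G]
    [TopologicalSpace G'] [T2Space G'] [MeasurableSpace G'] [BorelSpace G']
    [OpensMeasurableSpace (G' × G)] [LocallyCompactSpace G] [LocallyCompactSpace G']
    (μ : Measure G) (ν : Measure G') [IsLocallyFiniteMeasure ν] [SFinite μ] [SFinite ν]
    (η : G → ℂ) (hη : LocallyIntegrable η μ) :
    LocallyIntegrable (fun z : G' × G => η z.2) (ν.prod μ) := by
  rw [locallyIntegrable_iff]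
  intro K hK
  have h1 := hK.image continuous_fst
  have h2 := hK.image continuous_snd
  have : IntegrableOn (fun z : G' × G => η z.2) ((Prod.fst '' K) ×ˢ (Prod.snd '' K))
      (ν.prod μ) := by
    rw [IntegrableOn, ← Measure.prod_restrict]
    haveI : IsFiniteMeasure (ν.restrict (Prod.fst '' K)) :=
      ⟨by simpa using h1.measure_lt_top⟩
    exact Integrable.comp_snd ((locallyIntegrable_iff.1 hη) _ h2) _
  exact this.mono_set fun z hz => ⟨⟨z, hz, rfl⟩, ⟨z, hz, rfl⟩⟩

theorem aux_setA (n : ℕ) (ℏ : ℝ) (h0 : 0 < ℏ) (x : Ef n) :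
    {v : Ef n | ℏ * v.2 ≤ x.2} = (univ : Set (Eb n)) ×ˢ Iic (x.2 / ℏ) := by
  ext v
  simp [le_div_iff₀ h0, mul_comm]

theorem aux_setAc (n : ℕ) (t : ℝ) :
    ((univ : Set (Eb n)) ×ˢ Iic t)ᶜ = (univ : Set (Eb n)) ×ˢ Ioi t := by
  ext v
  simp

theorem aux_point_s5 (n : ℕ) (ℏ : ℝ) (f g : Ef n × Ef n → ℂ)
    (h0 : 0 < ℏ)
    (hf : ContDiff ℝ ∞ f) (hf' : HasCompactSupport f)
    (hg : ContDiff ℝ ∞ g) (hg' : HasCompactSupport g) (x : Ef n) (η : Ef n → ℂ)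
    (A : Set (Ef n)) (hAdef : A = (univ : Set (Eb n)) ×ˢ Iic (x.2 / ℏ))
    (hη : LocallyIntegrable (A.indicator η)) :
    ∫ v in A, f (x, v) * ∫ u in A, g (x - ℏ • v, u - v) * η u =
      (∫ u in A, fconvH n ℏ f g (x, u) * η u) +
      ∫ y' : Eb n, ∫ yn in Ioi (0:ℝ),
        lGreenH n ℏ f g (x.1, y', x.2 / ℏ, yn) * η (y', x.2 / ℏ - yn) := by
  have hA : MeasurableSet A := by rw [hAdef]; exact aux_meas n _ measurableSet_Iic
  obtain ⟨h1, h2⟩ := aux_comp f g hf hf' hg hg' (LA n ℏ) (LA_inj n ℏ)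
  set k : Ef n × Ef n → ℂ := fun z => f (x, z.2) * g (x - ℏ • z.2, z.1 - z.2) with hk
  have hk1 : ContDiff ℝ ∞ k :=
    h1.comp (f := fun z : Ef n × Ef n => ((x, z.1), z.2))
      ((contDiff_const.prodMk contDiff_fst).prodMk contDiff_snd)
  have hk2 : HasCompactSupport k := by
    have hK : IsCompact (tsupport _) := h2
    refine HasCompactSupport.intro (hK.image (f := fun z => (z.1.2, z.2)) (by fun_prop)) ?_
    rintro ⟨u, v⟩ hv
    exact image_eq_zero_of_notMem_tsupport (x := ((x, u), v)) fun hh => hv ⟨_, hh, rfl⟩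
  -- integrability of smooth cutoffs times `η`
  have hint : ∀ J : Ef n → ℂ, Continuous J → HasCompactSupport J →
      IntegrableOn (fun u => J u * η u) A := by
    intro J hJ hJ'
    have := hη.integrable_smul_left_of_hasCompactSupport hJ hJ'
    rw [← integrable_indicator_iff hA]
    refine this.congr (Eventually.of_forall fun u => ?_)
    by_cases hu : u ∈ A <;> simp [hu]
  obtain ⟨a1, a2⟩ := aux_param (volume : Measure (Ef n)) k hk1 hk2 A hA
  obtain ⟨b1, b2⟩ := aux_param (volume : Measure (Ef n)) k hk1 hk2 Aᶜ hA.compl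
  have hkv : ∀ u, Integrable (fun v => k (u, v)) := fun u =>
    (hk1.continuous.comp (by fun_prop : Continuous fun v : Ef n => (u, v))).integrable_of_hasCompactSupport
      (aux_slice k hk2 u)
  -- Fubini
  have s1 : ∫ v in A, f (x, v) * ∫ u in A, g (x - ℏ • v, u - v) * η u =
      ∫ u in A, (∫ v in A, k (u, v)) * η u := by
    have e1 : ∀ v, f (x, v) * ∫ u in A, g (x - ℏ • v, u - v) * η u =
        ∫ u in A, k (u, v) * η u := by
      intro v
      rw [← integral_const_mul]
      simp only [hk, mul_assoc]
    have e2 : ∀ u, (∫ v in A, k (u, v)) * η u = ∫ v in A, k (u, v) * η u := by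
      intro u
      rw [integral_mul_const]
    simp only [e1, e2]
    rw [integral_integral_swap]
    have hl := aux_snd (volume : Measure (Ef n)) (volume : Measure (Ef n)) _ hη
    have hks : HasCompactSupport (fun z : Ef n × Ef n => k z.swap) := 
      hk2.comp_homeomorph (Homeomorph.prodComm _ _)
    have := hl.integrable_smul_left_of_hasCompactSupport
      (hk1.continuous.comp continuous_swap) hks
    have h3 := this.integrableOn (s := A ×ˢ A)
    rw [IntegrableOn, ← Measure.prod_restrict] at h3
    refine h3.congr ?_
    rw [Measure.prod_restrict]
    refine (ae_restrict_iff' (hA.prod hA)).2 (Eventually.of_forall fun z hz => ?_)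
    simp [Function.uncurry, hz.2, Prod.swap]
  have s2 : ∫ u in A, fconvH n ℏ f g (x, u) * η u =
      (∫ u in A, (∫ v in A, k (u, v)) * η u) + ∫ u in A, (∫ v in Aᶜ, k (u, v)) * η u := by
    rw [← integral_add (hint _ a1.continuous a2) (hint _ b1.continuous b2)]
    congr 1
    funext u
    rw [← add_mul, integral_add_compl hA (hkv u)]
    rfl
  have s3 : ∀ y' yn, lGreenH n ℏ f g (x.1, y', x.2 / ℏ, yn) =
      - ∫ v in Aᶜ, k ((y', x.2 / ℏ - yn), v) := by
    intro y' yn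
    rw [lGreenH, hAdef, aux_setAc, Measure.volume_eq_prod,
      setIntegral_prod _ (hkv _).integrableOn, setIntegral_univ]
    congr 2
    funext v'
    rw [integral_Ici_eq_integral_Ioi]
    congr 1
    funext vn
    have e : ℏ * (x.2 / ℏ) = x.2 := by field_simp
    simp only [hk, mul_sub, e]
    rfl
  have s4 : ∫ y' : Eb n, ∫ yn in Ioi (0:ℝ),
        lGreenH n ℏ f g (x.1, y', x.2 / ℏ, yn) * η (y', x.2 / ℏ - yn) =
      - ∫ u in A, (∫ v in Aᶜ, k (u, v)) * η u := by
    have hi := hint _ b1.continuous b2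
    simp only [s3]
    rw [← integral_neg]
    set F : Ef n → ℂ := fun u => -((∫ v in Aᶜ, k (u, v)) * η u) with hF
    have hi' : IntegrableOn F A := hi.neg
    clear_value F
    rw [hAdef] at hi' ⊢
    rw [Measure.volume_eq_prod] at hi' ⊢
    rw [setIntegral_prod _ hi', setIntegral_univ]
    congr 1
    funext y'
    rw [← integral_Ici_eq_integral_Ioi, ← integral_indicator measurableSet_Ici,
      ← integral_indicator measurableSet_Iic, ← integral_sub_left_eq_self _ _ (x.2 / ℏ)]
    congr 1
    funext t
    by_cases ht : t ≤ x.2 / ℏ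
    · rw [indicator_of_mem (by simpa using ht), indicator_of_mem (by simpa using ht), hF]
      rw [← hAdef]
      simp [Measure.volume_eq_prod]
    · rw [indicator_of_notMem (by simpa using ht), indicator_of_notMem (by simpa using ht)]
  rw [s1, s2, s4]
  ring

theorem aux_quasi (n : ℕ) (ℏ : ℝ) (h0 : 0 < ℏ) (x : Ef n) :
    Measure.QuasiMeasurePreserving (fun v : Ef n => x - ℏ • v) volume volume :=
  (quasiMeasurePreserving_sub_left_of_right_invariant volume x).comp
    (Measure.quasiMeasurePreserving_smul volume h0.ne')

theorem aux_half (n : ℕ) : MeasurableSet {p : Ef n | 0 ≤ p.2} :=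
  measurableSet_le measurable_const measurable_snd

theorem aux_loc (n : ℕ) (ℏ : ℝ) (h0 : 0 < ℏ) (x : Ef n) (ξ : HS n) :
    LocallyIntegrable ({v : Ef n | ℏ * v.2 ≤ x.2}.indicator (fun v => ξ (x - ℏ • v))) := by
  have h1 : MemLp ({p : Ef n | 0 ≤ p.2}.indicator ξ) 2 volume :=
    (memLp_indicator_iff_restrict (aux_half n)).2 (Lp.memLp ξ)
  have hmap : Measure.map (fun v : Ef n => x - ℏ • v) volume =
      ENNReal.ofReal (abs (ℏ ^ Module.finrank ℝ (Ef n))⁻¹) • volume := by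
    have : (fun v : Ef n => x - ℏ • v) = (fun v => x - v) ∘ (fun v => ℏ • v) := rfl
    rw [this, ← Measure.map_map (by fun_prop) (by fun_prop),
      Measure.map_addHaar_smul _ h0.ne', Measure.map_smul,
      (Measure.measurePreserving_sub_left volume x).map_eq]
  have h2 : MemLp ({p : Ef n | 0 ≤ p.2}.indicator ξ) 2
      (Measure.map (fun v : Ef n => x - ℏ • v) volume) := by
    rw [hmap]
    exact h1.smul_measure ENNReal.ofReal_ne_top
  have h3 := (memLp_map_measure_iff h2.1 (by fun_prop)).1 h2
  have h4 := h3.locallyIntegrable (by norm_num)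
  suffices e : ({v : Ef n | ℏ * v.2 ≤ x.2}.indicator (fun v => ξ (x - ℏ • v))) =
      {p : Ef n | 0 ≤ p.2}.indicator ξ ∘ fun v => x - ℏ • v by
    rw [e]
    exact h4
  funext v
  by_cases hv : ℏ * v.2 ≤ x.2
  · rw [indicator_of_mem (by simpa using hv), Function.comp, indicator_of_mem (by simpa using hv)]
  · rw [indicator_of_notMem (by simpa using hv), Function.comp,
      indicator_of_notMem (by simpa using hv)]

theorem aux_id (n : ℕ) (f g : Ef n × Ef n → ℂ)
    (hf : ContDiff ℝ ∞ f) (hf' : HasCompactSupport f)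
    (hg : ContDiff ℝ ∞ g) (hg' : HasCompactSupport g)
    (ℏ : ℝ) (h0 : 0 < ℏ) (Tf Tg Tc S : HS n →L[ℂ] HS n)
    (hTf : rhoSpec n ℏ f Tf) (hTg : rhoSpec n ℏ g Tg)
    (hTc : rhoSpec n ℏ (fconvH n ℏ f g) Tc)
    (hS : kappaSpec n ℏ (lGreenH n ℏ f g) S) :
    Tf.comp Tg = Tc + S := by
  ext1 ξ
  apply Lp.ext
  have hadd : ⇑((Tc + S) ξ) =ᵐ[muPlus n] ⇑(Tc ξ) + ⇑(S ξ) := Lp.coeFn_add (Tc ξ) (S ξ)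
  have hTg' := (ae_restrict_iff' (μ := volume) (aux_half n)).1 (hTg ξ)
  filter_upwards [hTf (Tg ξ), hTc ξ, hS ξ, hadd] with x h1 h2 h3 h4
  have hset := aux_setA n ℏ h0 x
  have hp := aux_point_s5 n ℏ f g h0 hf hf' hg hg' x (fun v => ξ (x - ℏ • v)) _ hset
    (aux_loc n ℏ h0 x ξ)
  rw [h4, Pi.add_apply, h2, h3, ContinuousLinearMap.comp_apply, h1]
  have hmA : MeasurableSet {v : Ef n | ℏ * v.2 ≤ x.2} :=
    measurableSet_le (by fun_prop) (by fun_prop)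
  refine Eq.trans ?_ (hp.trans ?_)
  · refine integral_congr_ae ?_
    rw [EventuallyEq, ae_restrict_iff' hmA]
    filter_upwards [(aux_quasi n ℏ h0 x).ae hTg'] with v hv hvA
    have hv' := hv (by simpa using hvA)
    congr 1
    change (Tg ξ) (x - ℏ • v) = _
    rw [hv', ← integral_indicator hmA, ← integral_indicator 
      (measurableSet_le (by fun_prop) (by fun_prop)),
      ← integral_sub_right_eq_self _ v]
    congr 1
    funext u
    by_cases hu : ℏ * u.2 ≤ x.2
    · rw [indicator_of_mem (by simpa [mul_sub] using hu), indicator_of_mem (by simpa using hu)]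
      congr 2
      ext <;> simp <;> ring
    · rw [indicator_of_notMem (by simpa [mul_sub] using hu),
        indicator_of_notMem (by simpa using hu)]
  · congr 1
    congr 1
    funext y'
    congr 1
    funext yn
    congr 2
    ext
    · simp
    · simp; field_simp; ring

/-- For all `f,g ∈ C_c^∞(ℝⁿ×ℝⁿ)` and every `0<ℏ≤1`, the functions `f*_ℏg` and `l_ℏ(f,g)`
are smooth and compactly supported, and one has the exact operator identity
`ρ_ℏ(f) ρ_ℏ(g) = ρ_ℏ(f*_ℏg) + κ_ℏ(l_ℏ(f,g))` on `L²(ℝⁿ₊)`. -/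
theorem statement5 (n : ℕ) (hn : 1 ≤ n) (f g : Ef n × Ef n → ℂ)
    (hf : ContDiff ℝ ∞ f) (hf' : HasCompactSupport f)
    (hg : ContDiff ℝ ∞ g) (hg' : HasCompactSupport g)
    (ℏ : ℝ) (hℏ : ℏ ∈ Ioc (0:ℝ) 1) :
    ContDiff ℝ ∞ (fconvH n ℏ f g) ∧ HasCompactSupport (fconvH n ℏ f g) ∧
    ContDiff ℝ ∞ (lGreenH n ℏ f g) ∧ HasCompactSupport (lGreenH n ℏ f g) ∧
    (∀ Tf Tg Tc S : HS n →L[ℂ] HS n,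
      rhoSpec n ℏ f Tf → rhoSpec n ℏ g Tg → rhoSpec n ℏ (fconvH n ℏ f g) Tc →
      kappaSpec n ℏ (lGreenH n ℏ f g) S →
      Tf.comp Tg = Tc + S) := by
  have h0 := hℏ.1
  obtain ⟨a1, a2⟩ := aux_fconv n ℏ f g hf hf' hg hg'
  obtain ⟨b1, b2⟩ := aux_lGreen n ℏ f g h0.ne' hf hf' hg hg'
  exact ⟨a1, a2, b1, b2, fun Tf Tg Tc S hTf hTg hTc hS =>
    aux_id n f g hf hf' hg hg' ℏ h0 Tf Tg Tc S hTf hTg hTc hS⟩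
end
end
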